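/- Let n > 1000 be an integer, let F_n be the n-th Fibonacci number, let α^(1) < α^(2) < α^(3) be the three real roots of f_n(X) = X·(X − F_n)·(X − 2^n) − 1, and let (x, y) be an integer solution of x·(x − F_n·y)·(x − 2^n·y) − y³ = ±1 with |y| ≥ 2. Set β^(i) = x − α^(i)·y. If the type j of the solution satisfies j ∈ {1, 2} (i.e., |β^(j)| = min{|β^(1)|, |β^(2)|, |β^(3)|} for some j ∈ {1,2}), then log|y| > exp(n/(5.7·10^{12}) − log n − 4). -/

import Mathlib

section

open Complex Metric Finset

lemma exists_taylor_coeff_bound {ψ : ℂ → ℂ} {y : ℂ} {C : ℝ} (m : ℕ)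
    (han : AnalyticAt ℂ ψ y) (hψ : DiffContOnCl ℂ ψ (ball y 1))
    (hC : ∀ z ∈ sphere y 1, ‖ψ z‖ ≤ C) :
    ∃ c : ℕ → ℂ, (∀ i, ‖c i‖ ≤ C) ∧
      (m : ℕ∞) ≤ analyticOrderAt (fun z ↦ ψ z - ∑ i ∈ range m, c i * (z - y) ^ i) y := by
  refine ⟨fun i ↦ iteratedDeriv i ψ y / i.factorial, fun i ↦ ?_, ?_⟩
  · have h := Complex.norm_iteratedDeriv_le_of_forall_mem_sphere_norm_le i one_pos hψ hC
    rw [norm_div, Complex.norm_natCast, div_le_iff₀ (by positivity)]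
    simpa [mul_comm] using h
  · have h0 : AnalyticAt ℂ (fun z ↦ ψ (z + y)) 0 := by
      refine AnalyticAt.fun_comp (g := ψ) (f := fun z ↦ z + y) (by simpa using han) (by fun_prop)
    obtain ⟨F, hF, hFe⟩ := h0.exists_eq_sum_add_pow_mul m
    have h1 : AnalyticAt ℂ (fun z ↦ ψ z - ∑ i ∈ range m,
        (iteratedDeriv i ψ y / i.factorial) * (z - y) ^ i) y := by fun_prop
    rw [natCast_le_analyticOrderAt h1]
    refine ⟨fun z ↦ F (z - y), ?_, ?_⟩
    · exact AnalyticAt.fun_comp (g := F) (f := fun z ↦ z - y) (by simpa using hF) (by fun_prop)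
    · refine Filter.Eventually.of_forall fun z ↦ ?_
      have := hFe (z - y)
      simp only [sub_add_cancel] at this
      simp only [this, iteratedDeriv_comp_add_const, zero_add, smul_eq_mul]
      rw [sub_eq_iff_eq_add, add_comm]
      congr 1
      refine Finset.sum_congr rfl fun i _ ↦ by ring

lemma exists_eq_pow_mul_of_le_order {g : ℂ → ℂ} (hg : Differentiable ℂ g) {y : ℂ} {m : ℕ}
    (h : (m : ℕ∞) ≤ analyticOrderAt g y) :
    ∃ G : ℂ → ℂ, Differentiable ℂ G ∧ ∀ z, g z = (z - y) ^ m * G z := by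
  have han : AnalyticAt ℂ g y := hg.analyticAt y
  obtain ⟨F, hF, hFe⟩ := (natCast_le_analyticOrderAt han).1 h
  classical
  refine ⟨fun z ↦ if z = y then F y else g z / (z - y) ^ m, fun z ↦ ?_, fun z ↦ ?_⟩
  · by_cases hz : z = y
    · subst hz
      refine hF.differentiableAt.congr_of_eventuallyEq ?_
      filter_upwards [hFe] with w hw
      by_cases hwz : w = z
      · simp [hwz]
      · simp only [hwz, if_false, hw, smul_eq_mul]
        rw [mul_div_cancel_left₀ _ (pow_ne_zero _ (sub_ne_zero.2 hwz))]
    · have : DifferentiableAt ℂ (fun w ↦ g w / (w - y) ^ m) z :=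
        (hg z).div (by fun_prop) (pow_ne_zero _ (sub_ne_zero.2 hz))
      refine this.congr_of_eventuallyEq ?_
      filter_upwards [isOpen_ne.mem_nhds hz] with w hw
      simp [show w ≠ y from hw]
  · by_cases hz : z = y
    · subst hz
      simpa using hFe.self_of_nhds
    · simp only [hz, if_false]
      rw [mul_div_cancel₀ _ (pow_ne_zero _ (sub_ne_zero.2 hz))]

lemma exists_eq_prod_mul_of_le_order {ι : Type*} (s : Finset ι) (y : ι → ℂ)
    (hy : Set.InjOn y s) {g : ℂ → ℂ} (hg : Differentiable ℂ g) {m : ℕ}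
    (h : ∀ j ∈ s, (m : ℕ∞) ≤ analyticOrderAt g (y j)) :
    ∃ G : ℂ → ℂ, Differentiable ℂ G ∧ ∀ z, g z = (∏ j ∈ s, (z - y j) ^ m) * G z := by
  classical
  induction s using Finset.induction_on generalizing g with
  | empty => exact ⟨g, hg, by simp⟩
  | insert a s ha ih =>
    obtain ⟨G, hG, hGe⟩ := exists_eq_pow_mul_of_le_order hg (h a (mem_insert_self _ _))
    obtain ⟨G', hG', hGe'⟩ := ih (hy.mono (by simp)) hG (fun j hj ↦ by
      have h1 := h j (mem_insert_of_mem hj)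
      have hne : y j ≠ y a := fun hc ↦ ha (by
        have := hy (by simp [hj]) (by simp) hc
        exact this ▸ hj)
      have h2 : analyticOrderAt (fun z ↦ (z - y a) ^ m) (y j) = 0 := by
        rw [AnalyticAt.analyticOrderAt_eq_zero (by fun_prop)]
        exact pow_ne_zero _ (sub_ne_zero.2 hne)
      have h3 : g = (fun z ↦ (z - y a) ^ m) * G := by ext z; exact hGe z
      rw [h3, analyticOrderAt_mul (by fun_prop) (hG.analyticAt _), h2, zero_add] at h1
      exact h1)
    refine ⟨G', hG', fun z ↦ ?_⟩
    rw [hGe, hGe', prod_insert ha, mul_assoc]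

/-- The `j`-th of the `n` equidistant nodes `1 - n, 3 - n, …, n - 1`. -/
noncomputable def node (n j : ℕ) : ℝ := 2 * j + 1 - n

lemma node_reflect {n j : ℕ} (hj : j < n) : node n (n - 1 - j) = - node n j := by
  have : ((n - 1 - j : ℕ) : ℝ) = n - 1 - j := by
    rw [Nat.sub_sub, Nat.cast_sub (by omega)]; push_cast; ring
  unfold node; rw [this]; ring

lemma abs_node_le {n j : ℕ} (hj : j < n) : |node n j| ≤ n := by
  have : (j : ℝ) + 1 ≤ n := by exact_mod_cast hj
  have h0 : (0 : ℝ) ≤ j := by positivity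
  unfold node; rw [abs_le]; constructor <;> linarith

lemma prod_sub_node_sq {n : ℕ} (z : ℂ) :
    (∏ j ∈ range n, (z - node n j)) ^ 2 = ∏ j ∈ range n, (z ^ 2 - (node n j : ℂ) ^ 2) := by
  have h := Finset.prod_range_reflect (fun j ↦ z - (node n j : ℂ)) n
  rw [sq]
  nth_rewrite 2 [← h]
  rw [← prod_mul_distrib]
  refine prod_congr rfl fun j hj ↦ ?_
  rw [node_reflect (mem_range.1 hj)]
  push_cast; ring

lemma norm_prod_sub_node_le {n : ℕ} {x : ℝ} (hx : |x| ≤ n) :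
    ‖∏ j ∈ range n, ((x : ℂ) - node n j)‖ ≤ (n : ℝ) ^ n := by
  refine le_of_sq_le_sq ?_ (by positivity)
  rw [← norm_pow, prod_sub_node_sq, norm_prod, ← pow_mul, mul_comm n 2, pow_mul]
  calc _ ≤ ∏ j ∈ range n, ((n : ℝ) ^ 2) := by
        refine prod_le_prod (fun _ _ ↦ norm_nonneg _) fun j hj ↦ ?_
        have h1 : (x : ℂ) ^ 2 - (node n j : ℂ) ^ 2 =
            ((x ^ 2 - node n j ^ 2 : ℝ) : ℂ) := by push_cast; rfl
        rw [h1, Complex.norm_real, Real.norm_eq_abs]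
        have h2 := abs_node_le (mem_range.1 hj)
        have h3 : x ^ 2 ≤ (n : ℝ) ^ 2 := by rw [← sq_abs]; gcongr
        have h4 : node n j ^ 2 ≤ (n : ℝ) ^ 2 := by rw [← sq_abs]; gcongr
        rw [abs_le]; constructor <;> nlinarith [sq_nonneg x, sq_nonneg (node n j)]
    _ = _ := by simp

lemma le_norm_prod_sub_node {n : ℕ} {E : ℝ} (hE : 1 ≤ E) {z : ℂ} (hz : ‖z‖ = E * n) :
    (Real.sqrt (E ^ 2 - 1) * n) ^ n ≤ ‖∏ j ∈ range n, (z - node n j)‖ := by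
  have hE2 : 0 ≤ E ^ 2 - 1 := by nlinarith
  refine le_of_sq_le_sq ?_ (by positivity)
  rw [← norm_pow, prod_sub_node_sq, norm_prod, ← pow_mul, mul_comm n 2, pow_mul, mul_pow,
    Real.sq_sqrt hE2]
  calc _ = ∏ j ∈ range n, ((E ^ 2 - 1) * (n : ℝ) ^ 2) := by simp
    _ ≤ _ := by
        refine prod_le_prod (fun _ _ ↦ by positivity) fun j hj ↦ ?_
        have h2 := abs_node_le (mem_range.1 hj)
        have h4 : node n j ^ 2 ≤ (n : ℝ) ^ 2 := by rw [← sq_abs]; gcongr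
        have h5 := norm_sub_norm_le (z ^ 2) ((node n j : ℂ) ^ 2)
        have h6 : ‖(node n j : ℂ) ^ 2‖ = node n j ^ 2 := by
          rw [norm_pow, Complex.norm_real, Real.norm_eq_abs, sq_abs]
        rw [norm_pow, hz, h6] at h5
        nlinarith

lemma prod_erase_dist {n j : ℕ} (hj : j < n) :
    ∏ k ∈ (range n).erase j, |(j : ℝ) - k| = (j.factorial : ℝ) * (n - 1 - j).factorial := by
  have hsplit : (range n).erase j = range j ∪ Ico (j + 1) n := by
    ext k; simp only [mem_erase, mem_range, mem_union, mem_Ico]; omega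
  rw [hsplit, prod_union (by
    rw [disjoint_left]; intro k; simp only [mem_range, mem_Ico]; omega)]
  congr 1
  · rw [← Finset.prod_range_add_one_eq_factorial, ← Finset.prod_range_reflect]
    push_cast
    refine prod_congr rfl fun k hk ↦ ?_
    have hk := mem_range.1 hk
    rw [Nat.sub_sub, Nat.cast_sub (by omega), abs_of_nonneg (by push_cast; linarith)]
    push_cast; ring
  · rw [Finset.prod_Ico_eq_prod_range, ← Finset.prod_range_add_one_eq_factorial]
    push_cast
    rw [show n - (j + 1) = n - 1 - j by omega]
    refine prod_congr rfl fun k hk ↦ ?_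
    rw [abs_of_nonpos (by have : (0 : ℝ) ≤ k := by positivity
                          linarith)]
    ring

lemma self_pow_le_prod_erase_dist {n j : ℕ} (hj : j < n) :
    (n : ℝ) ^ n ≤ (4 * Real.exp 1) ^ n * ∏ k ∈ (range n).erase j, |(j : ℝ) - k| := by
  rw [prod_erase_dist hj]
  have h1 : (n : ℝ) ^ n ≤ Real.exp 1 ^ n * n.factorial := by
    have := Real.pow_div_factorial_le_exp (n : ℝ) (by positivity) n
    rw [div_le_iff₀ (by positivity)] at this
    rwa [← Real.exp_nat_mul, mul_one]
  have h2 : n.factorial ≤ 4 ^ n * (j.factorial * (n - 1 - j).factorial) := by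
    have h3 := Nat.choose_mul_factorial_mul_factorial (show j ≤ n - 1 by omega)
    have h4 : n.factorial = n * (n - 1).factorial :=
      (Nat.mul_factorial_pred (by omega)).symm
    rw [h4, ← h3]
    have h5 : (n - 1).choose j ≤ 2 ^ n :=
      (Nat.choose_le_two_pow _ _).trans (Nat.pow_le_pow_right (by norm_num) (by omega))
    have h6 : n ≤ 2 ^ n := Nat.lt_two_pow_self.le
    calc _ = n * (n - 1).choose j * (j.factorial * (n - 1 - j).factorial) := by ring
      _ ≤ 2 ^ n * 2 ^ n * (j.factorial * (n - 1 - j).factorial) := by gcongr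
      _ = _ := by rw [← mul_pow]; norm_num
  calc _ ≤ Real.exp 1 ^ n * n.factorial := h1
    _ ≤ Real.exp 1 ^ n * (4 ^ n * (j.factorial * (n - 1 - j).factorial)) := by
        gcongr; exact_mod_cast h2
    _ = _ := by rw [mul_pow]; ring

lemma le_norm_sub_node {n j k : ℕ} (hjk : k ≠ j) {z : ℂ} (hz : ‖z - node n j‖ ≤ 1) :
    |(j : ℝ) - k| ≤ ‖z - node n k‖ := by
  have h1 : ‖((node n j : ℂ)) - node n k‖ = 2 * |(j : ℝ) - k| := by
    rw [← Complex.ofReal_sub, Complex.norm_real, Real.norm_eq_abs]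
    unfold node
    rw [← abs_two, ← abs_mul, abs_two]; congr 1; ring
  have h2 : (1 : ℝ) ≤ |(j : ℝ) - k| := by
    have : (1 : ℤ) ≤ |(j : ℤ) - k| := Int.one_le_abs (by omega)
    exact_mod_cast this
  have h3 := norm_sub_norm_le ((node n j : ℂ) - node n k) ((node n j : ℂ) - z)
  rw [h1, norm_sub_rev _ z, show (node n j : ℂ) - node n k - (node n j - z) = z - node n k by ring]
    at h3
  linarith

lemma norm_hermite_term_le {n m j i : ℕ} (hj : j < n) (hi : i < m) {E ε : ℝ} (hE : 1 ≤ E)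
    (hε : 0 ≤ ε) {z c : ℂ} (hz : ‖z‖ ≤ E * n)
    (hc : ‖c‖ ≤ ε / (∏ k ∈ (range n).erase j, |(j : ℝ) - k|) ^ m) :
    ‖(∏ k ∈ (range n).erase j, (z - node n k) ^ m) * (c * (z - node n j) ^ i)‖ ≤
      ε * (4 * Real.exp 1 * (E + 1)) ^ (n * m) := by
  have hn : (1 : ℝ) ≤ n := by exact_mod_cast (show 1 ≤ n by omega)
  set D := ∏ k ∈ (range n).erase j, |(j : ℝ) - k| with hD
  have hDpos : 0 < D := by rw [hD, prod_erase_dist hj]; positivity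
  have hb : ∀ k < n, ‖z - node n k‖ ≤ (E + 1) * n := by
    intro k hk
    have h1 := norm_sub_le z (node n k : ℂ)
    rw [Complex.norm_real, Real.norm_eq_abs] at h1
    have := abs_node_le hk
    linarith
  have hX : 1 ≤ (E + 1) * n := by nlinarith
  have h1 : ‖∏ k ∈ (range n).erase j, (z - node n k) ^ m‖ ≤ ((E + 1) * n) ^ ((n - 1) * m) := by
    rw [norm_prod]
    calc _ ≤ ∏ k ∈ (range n).erase j, ((E + 1) * n) ^ m := by
          refine prod_le_prod (fun _ _ ↦ norm_nonneg _) fun k hk ↦ ?_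
          rw [norm_pow]
          exact pow_le_pow_left₀ (norm_nonneg _) (hb k (mem_range.1 (mem_of_mem_erase hk))) _
      _ = _ := by
          rw [prod_const, card_erase_of_mem (mem_range.2 hj), card_range, ← pow_mul, mul_comm m]
  have h2 : ‖(z - node n j) ^ i‖ ≤ ((E + 1) * n) ^ m := by
    rw [norm_pow]
    exact (pow_le_pow_left₀ (norm_nonneg _) (hb j hj) _).trans
      (pow_le_pow_right₀ hX hi.le)
  have h3 : (n : ℝ) ^ n / D ≤ (4 * Real.exp 1) ^ n := by
    rw [div_le_iff₀ hDpos]; exact self_pow_le_prod_erase_dist hj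
  rw [norm_mul, norm_mul]
  calc _ ≤ ((E + 1) * n) ^ ((n - 1) * m) * (ε / D ^ m * ((E + 1) * n) ^ m) := by gcongr
    _ = ε * ((E + 1) ^ n * ((n : ℝ) ^ n / D)) ^ m := by
        obtain ⟨n, rfl⟩ : ∃ k, n = k + 1 := ⟨n - 1, by omega⟩
        simp only [Nat.add_sub_cancel]
        rw [← mul_div_assoc, ← mul_pow, div_pow, ← pow_mul (_ * _), add_one_mul n m, pow_add]
        field_simp
    _ ≤ ε * ((E + 1) ^ n * (4 * Real.exp 1) ^ n) ^ m := by gcongr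
    _ = _ := by rw [← mul_pow, ← pow_mul, mul_comm (E + 1)]

/-- Approximate Hermite interpolation: a function that is close to functions vanishing to order `m`
at each of the nodes is small on the real segment spanned by the nodes. -/
theorem norm_le_of_approx_zeros {n m : ℕ} (hn : 0 < n) {E M ε : ℝ} (hE : 2 ≤ E)
    (hε : 0 ≤ ε) {f : ℂ → ℂ} (hf : Differentiable ℂ f) (g : ℕ → ℂ → ℂ)
    (hg : ∀ j < n, Differentiable ℂ (g j))
    (hord : ∀ j < n, (m : ℕ∞) ≤ analyticOrderAt (g j) (node n j))
    (happ : ∀ j < n, ∀ z : ℂ, ‖z - node n j‖ ≤ 1 → ‖f z - g j z‖ ≤ ε)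
    (hM : ∀ z : ℂ, ‖z‖ = E * n → ‖f z‖ ≤ M) {x : ℝ} (hx : |x| ≤ n) :
    ‖f x‖ ≤ M / Real.sqrt (E ^ 2 - 1) ^ (n * m) + 2 * ε * (22 * (E + 1)) ^ (n * m) := by
  classical
  have hn1 : (1 : ℝ) ≤ n := by exact_mod_cast hn
  set Q : ℕ → ℂ → ℂ := fun j z ↦ ∏ k ∈ (range n).erase j, (z - node n k) ^ m with hQ
  have hQd : ∀ j, Differentiable ℂ (Q j) := fun j ↦ by
    intro z; simp only [hQ]; fun_prop
  have hinj : ∀ j k : ℕ, node n j = node n k → j = k := by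
    intro j k h
    unfold node at h
    have : (j : ℝ) = k := by linarith
    exact_mod_cast this
  have hinjC : ∀ j k : ℕ, (node n j : ℂ) = node n k → j = k := fun j k h ↦
    hinj j k (by exact_mod_cast h)
  have hdist : ∀ j < n, ∀ z : ℂ, ‖z - node n j‖ ≤ 1 → Q j z ≠ 0 ∧
      (∏ k ∈ (range n).erase j, |(j : ℝ) - k|) ^ m ≤ ‖Q j z‖ := by
    intro j hj z hz
    have h1 : (∏ k ∈ (range n).erase j, |(j : ℝ) - k|) ^ m ≤ ‖Q j z‖ := by
      rw [← prod_pow, norm_prod]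
      refine prod_le_prod (fun _ _ ↦ by positivity) fun k hk ↦ ?_
      rw [norm_pow]
      gcongr
      exact le_norm_sub_node (ne_of_mem_erase hk) hz
    refine ⟨fun h0 ↦ ?_, h1⟩
    rw [h0, norm_zero, prod_erase_dist hj] at h1
    have : (0 : ℝ) < ((j.factorial : ℝ) * (n - 1 - j).factorial) ^ m := by positivity
    linarith
  have hcoef : ∀ j, ∃ c : ℕ → ℂ, j < n →
      (∀ i, ‖c i‖ ≤ ε / (∏ k ∈ (range n).erase j, |(j : ℝ) - k|) ^ m) ∧
      (m : ℕ∞) ≤ analyticOrderAt (fun z ↦ (f z - g j z) / Q j z -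
        ∑ i ∈ range m, c i * (z - node n j) ^ i) (node n j) := by
    intro j
    by_cases hj : j < n
    swap
    · exact ⟨0, fun h ↦ absurd h hj⟩
    have hd : DiffContOnCl ℂ (fun z ↦ (f z - g j z) / Q j z) (ball (node n j : ℂ) 1) := by
      refine DifferentiableOn.diffContOnCl fun z hz ↦ ?_
      rw [closure_ball _ one_ne_zero, mem_closedBall, dist_eq_norm] at hz
      exact (((hf z).sub (hg j hj z)).div (hQd j z) (hdist j hj z hz).1).differentiableWithinAt
    obtain ⟨c, hc, hc'⟩ := exists_taylor_coeff_bound (y := (node n j : ℂ))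
      (C := ε / (∏ k ∈ (range n).erase j, |(j : ℝ) - k|) ^ m) m
      (ψ := fun z ↦ (f z - g j z) / Q j z)
      (((hf.analyticAt _).sub ((hg j hj).analyticAt _)).div ((hQd j).analyticAt _)
        (hdist j hj _ (by simp)).1) hd (fun z hz ↦ by
          rw [mem_sphere, dist_eq_norm] at hz
          have h1 := hdist j hj z hz.le
          rw [norm_div]
          have hpos : 0 < (∏ k ∈ (range n).erase j, |(j : ℝ) - k|) ^ m := by
            rw [prod_erase_dist hj]; positivity
          gcongr
          · exact happ j hj z hz.le
          · exact h1.2)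
    exact ⟨c, fun _ ↦ ⟨hc, hc'⟩⟩
  choose c hc using hcoef
  set H : ℂ → ℂ := fun z ↦ ∑ j ∈ range n, Q j z * ∑ i ∈ range m, c j i * (z - node n j) ^ i with hH
  have hHd : Differentiable ℂ H := by
    intro z
    simp only [hH]
    refine DifferentiableAt.fun_sum fun j _ ↦ (hQd j z).mul ?_
    fun_prop
  set A : ℝ := (22 * (E + 1)) ^ (n * m) with hA
  have hHb : ∀ z : ℂ, ‖z‖ ≤ E * n → ‖H z‖ ≤ ε * A := by
    intro z hz
    calc ‖H z‖ ≤ ∑ j ∈ range n, ∑ i ∈ range m, ε * (4 * Real.exp 1 * (E + 1)) ^ (n * m) := by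
          simp only [hH, mul_sum]
          refine (norm_sum_le _ _).trans (sum_le_sum fun j hj ↦ (norm_sum_le _ _).trans
            (sum_le_sum fun i hi ↦ ?_))
          exact norm_hermite_term_le (mem_range.1 hj) (mem_range.1 hi) (by linarith) hε hz
            ((hc j (mem_range.1 hj)).1 i)
      _ = (n * m : ℕ) * (ε * (4 * Real.exp 1 * (E + 1)) ^ (n * m)) := by
          simp [mul_assoc]
      _ ≤ 2 ^ (n * m) * (ε * (4 * Real.exp 1 * (E + 1)) ^ (n * m)) := by
          gcongr
          exact_mod_cast Nat.lt_two_pow_self.le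
      _ = ε * (2 * (4 * Real.exp 1 * (E + 1))) ^ (n * m) := by
          rw [mul_pow (2 : ℝ)]; ring
      _ ≤ ε * A := by
          rw [hA]
          have := Real.exp_one_lt_d9
          refine mul_le_mul_of_nonneg_left (pow_le_pow_left₀ (by positivity) ?_ _) hε
          nlinarith
  have hfH : ∀ j ∈ range n, (m : ℕ∞) ≤ analyticOrderAt (fun z ↦ f z - H z) (node n j) := by
    intro j hj'
    have hj := mem_range.1 hj'
    have e1 : Filter.EventuallyEq (nhds (node n j : ℂ)) (fun z ↦ f z - H z)
        (g j + Q j * (fun z ↦ (f z - g j z) / Q j z -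
          ∑ i ∈ range m, c j i * (z - node n j) ^ i) - (fun z ↦ ∑ k ∈ (range n).erase j,
          Q k z * ∑ i ∈ range m, c k i * (z - node n k) ^ i)) := by
      have : ∀ᶠ z : ℂ in nhds (node n j : ℂ), ‖z - node n j‖ ≤ 1 := by
        filter_upwards [closedBall_mem_nhds (node n j : ℂ) one_pos] with z hz
        rwa [mem_closedBall, dist_eq_norm] at hz
      filter_upwards [this] with z hz
      have h0 := (hdist j hj z hz).1
      simp only [hH, Pi.add_apply, Pi.sub_apply, Pi.mul_apply]
      rw [← add_sum_erase _ _ hj', mul_sub, mul_div_cancel₀ _ h0]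
      ring
    rw [analyticOrderAt_congr e1]
    refine le_trans (le_min ?_ ?_) le_analyticOrderAt_sub
    · refine le_trans (le_min (hord j hj) ?_) le_analyticOrderAt_add
      rw [analyticOrderAt_mul ((hQd j).analyticAt _)]
      · exact le_add_left (hc j hj).2
      · refine AnalyticAt.fun_sub (((hf.analyticAt _).sub ((hg j hj).analyticAt _)).div
          ((hQd j).analyticAt _) (hdist j hj _ (by simp)).1) (by fun_prop)
    · rw [natCast_le_analyticOrderAt (by
        refine Differentiable.analyticAt (fun z ↦ DifferentiableAt.fun_sum fun k _ ↦
          (hQd k z).mul (by fun_prop)) _)]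
      refine ⟨fun z ↦ ∑ k ∈ (range n).erase j, (∏ l ∈ ((range n).erase k).erase j,
        (z - node n l) ^ m) * ∑ i ∈ range m, c k i * (z - node n k) ^ i, by
          refine Differentiable.analyticAt (fun z ↦ DifferentiableAt.fun_sum fun k _ ↦ by
            fun_prop) _, Filter.Eventually.of_forall fun z ↦ ?_⟩
      rw [smul_eq_mul, mul_sum]
      refine sum_congr rfl fun k hk ↦ ?_
      have hjk : j ∈ (range n).erase k := mem_erase.2 ⟨(ne_of_mem_erase hk).symm, hj'⟩
      simp only [hQ]
      rw [← mul_prod_erase _ _ hjk]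
      ring
  obtain ⟨G, hG, hGe⟩ := exists_eq_prod_mul_of_le_order (range n) (fun j ↦ (node n j : ℂ))
    (fun j _ k _ h ↦ hinjC j k h) (hf.sub hHd) hfH
  set S := Real.sqrt (E ^ 2 - 1) with hS
  have hS1 : 1 ≤ S := by rw [hS, Real.one_le_sqrt]; nlinarith
  have hSn : 0 < (S * n) ^ (n * m) := by positivity
  have hGb : ∀ z ∈ frontier (ball (0 : ℂ) (E * n)), ‖G z‖ ≤ (M + ε * A) / (S * n) ^ (n * m) := by
    intro z hz
    rw [frontier_ball _ (by positivity), mem_sphere, dist_zero_right] at hz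
    have h1 := hGe z
    simp only [Pi.sub_apply] at h1
    have h2 : ‖f z - H z‖ ≤ M + ε * A :=
      (norm_sub_le _ _).trans (add_le_add (hM z hz) (hHb z hz.le))
    rw [h1, norm_mul, prod_pow, norm_pow] at h2
    rw [le_div_iff₀ hSn, mul_comm, pow_mul]
    refine le_trans ?_ h2
    gcongr
    exact le_norm_prod_sub_node (by linarith) hz
  have hxn : ‖(x : ℂ)‖ ≤ n := by rwa [Complex.norm_real, Real.norm_eq_abs]
  have hxE : ‖(x : ℂ)‖ ≤ E * n := hxn.trans (by nlinarith)
  have hGx : ‖G x‖ ≤ (M + ε * A) / (S * n) ^ (n * m) :=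
    Complex.norm_le_of_forall_mem_frontier_norm_le isBounded_ball hG.diffContOnCl hGb
      (by rw [closure_ball _ (by positivity), mem_closedBall, dist_zero_right]; exact hxE)
  have h3 : f x = H x + (∏ j ∈ range n, ((x : ℂ) - node n j) ^ m) * G x := by
    rw [← hGe]; simp
  have hMA : 0 ≤ M + ε * A := by
    have := (norm_nonneg (G x)).trans hGx
    rw [le_div_iff₀ hSn, zero_mul] at this
    exact this
  have hA0 : 0 ≤ ε * A := by positivity
  calc ‖f x‖ ≤ ‖H x‖ + ‖∏ j ∈ range n, ((x : ℂ) - node n j)‖ ^ m * ‖G x‖ := by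
        rw [h3]
        refine (norm_add_le _ _).trans ?_
        rw [norm_mul, prod_pow, norm_pow]
    _ ≤ ε * A + ((n : ℝ) ^ n) ^ m * ((M + ε * A) / (S * n) ^ (n * m)) := by
        gcongr
        · exact hHb _ hxE
        · exact norm_prod_sub_node_le hx
    _ = ε * A + (M + ε * A) / S ^ (n * m) := by
        rw [← pow_mul, mul_pow]
        field_simp
    _ = ε * A + (M / S ^ (n * m) + ε * A / S ^ (n * m)) := by rw [add_div]
    _ ≤ ε * A + (M / S ^ (n * m) + ε * A) := by
        gcongr
        exact div_le_self hA0 (one_le_pow₀ hS1)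
    _ = _ := by ring

end

section

open Finset IntermediateField

lemma one_le_norm_mul_pow_of_isIntegral {K : Type*} [Field K] [NumberField K] {x : K}
    (hx : IsIntegral ℤ x) (hx0 : x ≠ 0) (σ₀ : K →+* ℂ) {M : ℝ} (hM : ∀ σ : K →+* ℂ, ‖σ x‖ ≤ M)
    {D : ℕ} (hD : Module.finrank ℚ K ≤ D + 1) : 1 ≤ ‖σ₀ x‖ * M ^ D := by
  classical
  obtain ⟨N, hN⟩ : ∃ N : ℤ, (N : ℚ) = Algebra.norm ℚ x := by
    have := Algebra.isIntegral_norm ℚ hx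
    exact IsIntegrallyClosed.isIntegral_iff.1 this
  have hN0 : N ≠ 0 := by
    rintro rfl
    rw [Int.cast_zero, eq_comm, Algebra.norm_eq_zero_iff] at hN
    exact hx0 hN
  have hprod : ∏ σ : K →+* ℂ, ‖σ x‖ = |(N : ℝ)| := by
    have h1 := Algebra.norm_eq_prod_embeddings ℚ ℂ x
    rw [← hN] at h1
    have h2 : ∏ σ : K →+* ℂ, σ x = ∏ σ : K →ₐ[ℚ] ℂ, σ x :=
      Fintype.prod_equiv (RingHom.equivRatAlgHom K ℂ) _ _ (fun σ ↦ rfl)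
    rw [← norm_prod, h2, ← h1]
    simp
  have hN1 : (1 : ℝ) ≤ |(N : ℝ)| := by exact_mod_cast Int.one_le_abs hN0
  have hM0 : 0 ≤ M := (norm_nonneg _).trans (hM σ₀)
  have hcard : (univ.erase σ₀ : Finset (K →+* ℂ)).card ≤ D := by
    rw [card_erase_of_mem (mem_univ _), card_univ, NumberField.Embeddings.card]
    omega
  have hM1 : 1 ≤ M := by
    by_contra hlt
    push Not at hlt
    have : ∏ σ : K →+* ℂ, ‖σ x‖ < 1 := by
      rw [← mul_prod_erase _ _ (mem_univ σ₀)]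
      calc _ ≤ M * 1 := by
            gcongr
            · exact hM _
            · exact prod_le_one (fun _ _ ↦ norm_nonneg _) fun σ _ ↦ (hM σ).trans hlt.le
        _ < 1 := by linarith
    linarith
  rw [← hprod, ← mul_prod_erase _ _ (mem_univ σ₀)] at hN1
  refine hN1.trans (mul_le_mul_of_nonneg_left ?_ (norm_nonneg _))
  calc _ ≤ ∏ σ ∈ univ.erase σ₀, M := prod_le_prod (fun _ _ ↦ norm_nonneg _) fun σ _ ↦ hM σ
    _ = M ^ _ := prod_const _
    _ ≤ M ^ D := pow_le_pow_right₀ hM1 hcard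

lemma finrank_adjoin_simple_le {F : Type*} [Field F] [Algebra F ℝ] {x : ℝ} {p : Polynomial F}
    (hp : p.Monic) (hx : Polynomial.aeval x p = 0) :
    FiniteDimensional F F⟮x⟯ ∧ Module.finrank F F⟮x⟯ ≤ p.natDegree := by
  have hInt : IsIntegral F x := ⟨p, hp, by simpa [Polynomial.aeval_def] using hx⟩
  refine ⟨adjoin.finiteDimensional hInt, ?_⟩
  rw [adjoin.finrank hInt]
  exact Polynomial.natDegree_le_natDegree (minpoly.min F x hp hx)

noncomputable def rootPhi : ℝ := Real.sqrt Real.goldenRatio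
noncomputable def rootSqrtFive : ℝ := Real.sqrt (Real.sqrt 5)
noncomputable def rootTwo : ℝ := Real.sqrt 2

lemma rootPhi_sq : rootPhi ^ 2 = Real.goldenRatio := Real.sq_sqrt Real.goldenRatio_pos.le
lemma rootSqrtFive_sq : rootSqrtFive ^ 2 = Real.sqrt 5 := Real.sq_sqrt (Real.sqrt_nonneg _)
lemma rootTwo_sq : rootTwo ^ 2 = 2 := Real.sq_sqrt (by norm_num)
lemma rootPhi_pos : 0 < rootPhi := Real.sqrt_pos.2 Real.goldenRatio_pos
lemma rootSqrtFive_pos : 0 < rootSqrtFive := Real.sqrt_pos.2 (by positivity)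
lemma rootTwo_pos : 0 < rootTwo := Real.sqrt_pos.2 (by norm_num)

lemma exists_numberField_sqrt {K : Type} [Field K] [NumberField K] (ι : K →+* ℝ) (a : K)
    {x : ℝ} (hx : x ^ 2 = ι a) : ∃ (L : Type) (_ : Field L) (_ : NumberField L) (ι' : L →+* ℝ)
    (j : K →+* L) (u : L), (∀ z, ι' (j z) = ι z) ∧ ι' u = x ∧
      Module.finrank ℚ L ≤ Module.finrank ℚ K * 2 := by
  let _ : Algebra K ℝ := ι.toAlgebra
  obtain ⟨hf, hd⟩ := finrank_adjoin_simple_le (F := K) (x := x)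
    (p := Polynomial.X ^ 2 - Polynomial.C a) (Polynomial.monic_X_pow_sub_C _ (by norm_num))
    (by
      have : algebraMap K ℝ a = x ^ 2 := hx.symm
      simp [this])
  rw [Polynomial.natDegree_X_pow_sub_C] at hd
  have hff : FiniteDimensional ℚ K⟮x⟯ := FiniteDimensional.trans ℚ K K⟮x⟯
  refine ⟨K⟮x⟯, inferInstance, { to_charZero := inferInstance, to_finiteDimensional := hff },
    algebraMap K⟮x⟯ ℝ, algebraMap K K⟮x⟯, AdjoinSimple.gen K x, fun z ↦ rfl,
    AdjoinSimple.coe_gen K x, ?_⟩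
  rw [← Module.finrank_mul_finrank ℚ K K⟮x⟯]
  gcongr

lemma exists_numberField_roots : ∃ (K : Type) (_ : Field K) (_ : NumberField K) (ι : K →+* ℝ)
    (u₁ u₂ u₃ : K), Module.finrank ℚ K ≤ 16 ∧ ι u₁ = rootPhi ∧ ι u₂ = rootSqrtFive ∧
      ι u₃ = rootTwo := by
  obtain ⟨K₀, _, _, ι₀, j₀, w, -, hw, hd₀⟩ := exists_numberField_sqrt (algebraMap ℚ ℝ) 5
    (x := Real.sqrt 5) (by simp)
  obtain ⟨K₁, _, _, ι₁, j₁, u₂, hj₁, hu₂, hd₁⟩ := exists_numberField_sqrt ι₀ w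
    (x := rootSqrtFive) (by rw [rootSqrtFive_sq, hw])
  obtain ⟨K₂, _, _, ι₂, j₂, u₁, hj₂, hu₁, hd₂⟩ := exists_numberField_sqrt ι₁ ((1 + j₁ w) / 2)
    (x := rootPhi) (by
      have : ι₁ 2 = 2 := map_ofNat ι₁ 2
      simp [rootPhi_sq, hj₁, hw, Real.goldenRatio, this])
  obtain ⟨K₃, i₃, n₃, ι₃, j₃, u₃, hj₃, hu₃, hd₃⟩ := exists_numberField_sqrt ι₂ 2
    (x := rootTwo) (by rw [rootTwo_sq]; exact (map_ofNat ι₂ 2).symm)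
  refine ⟨K₃, i₃, n₃, ι₃, j₃ u₁, j₃ (j₂ u₂), u₃, ?_, by rw [hj₃, hu₁], by rw [hj₃, hj₂, hu₂], hu₃⟩
  have : Module.finrank ℚ ℚ = 1 := Module.finrank_self ℚ
  omega

lemma one_lt_rootPhi : 1 < rootPhi := by
  rw [rootPhi, Real.lt_sqrt (by norm_num)]; simpa using Real.one_lt_goldenRatio
lemma one_lt_rootSqrtFive : 1 < rootSqrtFive := by
  rw [rootSqrtFive, Real.lt_sqrt (by norm_num), Real.lt_sqrt (by norm_num)]; norm_num
lemma one_lt_rootTwo : 1 < rootTwo := by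
  rw [rootTwo, Real.lt_sqrt (by norm_num)]; norm_num

/-- Liouville's inequality for integer combinations of monomials in the three square roots. -/
theorem one_le_abs_sum_mul_pow {κ : Type*} (s : Finset κ) (a : κ → ℤ) (e₁ e₂ e₃ : κ → ℕ)
    {E₁ E₂ E₃ : ℕ} (h₁ : ∀ i ∈ s, e₁ i ≤ E₁) (h₂ : ∀ i ∈ s, e₂ i ≤ E₂) (h₃ : ∀ i ∈ s, e₃ i ≤ E₃)
    {v M : ℝ} (hv : v = ∑ i ∈ s, a i * (rootPhi ^ e₁ i * rootSqrtFive ^ e₂ i * rootTwo ^ e₃ i))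
    (hv0 : v ≠ 0)
    (hM : (∑ i ∈ s, |(a i : ℝ)|) * (rootPhi ^ E₁ * rootSqrtFive ^ E₂ * rootTwo ^ E₃) ≤ M) :
    1 ≤ |v| * M ^ 15 := by
  obtain ⟨K, _, _, ι, u₁, u₂, u₃, hd, hu₁, hu₂, hu₃⟩ := exists_numberField_roots
  have q₁ : u₁ ^ 4 = u₁ ^ 2 + 1 := ι.injective (by
    have := Real.goldenRatio_sq
    rw [← rootPhi_sq, ← pow_mul] at this
    simpa [hu₁] using this)
  have q₂ : u₂ ^ 4 = 5 := ι.injective (by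
    have : (rootSqrtFive ^ 2) ^ 2 = 5 := by rw [rootSqrtFive_sq, Real.sq_sqrt (by norm_num)]
    rw [← pow_mul] at this
    rw [map_pow, hu₂, this]; exact (map_ofNat ι 5).symm)
  have q₃ : u₃ ^ 2 = 2 := ι.injective (by rw [map_pow, hu₃, rootTwo_sq]; exact (map_ofNat ι 2).symm)
  have i₁ : IsIntegral ℤ u₁ := by
    refine ⟨Polynomial.X ^ 4 - (Polynomial.X ^ 2 + 1), by monicity!, ?_⟩
    simp [q₁]
  have i₂ : IsIntegral ℤ u₂ := ⟨Polynomial.X ^ 4 - Polynomial.C 5,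
    Polynomial.monic_X_pow_sub_C _ (by norm_num), by simp [q₂]⟩
  have i₃ : IsIntegral ℤ u₃ := ⟨Polynomial.X ^ 2 - Polynomial.C 2,
    Polynomial.monic_X_pow_sub_C _ (by norm_num), by simp [q₃]⟩
  set x : K := ∑ i ∈ s, a i * (u₁ ^ e₁ i * u₂ ^ e₂ i * u₃ ^ e₃ i) with hx
  have hιx : ι x = v := by simp [hx, hv, hu₁, hu₂, hu₃]
  have hxint : IsIntegral ℤ x := by
    refine IsIntegral.sum _ fun i _ ↦ ?_
    exact (isIntegral_algebraMap (R := ℤ) (x := a i)).mul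
      (((i₁.pow _).mul (i₂.pow _)).mul (i₃.pow _))
  have hx0 : x ≠ 0 := by
    rintro h0; rw [h0, map_zero] at hιx; exact hv0 hιx.symm
  have key := one_le_norm_mul_pow_of_isIntegral hxint hx0 (Complex.ofRealHom.comp ι) (M := M)
    (fun σ ↦ ?_) (D := 15) hd
  · simpa [hιx] using key
  have n₁ : ‖σ u₁‖ ≤ rootPhi := by
    have h := congrArg σ q₁
    simp only [map_pow, map_add, map_one] at h
    have h' : ‖σ u₁‖ ^ 4 ≤ ‖σ u₁‖ ^ 2 + 1 := by
      rw [← norm_pow, h]; exact (norm_add_le _ _).trans (by simp)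
    have hg := Real.goldenRatio_sq
    have hgp := Real.goldenRatio_pos
    refine Real.le_sqrt_of_sq_le ?_
    by_contra hlt
    push Not at hlt
    have h4 : ‖σ u₁‖ ^ 4 = (‖σ u₁‖ ^ 2) ^ 2 := by ring
    rw [h4] at h'
    nlinarith [Real.one_lt_goldenRatio]
  have n₂ : ‖σ u₂‖ ≤ rootSqrtFive := by
    have h := congrArg (fun z ↦ ‖σ z‖) q₂
    simp only [map_pow, norm_pow] at h
    refine Real.le_sqrt_of_sq_le (Real.le_sqrt_of_sq_le ?_)
    rw [← pow_mul, h, map_ofNat σ 5]; simp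
  have n₃ : ‖σ u₃‖ ≤ rootTwo := by
    have h := congrArg (fun z ↦ ‖σ z‖) q₃
    simp only [map_pow, norm_pow] at h
    refine Real.le_sqrt_of_sq_le ?_
    rw [h, map_ofNat σ 2]; simp
  refine le_trans ?_ hM
  rw [hx, map_sum, sum_mul]
  refine (norm_sum_le _ _).trans (sum_le_sum fun i hi ↦ ?_)
  simp only [map_mul, map_pow, map_intCast, norm_mul, norm_pow, Complex.norm_intCast]
  have := rootPhi_pos
  have := rootSqrtFive_pos
  gcongr
  · exact (pow_le_pow_left₀ (norm_nonneg _) n₁ _).trans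
      (pow_le_pow_right₀ one_lt_rootPhi.le (h₁ i hi))
  · exact (pow_le_pow_left₀ (norm_nonneg _) n₂ _).trans
      (pow_le_pow_right₀ one_lt_rootSqrtFive.le (h₂ i hi))
  · exact (pow_le_pow_left₀ (norm_nonneg _) n₃ _).trans
      (pow_le_pow_right₀ one_lt_rootTwo.le (h₃ i hi))

end

section

open Finset

/-- The field obtained from `k` by adjoining a square root `x` of an element of `k`. -/
def quadAdjoin (k : Subfield ℝ) (x : ℝ) (hx : x ^ 2 ∈ k) : Subfield ℝ where
  carrier := {z | ∃ a ∈ k, ∃ b ∈ k, z = a + b * x}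
  mul_mem' := by
    rintro _ _ ⟨a, ha, b, hb, rfl⟩ ⟨c, hc, d, hd, rfl⟩
    refine ⟨a * c + b * d * x ^ 2, add_mem (mul_mem ha hc) (mul_mem (mul_mem hb hd) hx),
      a * d + b * c, add_mem (mul_mem ha hd) (mul_mem hb hc), by ring⟩
  one_mem' := ⟨1, one_mem _, 0, zero_mem _, by ring⟩
  add_mem' := by
    rintro _ _ ⟨a, ha, b, hb, rfl⟩ ⟨c, hc, d, hd, rfl⟩
    exact ⟨a + c, add_mem ha hc, b + d, add_mem hb hd, by ring⟩
  zero_mem' := ⟨0, zero_mem _, 0, zero_mem _, by ring⟩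
  neg_mem' := by
    rintro _ ⟨a, ha, b, hb, rfl⟩
    exact ⟨-a, neg_mem ha, -b, neg_mem hb, by ring⟩
  inv_mem' := by
    rintro _ ⟨a, ha, b, hb, rfl⟩
    have hN : a ^ 2 - b ^ 2 * x ^ 2 ∈ k := sub_mem (pow_mem ha 2) (mul_mem (pow_mem hb 2) hx)
    by_cases h0 : a - b * x = 0
    · refine ⟨(2 * a)⁻¹, inv_mem (mul_mem (by exact_mod_cast natCast_mem k 2) ha), 0,
        zero_mem _, ?_⟩
      rw [show b * x = a by linarith]; ring
    by_cases h1 : a + b * x = 0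
    · exact ⟨0, zero_mem _, 0, zero_mem _, by simp [h1]⟩
    · refine ⟨a * (a ^ 2 - b ^ 2 * x ^ 2)⁻¹, mul_mem ha (inv_mem hN),
        -b * (a ^ 2 - b ^ 2 * x ^ 2)⁻¹, mul_mem (neg_mem hb) (inv_mem hN), ?_⟩
      have : a ^ 2 - b ^ 2 * x ^ 2 = (a + b * x) * (a - b * x) := by ring
      rw [this]
      field_simp
      ring

variable {k : Subfield ℝ} {x y : ℝ} {hx : x ^ 2 ∈ k}

lemma mem_quadAdjoin_of_mem {z : ℝ} (hz : z ∈ k) : z ∈ quadAdjoin k x hx :=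
  ⟨z, hz, 0, zero_mem _, by ring⟩

lemma add_mul_mem_quadAdjoin {a b : ℝ} (ha : a ∈ k) (hb : b ∈ k) :
    a + b * x ∈ quadAdjoin k x hx := ⟨a, ha, b, hb, rfl⟩

lemma mem_or_mul_mem_of_mem_quadAdjoin (hxk : x ∉ k) (hy : y ^ 2 ∈ k)
    (h : y ∈ quadAdjoin k x hx) : y ∈ k ∨ x * y ∈ k := by
  obtain ⟨a, ha, b, hb, rfl⟩ := h
  by_cases hb0 : b = 0
  · left; simpa [hb0] using ha
  by_cases ha0 : a = 0
  · right
    rw [ha0, zero_add, show x * (b * x) = b * x ^ 2 by ring]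
    exact mul_mem hb hx
  · exfalso
    apply hxk
    have h2 : (2 : ℝ) ∈ k := by exact_mod_cast natCast_mem k 2
    have : x = ((a + b * x) ^ 2 - a ^ 2 - b ^ 2 * x ^ 2) / (2 * a * b) := by
      field_simp; ring
    rw [this]
    exact div_mem (sub_mem (sub_mem hy (pow_mem ha 2)) (mul_mem (pow_mem hb 2) hx))
      (mul_mem (mul_mem h2 ha) hb)

lemma eq_zero_of_add_mul_eq_zero (hxk : x ∉ k) {a b : ℝ} (ha : a ∈ k) (hb : b ∈ k)
    (h : a + b * x = 0) : a = 0 ∧ b = 0 := by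
  have hb0 : b = 0 := by
    by_contra hb0
    apply hxk
    have : x = -a / b := by field_simp; linarith
    rw [this]; exact div_mem (neg_mem ha) hb
  exact ⟨by simpa [hb0] using h, hb0⟩

/-- Linear independence of the monomials in three square roots over `k`. -/
lemma eq_zero_of_sum_sqrt_monomials {u₁ u₂ u₃ : ℝ}
    (h₁ : u₁ ^ 2 ∈ k) (h₂ : u₂ ^ 2 ∈ k) (h₃ : u₃ ^ 2 ∈ k)
    (n₁ : u₁ ∉ k) (n₂ : u₂ ∉ k) (n₁₂ : u₁ * u₂ ∉ k) (n₃ : u₃ ∉ k) (n₁₃ : u₁ * u₃ ∉ k)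
    (n₂₃ : u₂ * u₃ ∉ k) (n₁₂₃ : u₁ * (u₂ * u₃) ∉ k)
    {a : Fin 2 → Fin 2 → Fin 2 → ℝ} (ha : ∀ i j l, a i j l ∈ k)
    (h : ∑ i, ∑ j, ∑ l, a i j l * (u₁ ^ (i : ℕ) * u₂ ^ (j : ℕ) * u₃ ^ (l : ℕ)) = 0) :
    ∀ i j l, a i j l = 0 := by
  let k₁ := quadAdjoin k u₁ h₁
  have m₂ : u₂ ∉ k₁ := fun hm ↦ (mem_or_mul_mem_of_mem_quadAdjoin n₁ h₂ hm).elim n₂ n₁₂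
  have m₃ : u₃ ∉ k₁ := fun hm ↦ (mem_or_mul_mem_of_mem_quadAdjoin n₁ h₃ hm).elim n₃ n₁₃
  have m₂₃ : u₂ * u₃ ∉ k₁ := fun hm ↦
    (mem_or_mul_mem_of_mem_quadAdjoin n₁ (by rw [mul_pow]; exact mul_mem h₂ h₃) hm).elim n₂₃ n₁₂₃
  let k₂ := quadAdjoin k₁ u₂ (mem_quadAdjoin_of_mem h₂)
  have p₃ : u₃ ∉ k₂ := fun hm ↦
    (mem_or_mul_mem_of_mem_quadAdjoin m₂ (mem_quadAdjoin_of_mem h₃) hm).elim m₃ m₂₃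
  have e : ∀ j l, a 0 j l + a 1 j l * u₁ ∈ k₁ := fun j l ↦
    add_mul_mem_quadAdjoin (ha _ _ _) (ha _ _ _)
  have e' : ∀ l, (a 0 0 l + a 1 0 l * u₁) + (a 0 1 l + a 1 1 l * u₁) * u₂ ∈ k₂ := fun l ↦
    add_mul_mem_quadAdjoin (e _ _) (e _ _)
  have h0 : ((a 0 0 0 + a 1 0 0 * u₁) + (a 0 1 0 + a 1 1 0 * u₁) * u₂) +
      ((a 0 0 1 + a 1 0 1 * u₁) + (a 0 1 1 + a 1 1 1 * u₁) * u₂) * u₃ = 0 := by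
    rw [← h]; simp [Fin.sum_univ_two]; ring
  obtain ⟨q0, q1⟩ := eq_zero_of_add_mul_eq_zero p₃ (e' 0) (e' 1) h0
  obtain ⟨q00, q01⟩ := eq_zero_of_add_mul_eq_zero m₂ (e _ _) (e _ _) q0
  obtain ⟨q10, q11⟩ := eq_zero_of_add_mul_eq_zero m₂ (e _ _) (e _ _) q1
  obtain ⟨r1, r2⟩ := eq_zero_of_add_mul_eq_zero n₁ (ha _ _ _) (ha _ _ _) q00
  obtain ⟨r3, r4⟩ := eq_zero_of_add_mul_eq_zero n₁ (ha _ _ _) (ha _ _ _) q01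
  obtain ⟨r5, r6⟩ := eq_zero_of_add_mul_eq_zero n₁ (ha _ _ _) (ha _ _ _) q10
  obtain ⟨r7, r8⟩ := eq_zero_of_add_mul_eq_zero n₁ (ha _ _ _) (ha _ _ _) q11
  intro i j l
  fin_cases i <;> fin_cases j <;> fin_cases l <;> assumption

/-- The field `ℚ(√5)` inside `ℝ`. -/
noncomputable def ratSqrtFive : Subfield ℝ :=
  quadAdjoin (Rat.castHom ℝ).fieldRange (Real.sqrt 5) ⟨5, by simp⟩

lemma mem_ratSqrtFive {z : ℝ} : z ∈ ratSqrtFive ↔ ∃ a b : ℚ, z = a + b * Real.sqrt 5 := by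
  constructor
  · rintro ⟨_, ⟨a, rfl⟩, _, ⟨b, rfl⟩, rfl⟩; exact ⟨a, b, by simp⟩
  · rintro ⟨a, b, rfl⟩; exact ⟨a, ⟨a, by simp⟩, b, ⟨b, by simp⟩, rfl⟩

lemma irrational_sqrt_five : Irrational (Real.sqrt 5) := by
  simpa using Nat.Prime.irrational_sqrt (show Nat.Prime 5 by norm_num)

lemma rat_add_mul_sqrt_five_inj {a b c d : ℚ}
    (h : (a : ℝ) + b * Real.sqrt 5 = c + d * Real.sqrt 5) : a = c ∧ b = d := by
  have hbd : b = d := by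
    by_contra hne
    apply irrational_sqrt_five
    have hne' : (b : ℝ) - d ≠ 0 := by
      rw [sub_ne_zero]; exact_mod_cast hne
    refine ⟨(c - a) / (b - d), ?_⟩
    push_cast
    field_simp
    linarith
  refine ⟨?_, hbd⟩
  subst hbd
  have : (a : ℝ) = c := by linarith
  exact_mod_cast this

/-- A square root of `p + q√5` lies outside `ℚ(√5)` unless the norm `p² - 5q²` is a square. -/
lemma not_mem_ratSqrtFive {w : ℝ} {p q : ℚ} (hw : w ^ 2 = p + q * Real.sqrt 5)
    (hns : ∀ r : ℚ, r ^ 2 ≠ p ^ 2 - 5 * q ^ 2) : w ∉ ratSqrtFive := by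
  rw [mem_ratSqrtFive]
  rintro ⟨a, b, rfl⟩
  have h5 : Real.sqrt 5 ^ 2 = 5 := Real.sq_sqrt (by norm_num)
  have h : ((a ^ 2 + 5 * b ^ 2 : ℚ) : ℝ) + (2 * a * b : ℚ) * Real.sqrt 5 = p + q * Real.sqrt 5 := by
    rw [← hw]; push_cast; linear_combination (-(b : ℝ) ^ 2) * h5
  obtain ⟨h1, h2⟩ := rat_add_mul_sqrt_five_inj h
  apply hns (a ^ 2 - 5 * b ^ 2)
  rw [← h1, ← h2]; ring

lemma rat_sq_ne_five (r : ℚ) : r ^ 2 ≠ 5 := by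
  intro h
  apply irrational_sqrt_five
  refine ⟨|r|, ?_⟩
  rw [eq_comm, Real.sqrt_eq_iff_mul_self_eq (by norm_num) (by positivity)]
  push_cast
  rw [abs_mul_abs_self]
  exact_mod_cast (by rw [← sq, h] : r * r = 5).symm

lemma sqrt_five_mem_ratSqrtFive : Real.sqrt 5 ∈ ratSqrtFive := mem_ratSqrtFive.2 ⟨0, 1, by simp⟩

lemma goldenRatio_mem_ratSqrtFive : Real.goldenRatio ∈ ratSqrtFive :=
  mem_ratSqrtFive.2 ⟨1 / 2, 1 / 2, by simp [Real.goldenRatio]; ring⟩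

lemma eq_zero_of_sum_root_monomials {a : Fin 2 → Fin 2 → Fin 2 → ℝ}
    (ha : ∀ i j l, a i j l ∈ ratSqrtFive)
    (h : ∑ i, ∑ j, ∑ l, a i j l *
      (rootPhi ^ (i : ℕ) * rootSqrtFive ^ (j : ℕ) * rootTwo ^ (l : ℕ)) = 0) :
    ∀ i j l, a i j l = 0 := by
  have h5 : Real.sqrt 5 ^ 2 = 5 := Real.sq_sqrt (by norm_num)
  have g : Real.goldenRatio = (1 + Real.sqrt 5) / 2 := rfl
  refine eq_zero_of_sum_sqrt_monomials (by rw [rootPhi_sq]; exact goldenRatio_mem_ratSqrtFive)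
    (by rw [rootSqrtFive_sq]; exact sqrt_five_mem_ratSqrtFive)
    (by rw [rootTwo_sq]; exact_mod_cast natCast_mem ratSqrtFive 2) ?_ ?_ ?_ ?_ ?_ ?_ ?_ ha h
  · refine not_mem_ratSqrtFive (p := 1 / 2) (q := 1 / 2) (by rw [rootPhi_sq, g]; push_cast; ring) ?_
    intro r; nlinarith [sq_nonneg r]
  · refine not_mem_ratSqrtFive (p := 0) (q := 1) (by rw [rootSqrtFive_sq]; push_cast; ring) ?_
    intro r; nlinarith [sq_nonneg r]
  · refine not_mem_ratSqrtFive (p := 5 / 2) (q := 1 / 2)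
      (by rw [mul_pow, rootPhi_sq, rootSqrtFive_sq, g]; push_cast; linear_combination h5 / 2) ?_
    intro r; norm_num; exact rat_sq_ne_five r
  · rw [mem_ratSqrtFive]
    rintro ⟨b, c, hbc⟩
    have h2 := rootTwo_sq
    have h : ((b ^ 2 + 5 * c ^ 2 : ℚ) : ℝ) + (2 * b * c : ℚ) * Real.sqrt 5 =
        (2 : ℚ) + (0 : ℚ) * Real.sqrt 5 := by
      have h2' : ((b : ℝ) + c * Real.sqrt 5) ^ 2 = 2 := by rw [← hbc]; exact h2
      push_cast; linear_combination h2' - (c : ℝ) ^ 2 * h5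
    obtain ⟨e1, e2⟩ := rat_add_mul_sqrt_five_inj h
    have e3 : b = 0 ∨ c = 0 := by
      rcases mul_eq_zero.1 e2 with h | h
      · left; linarith
      · right; exact h
    have hirr : Irrational (Real.sqrt 2) := irrational_sqrt_two
    have hirr2 : Irrational (Real.sqrt 10) := by
      rw [← Nat.cast_ofNat, irrational_sqrt_natCast_iff]
      rintro ⟨m, hm⟩
      have : m ≤ 3 ∨ 4 ≤ m := by omega
      rcases this with h | h
      · interval_cases m <;> omega
      · nlinarith
    rcases e3 with rfl | rfl
    · apply hirr2
      refine ⟨|5 * c|, ?_⟩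
      rw [eq_comm, Real.sqrt_eq_iff_mul_self_eq (by norm_num) (by positivity)]
      push_cast
      rw [abs_mul_abs_self]
      have : (10 : ℚ) = 5 * c * (5 * c) := by linarith
      have := congrArg (Rat.cast : ℚ → ℝ) this
      push_cast at this
      exact this
    · apply hirr
      refine ⟨|b|, ?_⟩
      rw [eq_comm, Real.sqrt_eq_iff_mul_self_eq (by norm_num) (by positivity)]
      push_cast
      rw [abs_mul_abs_self]
      have : (2 : ℚ) = b * b := by linarith
      exact_mod_cast this
  · refine not_mem_ratSqrtFive (p := 1) (q := 1)
      (by rw [mul_pow, rootPhi_sq, rootTwo_sq, g]; push_cast; ring) ?_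
    intro r; nlinarith [sq_nonneg r]
  · refine not_mem_ratSqrtFive (p := 0) (q := 2)
      (by rw [mul_pow, rootSqrtFive_sq, rootTwo_sq]; push_cast; ring) ?_
    intro r; nlinarith [sq_nonneg r]
  · refine not_mem_ratSqrtFive (p := 5) (q := 1)
      (by rw [mul_pow, mul_pow, rootPhi_sq, rootSqrtFive_sq, rootTwo_sq, g]; push_cast
          linear_combination h5) ?_
    intro r hr
    apply rat_sq_ne_five (r / 2)
    linarith

end

section

open Polynomial Finset

/-- The binomial polynomial `X (X - 1) ⋯ (X - a + 1) / a!`. -/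
noncomputable def binomPoly : ℕ → ℂ[X]
  | 0 => 1
  | a + 1 => binomPoly a * (X - C (a : ℂ)) * C ((a + 1 : ℂ)⁻¹)

lemma natCast_add_one_mul_binomPoly_succ (a : ℕ) :
    C (a + 1 : ℂ) * binomPoly (a + 1) = binomPoly a * (X - C (a : ℂ)) := by
  have h : C (a + 1 : ℂ) * C ((a + 1 : ℂ)⁻¹) = 1 := by
    rw [← C_mul, mul_inv_cancel₀ (by exact_mod_cast a.succ_ne_zero), C_1]
  rw [binomPoly]
  linear_combination binomPoly a * (X - C (a : ℂ)) * h

lemma C_natCast_add_one_ne_zero (a : ℕ) : (C (a + 1 : ℂ) : ℂ[X]) ≠ 0 := by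
  rw [Ne, C_eq_zero]; exact_mod_cast a.succ_ne_zero

lemma binomPoly_comp_X_add_one (a : ℕ) :
    (binomPoly (a + 1)).comp (X + 1) = binomPoly (a + 1) + binomPoly a := by
  induction a with
  | zero => simp [binomPoly]
  | succ a ih =>
    apply mul_left_cancel₀ (C_natCast_add_one_ne_zero (a + 1))
    have h1 := congrArg (fun p ↦ p.comp (X + 1)) (natCast_add_one_mul_binomPoly_succ (a + 1))
    have h2 := natCast_add_one_mul_binomPoly_succ (a + 1)
    have h3 := natCast_add_one_mul_binomPoly_succ a
    simp only [mul_comp, C_comp, sub_comp, X_comp] at h1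
    rw [h1, mul_add, h2, ih]
    simp only [Nat.cast_add, Nat.cast_one, C_add, C_1] at h3 ⊢
    linear_combination -h3

lemma C_add_one_mul_binomPoly_succ (a : ℕ) :
    C (a + 1 : ℂ) * binomPoly (a + 1) =
      X * ∏ j ∈ range a, (C ((j + 1 : ℂ)⁻¹) * X - 1) := by
  induction a with
  | zero => simp [binomPoly]
  | succ a ih =>
    rw [natCast_add_one_mul_binomPoly_succ, prod_range_succ, ← mul_assoc, ← ih]
    have h : C (a + 1 : ℂ) * C ((a + 1 : ℂ)⁻¹) = 1 := by
      rw [← C_mul, mul_inv_cancel₀ (by exact_mod_cast a.succ_ne_zero), C_1]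
    simp only [Nat.cast_add, Nat.cast_one] at h ⊢
    linear_combination (-binomPoly (a + 1) * X) * h

/-- `P (y + v X)` has integer coefficients. -/
def IntegralAt (v : ℕ) (y : ℤ) (P : ℂ[X]) : Prop :=
  ∃ W : ℤ[X], P.comp (C (y : ℂ) + C (v : ℂ) * X) = W.map (Int.castRingHom ℂ)

namespace IntegralAt

variable {v : ℕ} {y : ℤ} {P Q : ℂ[X]}

lemma one : IntegralAt v y 1 := ⟨1, by simp⟩

lemma mul (hP : IntegralAt v y P) (hQ : IntegralAt v y Q) : IntegralAt v y (P * Q) := by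
  obtain ⟨W, hW⟩ := hP
  obtain ⟨V, hV⟩ := hQ
  exact ⟨W * V, by rw [mul_comp, hW, hV, Polynomial.map_mul]⟩

lemma add (hP : IntegralAt v y P) (hQ : IntegralAt v y Q) : IntegralAt v y (P + Q) := by
  obtain ⟨W, hW⟩ := hP
  obtain ⟨V, hV⟩ := hQ
  exact ⟨W + V, by rw [add_comp, hW, hV, Polynomial.map_add]⟩

lemma sub (hP : IntegralAt v y P) (hQ : IntegralAt v y Q) : IntegralAt v y (P - Q) := by
  obtain ⟨W, hW⟩ := hP
  obtain ⟨V, hV⟩ := hQ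
  exact ⟨W - V, by rw [sub_comp, hW, hV, Polynomial.map_sub]⟩

lemma pow (hP : IntegralAt v y P) (b : ℕ) : IntegralAt v y (P ^ b) := by
  induction b with
  | zero => simpa using one
  | succ b ih => rw [pow_succ]; exact ih.mul hP

lemma comp_X_add_one_iff : IntegralAt v y (P.comp (X + 1)) ↔ IntegralAt v (y + 1) P := by
  have : ((X + 1 : ℂ[X])).comp (C (y : ℂ) + C (v : ℂ) * X) =
      C ((y + 1 : ℤ) : ℂ) + C (v : ℂ) * X := by
    simp; ring
  rw [IntegralAt, IntegralAt, comp_assoc, this]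

lemma binomPoly_zero {d a : ℕ} (hv : ∀ j, 1 ≤ j → j ≤ d → j ∣ v) (ha : a ≤ d) :
    IntegralAt v 0 (binomPoly a) := by
  cases a with
  | zero => exact one
  | succ a =>
    have key : ∀ j : ℕ, j + 1 ≤ d → ((v / (j + 1) : ℕ) : ℂ) * (j + 1) = v := fun j hj ↦ by
      exact_mod_cast Nat.div_mul_cancel (hv (j + 1) (by omega) hj)
    refine ⟨((v / (a + 1) : ℕ) : ℤ[X]) * X * ∏ j ∈ range a, (((v / (j + 1) : ℕ) : ℤ[X]) * X - 1), ?_⟩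
    apply mul_left_cancel₀ (C_natCast_add_one_ne_zero a)
    have h1 := congrArg (fun p ↦ p.comp (C ((0 : ℤ) : ℂ) + C (v : ℂ) * X))
      (C_add_one_mul_binomPoly_succ a)
    simp only [mul_comp, C_comp, X_comp, Polynomial.prod_comp, sub_comp, one_comp] at h1
    rw [h1, Polynomial.map_mul, Polynomial.map_prod, ← mul_assoc]
    congr 1
    · rw [← key a ha]
      simp only [Int.cast_zero, C_0, zero_add, Polynomial.map_mul, Polynomial.map_X,
        Polynomial.map_natCast, C_mul, map_natCast]
      ring
    · refine prod_congr rfl fun j hj ↦ ?_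
      have hj' : j + 1 ≤ d := by rw [mem_range] at hj; omega
      have hne : (j + 1 : ℂ) ≠ 0 := by exact_mod_cast j.succ_ne_zero
      have : C ((j + 1 : ℂ)⁻¹) * C (v : ℂ) = C ((v / (j + 1) : ℕ) : ℂ) := by
        rw [← C_mul, ← key j hj']; congr 1; field_simp
      simp only [Int.cast_zero, C_0, zero_add, ← mul_assoc, map_natCast, Polynomial.map_sub,
        Polynomial.map_mul, Polynomial.map_natCast, Polynomial.map_X, Polynomial.map_one]
      simp only [map_natCast] at this
      rw [this]

lemma binomPoly {d a : ℕ} (hv : ∀ j, 1 ≤ j → j ≤ d → j ∣ v) (ha : a ≤ d) (y : ℤ) :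
    IntegralAt v y (binomPoly a) := by
  induction a generalizing y with
  | zero => exact one
  | succ a ih =>
    induction y with
    | zero => exact binomPoly_zero hv ha
    | succ i hi =>
      rw [← comp_X_add_one_iff, binomPoly_comp_X_add_one]
      exact hi.add (ih (by omega) _)
    | pred i hi =>
      have : IntegralAt v (-(i : ℤ) - 1) ((_root_.binomPoly (a + 1)).comp (X + 1)) := by
        rw [comp_X_add_one_iff]; simpa using hi
      rw [binomPoly_comp_X_add_one] at this
      simpa using this.sub (ih (by omega) (-(i : ℤ) - 1))

lemma exists_eval_hasseDeriv (hP : IntegralAt v y P) (i : ℕ) :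
    ∃ N : ℤ, (N : ℂ) = (v : ℂ) ^ i * (hasseDeriv i P).eval (y : ℂ) := by
  obtain ⟨W, hW⟩ := hP
  refine ⟨W.coeff i, ?_⟩
  have h : (W.map (Int.castRingHom ℂ)).coeff i = W.coeff i := by simp
  rw [← h, ← hW, ← taylor_coeff, taylor_apply]
  have : P.comp (C (y : ℂ) + C (v : ℂ) * X) = ((P.comp (X + C (y : ℂ))).comp (C (v : ℂ) * X)) := by
    rw [comp_assoc]; simp [add_comm]
  rw [this, comp_C_mul_X_coeff, mul_comm]

end IntegralAt

/-- The Feldman polynomials, `feldman d m` having degree `m`. -/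
noncomputable def feldman (d m : ℕ) : ℂ[X] := binomPoly (m % d) * binomPoly d ^ (m / d)

lemma degree_binomPoly (a : ℕ) : (binomPoly a).degree = a := by
  induction a with
  | zero => simp [binomPoly]
  | succ a ih =>
    rw [binomPoly, degree_mul, degree_mul, ih, degree_X_sub_C, degree_C]
    · simp
    · exact inv_ne_zero (by exact_mod_cast a.succ_ne_zero)

lemma degree_feldman (d m : ℕ) : (feldman d m).degree = m := by
  rw [feldman, degree_mul, degree_pow, degree_binomPoly, degree_binomPoly]
  rw [nsmul_eq_mul, mul_comm]
  exact_mod_cast Nat.mod_add_div m d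

lemma linearIndependent_feldman (d : ℕ) : LinearIndependent ℂ (feldman d) :=
  (Sequence.linearIndependent ⟨feldman d, degree_feldman d⟩ :)

lemma integralAt_feldman {v d : ℕ} (hd : 0 < d) (hv : ∀ j, 1 ≤ j → j ≤ d → j ∣ v) (m : ℕ) (y : ℤ) :
    IntegralAt v y (feldman d m) :=
  (IntegralAt.binomPoly hv (Nat.mod_lt m hd).le y).mul ((IntegralAt.binomPoly hv le_rfl y).pow _)

lemma norm_eval_binomPoly_le {d a : ℕ} (ha : a ≤ d) {z : ℂ} {W : ℝ} (hz : ‖z‖ ≤ W) :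
    ‖(binomPoly a).eval z‖ ≤ (W + d) ^ a / a.factorial := by
  have hW : 0 ≤ W := (norm_nonneg z).trans hz
  induction a with
  | zero => simp [binomPoly]
  | succ a ih =>
    have h1 : ‖z - a‖ ≤ W + d := (norm_sub_le _ _).trans <| by
      rw [Complex.norm_natCast]
      gcongr; omega
    have h2 : ‖((a : ℂ) + 1)⁻¹‖ = ((a : ℝ) + 1)⁻¹ := by
      rw [norm_inv]; congr 1; exact_mod_cast Complex.norm_natCast (a + 1)
    simp only [binomPoly, eval_mul, eval_sub, eval_X, eval_C, norm_mul, h2]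
    calc _ ≤ (W + d) ^ a / a.factorial * (W + d) * ((a : ℝ) + 1)⁻¹ := by
          gcongr; exact ih (by omega)
      _ = _ := by rw [Nat.factorial_succ]; push_cast; field_simp; ring

lemma norm_eval_binomPoly_le' {d a : ℕ} (hd : 0 < d) (ha : a ≤ d) {z : ℂ} {W : ℝ} (hz : ‖z‖ ≤ W) :
    ‖(binomPoly a).eval z‖ ≤ (Real.exp 1 * ((W + d) / d)) ^ d := by
  have hW : 0 ≤ W := (norm_nonneg z).trans hz
  have hd' : (0 : ℝ) < d := by exact_mod_cast hd
  have h1 : 1 ≤ (W + d) / d := by rw [le_div_iff₀ hd']; linarith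
  calc _ ≤ (W + d) ^ a / a.factorial := norm_eval_binomPoly_le ha hz
    _ = ((W + d) / d) ^ a * ((d : ℝ) ^ a / a.factorial) := by rw [div_pow]; field_simp
    _ ≤ ((W + d) / d) ^ d * Real.exp d := by
        gcongr ?_ * ?_
        · exact pow_le_pow_right₀ h1 ha
        · exact Real.pow_div_factorial_le_exp _ hd'.le _
    _ = _ := by rw [mul_pow, ← Real.exp_nat_mul, mul_one, mul_comm]

lemma norm_eval_feldman_le {d L m : ℕ} (hd : 0 < d) (hm : m < d * L) {z : ℂ} {W : ℝ}
    (hz : ‖z‖ ≤ W) :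
    ‖(feldman d m).eval z‖ ≤ (Real.exp 1 * ((W + d) / d)) ^ (d * L) := by
  have hW : 0 ≤ W := (norm_nonneg z).trans hz
  have hd' : (0 : ℝ) < d := by exact_mod_cast hd
  have h1 : 1 ≤ (W + d) / d := by rw [le_div_iff₀ hd']; linarith
  have h2 : 1 ≤ Real.exp 1 * ((W + d) / d) :=
    one_le_mul_of_one_le_of_one_le (Real.one_le_exp zero_le_one) h1
  rw [feldman, eval_mul, eval_pow, norm_mul, norm_pow]
  calc _ ≤ (Real.exp 1 * ((W + d) / d)) ^ d * ((Real.exp 1 * ((W + d) / d)) ^ d) ^ (m / d) := by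
        gcongr
        · exact norm_eval_binomPoly_le' hd (Nat.mod_lt m hd).le hz
        · exact norm_eval_binomPoly_le' hd le_rfl hz
    _ = (Real.exp 1 * ((W + d) / d)) ^ (d * (m / d + 1)) := by rw [← pow_mul, ← pow_add]; ring_nf
    _ ≤ _ := by
        refine pow_le_pow_right₀ h2 (Nat.mul_le_mul_left d ?_)
        exact Nat.succ_le_of_lt (Nat.div_lt_of_lt_mul hm)

lemma iteratedDeriv_polynomial_eval (P : ℂ[X]) (i : ℕ) :
    iteratedDeriv i (fun z ↦ P.eval z) = fun z ↦ (derivative^[i] P).eval z := by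
  induction i with
  | zero => simp
  | succ i ih =>
    rw [iteratedDeriv_succ, ih]
    funext z
    rw [Polynomial.deriv, Function.iterate_succ_apply']

lemma norm_eval_hasseDeriv_le {P : ℂ[X]} {z : ℂ} {B : ℝ}
    (h : ∀ w : ℂ, ‖w - z‖ = 1 → ‖P.eval w‖ ≤ B) (i : ℕ) :
    ‖(hasseDeriv i P).eval z‖ ≤ B := by
  have h1 := Complex.norm_iteratedDeriv_le_of_forall_mem_sphere_norm_le (c := z) (C := B) i one_pos
    (P.differentiable.diffContOnCl) (fun w hw ↦ h w (by simpa [dist_eq_norm] using hw))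
  rw [iteratedDeriv_polynomial_eval, ← factorial_smul_hasseDeriv] at h1
  simp only [LinearMap.smul_apply, one_pow, div_one, eval_smul] at h1
  rw [nsmul_eq_mul, norm_mul, Complex.norm_natCast] at h1
  exact le_of_mul_le_mul_left h1 (by positivity)

lemma norm_eval_hasseDeriv_feldman_le {d L m : ℕ} (hd : 0 < d) (hm : m < d * L) {z : ℂ} {W : ℝ}
    (hz : ‖z‖ ≤ W) (i : ℕ) :
    ‖(hasseDeriv i (feldman d m)).eval z‖ ≤ (Real.exp 1 * ((W + 1 + d) / d)) ^ (d * L) := by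
  refine norm_eval_hasseDeriv_le (fun w hw ↦ norm_eval_feldman_le hd hm ?_) i
  calc ‖w‖ = ‖(w - z) + z‖ := by ring_nf
    _ ≤ ‖w - z‖ + ‖z‖ := norm_add_le _ _
    _ ≤ W + 1 := by rw [hw]; linarith

lemma dvd_lcmUpto {d j : ℕ} (h1 : 1 ≤ j) (hj : j ≤ d) : j ∣ Nat.lcmUpto d :=
  Finset.dvd_lcm (f := id) (Finset.mem_Icc.2 ⟨h1, hj⟩)

lemma lcmUpto_le_sixteen_pow {d : ℕ} (hd : 25 ≤ d) : (Nat.lcmUpto d : ℝ) ≤ 16 ^ d := by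
  have hd' : (25 : ℝ) ≤ d := by exact_mod_cast hd
  have hpos : (0 : ℝ) < Nat.lcmUpto d := by exact_mod_cast Nat.lcmUpto_pos d
  rw [← Real.log_le_log_iff hpos (by positivity), ← Chebyshev.psi_eq_log_lcmUpto, Real.log_pow]
  refine (Chebyshev.psi_le (by linarith)).trans ?_
  have h16 : Real.log 16 = 2 * Real.log 4 := by
    rw [show (16 : ℝ) = 4 ^ 2 by norm_num, Real.log_pow]; norm_num
  have h4 : Real.log 4 = 2 * Real.log 2 := by
    rw [show (4 : ℝ) = 2 ^ 2 by norm_num, Real.log_pow]; norm_num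
  have hl2 := Real.log_two_gt_d9
  set t := Real.sqrt d with ht
  have ht2 : t ^ 2 = d := Real.sq_sqrt (by linarith)
  have ht5 : 5 ≤ t := by
    rw [ht]; apply Real.le_sqrt_of_sq_le; norm_num; exact_mod_cast hd
  have hlog : 2 * Real.log (d : ℝ) ≤ Real.log 4 * t := by
    have h1 : Real.log (t / 5) ≤ t / 5 - 1 := Real.log_le_sub_one_of_pos (by linarith)
    have h2 : Real.log (5 / 4) ≤ 5 / 4 - 1 := Real.log_le_sub_one_of_pos (by norm_num)
    rw [Real.log_div (by linarith) (by norm_num)] at h1 h2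
    rw [← ht2, Real.log_pow]
    have hl2' := Real.log_two_lt_d9
    push_cast
    nlinarith
  rw [h16]
  nlinarith

end

section

open Polynomial Finset

lemma natCast_le_analyticOrderAt_const_mul {f : ℂ → ℂ} {m : ℕ} {s : ℂ} (c : ℂ)
    (hf : Differentiable ℂ f) (h : (m : ℕ∞) ≤ analyticOrderAt f s) :
    (m : ℕ∞) ≤ analyticOrderAt (fun z ↦ c * f z) s := by
  have : analyticOrderAt ((fun _ : ℂ ↦ c) * f) s = _ :=
    analyticOrderAt_mul analyticAt_const (hf.analyticAt s)
  change (m : ℕ∞) ≤ analyticOrderAt ((fun _ : ℂ ↦ c) * f) s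
  rw [this]
  exact h.trans le_add_self

lemma hasDerivAt_eval_hasseDeriv (P : ℂ[X]) (t : ℕ) (Q z : ℂ) :
    HasDerivAt (fun z ↦ (hasseDeriv t P).eval (Q * z))
      (Q * (t + 1) * (hasseDeriv (t + 1) P).eval (Q * z)) z := by
  have h1 := ((hasseDeriv t P).hasDerivAt (Q * z)).comp z ((hasDerivAt_id z).const_mul Q)
  have h2 : derivative (hasseDeriv t P) = (t + 1) • hasseDeriv (t + 1) P := by
    have := congrArg (fun f ↦ f P) (hasseDeriv_comp (R := ℂ) 1 t)
    simp only [LinearMap.comp_apply, hasseDeriv_one', LinearMap.smul_apply] at this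
    rw [this, add_comm 1 t, Nat.choose_one_right]
  refine HasDerivAt.congr_deriv h1 ?_
  rw [h2, eval_smul, nsmul_eq_mul]
  simp only [mul_one]
  push_cast
  ring

section ExpPoly

variable {ι : Type*}

lemma differentiable_expPoly (S : Finset ι) (w x y ω : ι → ℂ) (r : ι → ℂ[X]) (Q s : ℂ)
    (t₀ t₁ t₂ : ℕ) :
    Differentiable ℂ (fun z ↦ ∑ i ∈ S, w i * (hasseDeriv t₀ (r i)).eval (Q * z) *
      x i ^ t₁ * y i ^ t₂ * Complex.exp (ω i * (z - s))) := by
  have h : ∀ P : ℂ[X], Differentiable ℂ (fun z ↦ P.eval (Q * z)) := fun P ↦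
    P.differentiable.comp (differentiable_id.const_mul Q)
  refine Differentiable.fun_sum fun i _ ↦ ?_
  have := h (hasseDeriv t₀ (r i))
  fun_prop

lemma le_analyticOrderAt_expPoly (S : Finset ι) (w x y ω : ι → ℂ) (r : ι → ℂ[X]) (Q s g₁ g₂ : ℂ)
    (hω : ∀ i ∈ S, ω i = g₁ * x i + g₂ * y i) (T : ℕ)
    (h : ∀ t₀ t₁ t₂, t₀ + t₁ + t₂ < T →
      ∑ i ∈ S, w i * (hasseDeriv t₀ (r i)).eval (Q * s) * x i ^ t₁ * y i ^ t₂ = 0)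
    (m t₀ t₁ t₂ : ℕ) (hm : t₀ + t₁ + t₂ + m ≤ T) :
    (m : ℕ∞) ≤ analyticOrderAt (fun z ↦ ∑ i ∈ S, w i * (hasseDeriv t₀ (r i)).eval (Q * z) *
      x i ^ t₁ * y i ^ t₂ * Complex.exp (ω i * (z - s))) s := by
  induction m generalizing t₀ t₁ t₂ with
  | zero => simp
  | succ m ih =>
    have hd := differentiable_expPoly S w x y ω r Q s
    have h0 := h t₀ t₁ t₂ (by omega)
    push_cast
    rw [← analyticOrderAt_deriv_ge_iff ((hd t₀ t₁ t₂).analyticAt s) (by simpa using h0)]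
    have hder : deriv (fun z ↦ ∑ i ∈ S, w i * (hasseDeriv t₀ (r i)).eval (Q * z) *
        x i ^ t₁ * y i ^ t₂ * Complex.exp (ω i * (z - s))) =
        ((fun z ↦ (Q * (t₀ + 1)) * ∑ i ∈ S, w i * (hasseDeriv (t₀ + 1) (r i)).eval (Q * z) *
          x i ^ t₁ * y i ^ t₂ * Complex.exp (ω i * (z - s))) +
        (fun z ↦ g₁ * ∑ i ∈ S, w i * (hasseDeriv t₀ (r i)).eval (Q * z) *
          x i ^ (t₁ + 1) * y i ^ t₂ * Complex.exp (ω i * (z - s)))) +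
        (fun z ↦ g₂ * ∑ i ∈ S, w i * (hasseDeriv t₀ (r i)).eval (Q * z) *
          x i ^ t₁ * y i ^ (t₂ + 1) * Complex.exp (ω i * (z - s))) := by
      funext z
      refine HasDerivAt.deriv ?_
      simp only [Pi.add_apply, mul_sum, ← sum_add_distrib]
      refine HasDerivAt.fun_sum fun i hi ↦ ?_
      have h1 := ((((hasDerivAt_eval_hasseDeriv (r i) t₀ Q z).const_mul (w i)).mul_const
        (x i ^ t₁)).mul_const (y i ^ t₂)).mul
        ((((hasDerivAt_id z).sub_const s).const_mul (ω i)).cexp)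
      refine h1.congr_deriv ?_
      simp only [id_eq, mul_one]
      generalize Complex.exp (ω i * (z - s)) = e
      rw [hω i hi]
      ring
    rw [hder]
    refine le_trans (le_min (le_trans (le_min ?_ ?_) le_analyticOrderAt_add) ?_)
      le_analyticOrderAt_add
    · exact natCast_le_analyticOrderAt_const_mul _ (hd _ _ _) (ih _ _ _ (by omega))
    · exact natCast_le_analyticOrderAt_const_mul _ (hd _ _ _) (ih _ _ _ (by omega))
    · exact natCast_le_analyticOrderAt_const_mul _ (hd _ _ _) (ih _ _ _ (by omega))

lemma norm_exp_sub_one_le_two_mul {z : ℂ} (hz : ‖z‖ ≤ 1) : ‖Complex.exp z - 1‖ ≤ 2 * ‖z‖ :=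
  Complex.norm_exp_sub_one_le hz

lemma norm_sum_le_sum_mul {S : Finset ι} {p : ι → ℝ} {f : ι → ℂ} {B : ℝ}
    (h : ∀ i ∈ S, ‖f i‖ ≤ |p i| * B) : ‖∑ i ∈ S, f i‖ ≤ (∑ i ∈ S, |p i|) * B := by
  rw [sum_mul]
  exact norm_sum_le_of_le S h

/-- Extrapolation for exponential sums with almost proportional frequencies. -/
lemma norm_expSum_le {S : Finset ι} {p c₁ c₂ L θ : ι → ℝ} {r : ι → ℂ[X]} {Q : ℝ} (hQ : 0 ≤ Q)
    {g₁ g₂ : ℝ} (hω : ∀ i ∈ S, L i - θ i = g₁ * c₁ i + g₂ * c₂ i)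
    {n m : ℕ} (hn : 0 < n)
    (hV : ∀ j < n, ∀ t₀ t₁ t₂, t₀ + t₁ + t₂ < 2 * m →
      ∑ i ∈ S, (p i : ℂ) * (hasseDeriv t₀ (r i)).eval ((Q : ℂ) * node n j) * (c₁ i : ℂ) ^ t₁ *
        (c₂ i : ℂ) ^ t₂ * Complex.exp ((L i : ℂ) * node n j) = 0)
    {t₀ t₁ t₂ : ℕ} (ht : t₀ + t₁ + t₂ < m)
    {E N C R₁ R₂ Lmax δ : ℝ} (hE : 2 ≤ E) (hN : ∑ i ∈ S, |p i| ≤ N) (hδ : δ * n ≤ 1)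
    (hC : ∀ i ∈ S, |c₁ i| ^ t₁ * |c₂ i| ^ t₂ ≤ C)
    (hR₁ : ∀ i ∈ S, ∀ z : ℂ, ‖z‖ ≤ Q * (n + 1) → ‖(hasseDeriv t₀ (r i)).eval z‖ ≤ R₁)
    (hR₂ : ∀ i ∈ S, ∀ z : ℂ, ‖z‖ ≤ Q * (E * n) → ‖(hasseDeriv t₀ (r i)).eval z‖ ≤ R₂)
    (hR₁0 : 0 ≤ R₁) (hR₂0 : 0 ≤ R₂) (hC0 : 0 ≤ C) (hL0 : 0 ≤ Lmax) (hδ0 : 0 ≤ δ)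
    (hL : ∀ i ∈ S, |L i| ≤ Lmax) (hθ : ∀ i ∈ S, |θ i| ≤ δ) {x : ℝ} (hx : |x| ≤ n) :
    ‖∑ i ∈ S, (p i : ℂ) * (hasseDeriv t₀ (r i)).eval ((Q : ℂ) * x) * (c₁ i : ℂ) ^ t₁ *
        (c₂ i : ℂ) ^ t₂ * Complex.exp ((L i : ℂ) * x)‖ ≤
      N * C * R₂ * Real.exp ((Lmax + δ) * (E * n)) / Real.sqrt (E ^ 2 - 1) ^ (n * m) +
      3 * (N * C * R₁ * Real.exp (Lmax * n) * Real.exp (Lmax + δ) * (2 * δ * n)) *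
        (22 * (E + 1)) ^ (n * m) := by
  have hn1 : (1 : ℝ) ≤ n := by exact_mod_cast hn
  have hN0 : 0 ≤ N := (sum_nonneg fun i _ ↦ abs_nonneg (p i)).trans hN
  set ε := N * C * R₁ * Real.exp (Lmax * n) * Real.exp (Lmax + δ) * (2 * δ * n) with hε
  have hε0 : 0 ≤ ε := by positivity
  set f : ℂ → ℂ := fun z ↦ ∑ i ∈ S, (p i : ℂ) * (hasseDeriv t₀ (r i)).eval ((Q : ℂ) * z) *
    (c₁ i : ℂ) ^ t₁ * (c₂ i : ℂ) ^ t₂ * Complex.exp (((L i - θ i : ℝ) : ℂ) * (z - 0)) with hf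
  set g : ℕ → ℂ → ℂ := fun j z ↦ ∑ i ∈ S, ((p i : ℂ) * Complex.exp ((L i : ℂ) * node n j)) *
    (hasseDeriv t₀ (r i)).eval ((Q : ℂ) * z) * (c₁ i : ℂ) ^ t₁ * (c₂ i : ℂ) ^ t₂ *
    Complex.exp (((L i - θ i : ℝ) : ℂ) * (z - node n j)) with hg
  have hω' : ∀ i ∈ S, ‖((L i - θ i : ℝ) : ℂ)‖ ≤ Lmax + δ := fun i hi ↦ by
    rw [Complex.norm_real, Real.norm_eq_abs]
    exact (abs_sub _ _).trans (add_le_add (hL i hi) (hθ i hi))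
  have hexp : ∀ (z : ℂ) (B : ℝ), ‖z‖ ≤ B → ‖Complex.exp z‖ ≤ Real.exp B := fun z B h ↦
    (Complex.norm_exp_le_exp_norm z).trans (Real.exp_le_exp.2 h)
  have hcc : ∀ i ∈ S, ‖(c₁ i : ℂ)‖ ^ t₁ * ‖(c₂ i : ℂ)‖ ^ t₂ ≤ C := fun i hi ↦ by
    simpa [Complex.norm_real] using hC i hi
  have hpp : ∀ i, ‖(p i : ℂ)‖ = |p i| := fun i ↦ by simp
  have hsmall : ∀ i ∈ S, ∀ u : ℝ, |u| ≤ n →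
      ‖Complex.exp (-(θ i : ℂ) * u) - 1‖ ≤ 2 * δ * n := fun i hi u hu ↦ by
    have h1 : ‖-(θ i : ℂ) * u‖ ≤ δ * n := by
      rw [norm_mul, norm_neg, Complex.norm_real, Complex.norm_real]
      exact mul_le_mul (hθ i hi) hu (abs_nonneg _) hδ0
    refine (norm_exp_sub_one_le_two_mul (h1.trans hδ)).trans ?_
    linarith
  have hLu : ∀ i ∈ S, ∀ u : ℝ, |u| ≤ n → ‖Complex.exp ((L i : ℂ) * u)‖ ≤ Real.exp (Lmax * n) :=
    fun i hi u hu ↦ by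
      refine hexp _ _ ?_
      rw [norm_mul, Complex.norm_real, Complex.norm_real]
      exact mul_le_mul (hL i hi) hu (abs_nonneg _) hL0
  have hmain := norm_le_of_approx_zeros (n := n) (m := m) hn (E := E)
    (M := N * C * R₂ * Real.exp ((Lmax + δ) * (E * n))) (ε := ε) hE hε0 (f := f)
    (differentiable_expPoly S _ _ _ _ _ _ _ _ _ _) g
    (fun j _ ↦ differentiable_expPoly S _ _ _ _ _ _ _ _ _ _)
    (fun j hj ↦ ?_) (fun j hj z hz ↦ ?_) (fun z hz ↦ ?_) hx
  · have hdiff : ‖∑ i ∈ S, (p i : ℂ) * (hasseDeriv t₀ (r i)).eval ((Q : ℂ) * x) *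
        (c₁ i : ℂ) ^ t₁ * (c₂ i : ℂ) ^ t₂ * Complex.exp ((L i : ℂ) * x) - f x‖ ≤ ε := by
      have : ∑ i ∈ S, (p i : ℂ) * (hasseDeriv t₀ (r i)).eval ((Q : ℂ) * x) *
        (c₁ i : ℂ) ^ t₁ * (c₂ i : ℂ) ^ t₂ * Complex.exp ((L i : ℂ) * x) - f x =
          ∑ i ∈ S, -((p i : ℂ) * ((c₁ i : ℂ) ^ t₁ * (c₂ i : ℂ) ^ t₂ *
            (hasseDeriv t₀ (r i)).eval ((Q : ℂ) * x) * Complex.exp ((L i : ℂ) * x) *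
            (Complex.exp (-(θ i : ℂ) * x) - 1))) := by
        rw [hf, ← sum_sub_distrib]
        refine sum_congr rfl fun i _ ↦ ?_
        have : Complex.exp (((L i - θ i : ℝ) : ℂ) * ((x : ℂ) - 0)) =
            Complex.exp ((L i : ℂ) * x) * Complex.exp (-(θ i : ℂ) * x) := by
          rw [← Complex.exp_add]; congr 1; push_cast; ring
        rw [this]; ring
      rw [this]
      calc _ ≤ (∑ i ∈ S, |p i|) * (C * R₁ * Real.exp (Lmax * n) * (2 * δ * n)) := by
            refine norm_sum_le_sum_mul fun i hi ↦ ?_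
            rw [norm_neg, norm_mul, hpp]
            simp only [norm_mul, norm_pow]
            gcongr
            · exact hcc i hi
            · refine hR₁ i hi _ ?_
              rw [norm_mul, Complex.norm_real, Complex.norm_real, Real.norm_eq_abs,
                Real.norm_eq_abs, abs_of_nonneg hQ]
              gcongr; linarith
            · exact hLu i hi x hx
            · simpa using hsmall i hi x hx
        _ ≤ N * (C * R₁ * Real.exp (Lmax * n) * (2 * δ * n)) := by gcongr
        _ = (N * C * R₁ * Real.exp (Lmax * n) * (2 * δ * n)) * 1 := by ring
        _ ≤ (N * C * R₁ * Real.exp (Lmax * n) * (2 * δ * n)) * Real.exp (Lmax + δ) := by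
            gcongr; exact Real.one_le_exp (by positivity)
        _ = ε := by rw [hε]; ring
    have h1 : (1 : ℝ) ≤ (22 * (E + 1)) ^ (n * m) := one_le_pow₀ (by linarith)
    have h2 := norm_sub_norm_le (∑ i ∈ S, (p i : ℂ) * (hasseDeriv t₀ (r i)).eval ((Q : ℂ) * x) *
        (c₁ i : ℂ) ^ t₁ * (c₂ i : ℂ) ^ t₂ * Complex.exp ((L i : ℂ) * x)) (f x)
    have h3 : ε ≤ ε * (22 * (E + 1)) ^ (n * m) := le_mul_of_one_le_right hε0 h1
    linarith
  · refine le_analyticOrderAt_expPoly S _ _ _ _ _ _ _ (g₁ : ℂ) (g₂ : ℂ) (fun i hi ↦ ?_) (2 * m)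
      (fun a b c habc ↦ ?_) m t₀ t₁ t₂ (by omega)
    · rw [hω i hi]; push_cast; ring
    · rw [← hV j hj a b c habc]
      exact sum_congr rfl fun i _ ↦ by ring
  · have : f z - g j z = ∑ i ∈ S, (p i : ℂ) * ((c₁ i : ℂ) ^ t₁ * (c₂ i : ℂ) ^ t₂ *
            (hasseDeriv t₀ (r i)).eval ((Q : ℂ) * z) * Complex.exp ((L i : ℂ) * node n j) *
            Complex.exp (((L i - θ i : ℝ) : ℂ) * (z - node n j)) *
            (Complex.exp (-(θ i : ℂ) * node n j) - 1)) := by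
      rw [hf, hg, ← sum_sub_distrib]
      refine sum_congr rfl fun i _ ↦ ?_
      have : Complex.exp (((L i - θ i : ℝ) : ℂ) * (z - 0)) =
          Complex.exp ((L i : ℂ) * node n j) *
          Complex.exp (((L i - θ i : ℝ) : ℂ) * (z - node n j)) *
            Complex.exp (-(θ i : ℂ) * node n j) := by
        rw [← Complex.exp_add, ← Complex.exp_add]; congr 1; push_cast; ring
      rw [this]; ring
    rw [this]
    have hzn : ‖z‖ ≤ n + 1 := by
      calc ‖z‖ = ‖(node n j : ℂ) + (z - node n j)‖ := by ring_nf
        _ ≤ ‖(node n j : ℂ)‖ + ‖z - node n j‖ := norm_add_le _ _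
        _ ≤ n + 1 := add_le_add (by simpa using abs_node_le hj) hz
    calc _ ≤ (∑ i ∈ S, |p i|) *
          (C * R₁ * Real.exp (Lmax * n) * Real.exp (Lmax + δ) * (2 * δ * n)) := by
          refine norm_sum_le_sum_mul fun i hi ↦ ?_
          rw [norm_mul, hpp]
          simp only [norm_mul, norm_pow]
          gcongr
          · exact hcc i hi
          · refine hR₁ i hi _ ?_
            rw [norm_mul, Complex.norm_real, Real.norm_eq_abs, abs_of_nonneg hQ]
            gcongr
          · exact hLu i hi _ (abs_node_le hj)
          · refine hexp _ _ ?_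
            rw [norm_mul]
            calc _ ≤ (Lmax + δ) * 1 := mul_le_mul (hω' i hi) hz (norm_nonneg _) (by positivity)
              _ = _ := mul_one _
          · simpa using hsmall i hi _ (abs_node_le hj)
      _ ≤ N * (C * R₁ * Real.exp (Lmax * n) * Real.exp (Lmax + δ) * (2 * δ * n)) := by gcongr
      _ = ε := by rw [hε]; ring
  · calc ‖f z‖ ≤ (∑ i ∈ S, |p i|) * (C * R₂ * Real.exp ((Lmax + δ) * (E * n))) := by
          refine norm_sum_le_sum_mul fun i hi ↦ ?_
          have : (p i : ℂ) * (hasseDeriv t₀ (r i)).eval ((Q : ℂ) * z) *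
              (c₁ i : ℂ) ^ t₁ * (c₂ i : ℂ) ^ t₂ * Complex.exp (((L i - θ i : ℝ) : ℂ) * (z - 0)) =
              (p i : ℂ) * ((c₁ i : ℂ) ^ t₁ * (c₂ i : ℂ) ^ t₂ *
              (hasseDeriv t₀ (r i)).eval ((Q : ℂ) * z) *
              Complex.exp (((L i - θ i : ℝ) : ℂ) * z)) := by rw [sub_zero]; ring
          rw [this, norm_mul, hpp]
          simp only [norm_mul, norm_pow]
          gcongr
          · exact hcc i hi
          · refine hR₂ i hi _ ?_
            rw [norm_mul, Complex.norm_real, Real.norm_eq_abs, abs_of_nonneg hQ, hz]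
          · refine hexp _ _ ?_
            rw [norm_mul, hz]
            gcongr
            exact hω' i hi
      _ ≤ N * (C * R₂ * Real.exp ((Lmax + δ) * (E * n))) := by gcongr
      _ = _ := by ring

end ExpPoly

end

section

open Finset

/-- `l₁ log φ + l₂ log √5 + l₃ log 2`. -/
noncomputable def logSum (l : ℕ × ℕ × ℕ) : ℝ :=
  l.1 * Real.log Real.goldenRatio + l.2.1 * Real.log (Real.sqrt 5) + l.2.2 * Real.log 2

/-- `log (2 √5 φ)`. -/
noncomputable def logTotal : ℝ := logSum (1, 1, 1)

lemma rootPhi_pow_mul (l : ℕ × ℕ × ℕ) (s : ℕ) :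
    rootPhi ^ (l.1 * s) * rootSqrtFive ^ (l.2.1 * s) * rootTwo ^ (l.2.2 * s) =
      Real.exp (logSum l * (s / 2)) := by
  have key : ∀ {x y : ℝ}, 0 < x → x ^ 2 = y → ∀ n : ℕ, x ^ (n * s) =
      Real.exp (n * Real.log y * (s / 2)) := fun {x y} hx hxy n ↦ by
    rw [← hxy, Real.log_pow, ← Real.exp_log (pow_pos hx (n * s)), Real.log_pow]
    congr 1; push_cast; ring
  rw [key rootPhi_pos rootPhi_sq, key rootSqrtFive_pos rootSqrtFive_sq, key rootTwo_pos rootTwo_sq,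
    ← Real.exp_add, ← Real.exp_add, logSum]
  congr 1; ring

lemma logSum_pos_parts :
    0 < Real.log Real.goldenRatio ∧ 0 < Real.log (Real.sqrt 5) ∧ 0 < Real.log 2 := by
  refine ⟨Real.log_pos Real.one_lt_goldenRatio, Real.log_pos ?_, Real.log_pos (by norm_num)⟩
  rw [Real.lt_sqrt (by norm_num)]; norm_num

lemma logSum_nonneg (l : ℕ × ℕ × ℕ) : 0 ≤ logSum l := by
  obtain ⟨h1, h2, h3⟩ := logSum_pos_parts
  unfold logSum; positivity

lemma logSum_le {l : ℕ × ℕ × ℕ} {Q : ℕ} (h₁ : l.1 ≤ Q) (h₂ : l.2.1 ≤ Q) (h₃ : l.2.2 ≤ Q) :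
    logSum l ≤ logTotal * Q := by
  obtain ⟨p1, p2, p3⟩ := logSum_pos_parts
  have e1 : (l.1 : ℝ) ≤ Q := by exact_mod_cast h₁
  have e2 : (l.2.1 : ℝ) ≤ Q := by exact_mod_cast h₂
  have e3 : (l.2.2 : ℝ) ≤ Q := by exact_mod_cast h₃
  simp only [logTotal, logSum, Nat.cast_one, one_mul]
  nlinarith

lemma logTotal_nonneg : 0 ≤ logTotal := logSum_nonneg _

lemma logSum_diag (Q : ℕ) : logSum (Q, Q, Q) = logTotal * Q := by
  simp only [logTotal, logSum, Nat.cast_one, one_mul]; ring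

/-- Liouville's inequality for exponential sums at half-integers. -/
lemma one_le_abs_expSum_mul {ι : Type*} (S : Finset ι) (a : ι → ℤ) (l : ι → ℕ × ℕ × ℕ) {Q : ℕ}
    (hl : ∀ i ∈ S, (l i).1 ≤ Q ∧ (l i).2.1 ≤ Q ∧ (l i).2.2 ≤ Q) {s : ℤ} {n A V : ℝ}
    (hs : |(s : ℝ)| ≤ 2 * n) (hA : ∑ i ∈ S, |(a i : ℝ)| ≤ A)
    (hV : V = ∑ i ∈ S, (a i : ℝ) * Real.exp (logSum (l i) * (s / 2))) (hV0 : V ≠ 0) :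
    1 ≤ |V| * (Real.exp (logTotal * (Q * n)) * (A * Real.exp (logTotal * (Q * n))) ^ 15) := by
  have hA0 : 0 ≤ A := (sum_nonneg fun i _ ↦ abs_nonneg _).trans hA
  have hn : 0 ≤ n := by linarith [abs_nonneg (s : ℝ)]
  have hexp : ∀ N : ℕ, (N : ℝ) = |(s : ℝ)| → rootPhi ^ (Q * N) * rootSqrtFive ^ (Q * N) *
      rootTwo ^ (Q * N) ≤ Real.exp (logTotal * (Q * n)) := fun N hN ↦ by
    have := rootPhi_pow_mul (Q, Q, Q) N
    simp only at this
    rw [this, logSum_diag]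
    refine Real.exp_le_exp.2 ?_
    rw [mul_assoc]
    refine mul_le_mul_of_nonneg_left ?_ logTotal_nonneg
    gcongr; linarith
  have h1 : 1 ≤ Real.exp (logTotal * (Q * n)) :=
    Real.one_le_exp (by have := logTotal_nonneg; positivity)
  rcases le_or_gt 0 s with h0 | h0
  · obtain ⟨N, rfl⟩ := Int.eq_ofNat_of_zero_le h0
    have hN : (N : ℝ) = |((N : ℤ) : ℝ)| := by simp
    have := one_le_abs_sum_mul_pow S a (fun i ↦ (l i).1 * N) (fun i ↦ (l i).2.1 * N)
      (fun i ↦ (l i).2.2 * N) (E₁ := Q * N) (E₂ := Q * N) (E₃ := Q * N)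
      (fun i hi ↦ Nat.mul_le_mul_right _ (hl i hi).1)
      (fun i hi ↦ Nat.mul_le_mul_right _ (hl i hi).2.1)
      (fun i hi ↦ Nat.mul_le_mul_right _ (hl i hi).2.2) (v := V)
      (M := A * Real.exp (logTotal * (Q * n)))
      (by rw [hV]; refine sum_congr rfl fun i _ ↦ ?_; rw [rootPhi_pow_mul]; simp) hV0
      (mul_le_mul hA (hexp N hN) (by have := rootPhi_pos; have := rootSqrtFive_pos
                                     have := rootTwo_pos; positivity) hA0)
    calc (1 : ℝ) ≤ |V| * (A * Real.exp (logTotal * (Q * n))) ^ 15 := this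
      _ ≤ _ := by
        gcongr
        exact le_mul_of_one_le_left (by positivity) h1
  · obtain ⟨N, hN⟩ := Int.eq_ofNat_of_zero_le (show 0 ≤ -s by omega)
    have hs' : (s : ℝ) = -(N : ℝ) := by
      have : s = -(N : ℤ) := by omega
      rw [this]; push_cast; ring
    have hN' : (N : ℝ) = |(s : ℝ)| := by rw [hs', abs_neg, abs_of_nonneg (by positivity)]
    set W := V * Real.exp (logTotal * Q * (N / 2)) with hW
    have hW0 : W ≠ 0 := mul_ne_zero hV0 (Real.exp_ne_zero _)
    have := one_le_abs_sum_mul_pow S a (fun i ↦ (Q - (l i).1) * N) (fun i ↦ (Q - (l i).2.1) * N)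
      (fun i ↦ (Q - (l i).2.2) * N) (E₁ := Q * N) (E₂ := Q * N) (E₃ := Q * N)
      (fun i hi ↦ Nat.mul_le_mul_right _ (Nat.sub_le _ _))
      (fun i hi ↦ Nat.mul_le_mul_right _ (Nat.sub_le _ _))
      (fun i hi ↦ Nat.mul_le_mul_right _ (Nat.sub_le _ _)) (v := W)
      (M := A * Real.exp (logTotal * (Q * n)))
      (by
        rw [hW, hV, sum_mul]
        refine sum_congr rfl fun i hi ↦ ?_
        obtain ⟨e1, e2, e3⟩ := hl i hi
        have := rootPhi_pow_mul (Q - (l i).1, Q - (l i).2.1, Q - (l i).2.2) N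
        simp only at this
        rw [this, mul_assoc, ← Real.exp_add, ← logSum_diag]
        congr 2
        simp only [logSum, Nat.cast_sub e1, Nat.cast_sub e2, Nat.cast_sub e3, hs']
        ring) hW0
      (mul_le_mul hA (hexp N hN') (by have := rootPhi_pos; have := rootSqrtFive_pos
                                      have := rootTwo_pos; positivity) hA0)
    calc (1 : ℝ) ≤ |W| * (A * Real.exp (logTotal * (Q * n))) ^ 15 := this
      _ = |V| * (Real.exp (logTotal * Q * (N / 2)) * (A * Real.exp (logTotal * (Q * n))) ^ 15) := by
        rw [hW, abs_mul, abs_of_pos (Real.exp_pos _)]; ring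
      _ ≤ _ := by
        have := logTotal_nonneg
        rw [mul_assoc]
        gcongr; linarith

lemma exp_logSum_mul_mem (l : ℕ × ℕ × ℕ) (t : ℤ) : Real.exp (logSum l * t) ∈ ratSqrtFive := by
  have key : ∀ {y : ℝ}, 0 < y → y ∈ ratSqrtFive → ∀ n : ℕ,
      Real.exp (n * Real.log y * t) ∈ ratSqrtFive := fun {y} hy hm n ↦ by
    have : Real.exp (n * Real.log y * t) = (y ^ n) ^ t := by
      rw [← Real.exp_log (zpow_pos (pow_pos hy n) t), Real.log_zpow, Real.log_pow]
      congr 1; ring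
    rw [this]
    exact zpow_mem (pow_mem hm n) t
  have h5 : 0 < Real.sqrt 5 := by positivity
  rw [logSum, add_mul, add_mul, Real.exp_add, Real.exp_add]
  refine mul_mem (mul_mem (key Real.goldenRatio_pos goldenRatio_mem_ratSqrtFive _)
    (key h5 sqrt_five_mem_ratSqrtFive _)) (key two_pos ?_ _)
  exact_mod_cast natCast_mem ratSqrtFive 2

/-- The lattice points of the cube `[0, Q)³`. -/
def cubeBox (Q : ℕ) : Finset (ℕ × ℕ × ℕ) := range Q ×ˢ range Q ×ˢ range Q

lemma sum_range_two_mul {M : Type*} [AddCommMonoid M] (Q : ℕ) (f : ℕ → M) :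
    ∑ l ∈ range (2 * Q), f l = ∑ i : Fin 2, ∑ l ∈ range Q, f (i + 2 * l) := by
  induction Q with
  | zero => simp
  | succ Q ih =>
    rw [show 2 * (Q + 1) = 2 * Q + 1 + 1 by ring, sum_range_succ, sum_range_succ, ih]
    simp only [Fin.sum_univ_two, sum_range_succ, Fin.val_zero, Fin.val_one, zero_add]
    rw [add_comm 1 (2 * Q)]
    abel

/-- The point `c + 2 l`. -/
def classPoint (c₁ c₂ c₃ : Fin 2) (l : ℕ × ℕ × ℕ) : ℕ × ℕ × ℕ :=
  (c₁ + 2 * l.1, c₂ + 2 * l.2.1, c₃ + 2 * l.2.2)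

lemma sum_cubeBox_two_mul {M : Type*} [AddCommMonoid M] (Q : ℕ) (f : ℕ × ℕ × ℕ → M) :
    ∑ l ∈ cubeBox (2 * Q), f l =
      ∑ c₁ : Fin 2, ∑ c₂ : Fin 2, ∑ c₃ : Fin 2, ∑ l ∈ cubeBox Q, f (classPoint c₁ c₂ c₃ l) := by
  simp only [cubeBox, sum_product, sum_range_two_mul, classPoint]
  refine sum_congr rfl fun c₁ _ ↦ ?_
  rw [sum_comm]
  refine sum_congr rfl fun c₂ _ ↦ ?_
  rw [sum_congr rfl fun x _ ↦ sum_comm, sum_comm]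

lemma exists_classPoint {Q : ℕ} {l : ℕ × ℕ × ℕ} (hl : l ∈ cubeBox (2 * Q)) :
    ∃ c₁ c₂ c₃ : Fin 2, ∃ l' ∈ cubeBox Q, classPoint c₁ c₂ c₃ l' = l := by
  simp only [cubeBox, mem_product, mem_range] at hl
  refine ⟨⟨l.1 % 2, Nat.mod_lt _ two_pos⟩, ⟨l.2.1 % 2, Nat.mod_lt _ two_pos⟩,
    ⟨l.2.2 % 2, Nat.mod_lt _ two_pos⟩, (l.1 / 2, l.2.1 / 2, l.2.2 / 2), ?_, ?_⟩
  · simp only [cubeBox, mem_product, mem_range]; omega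
  · simp only [classPoint]
    ext <;> simp only <;> omega

lemma logSum_classPoint (c₁ c₂ c₃ : Fin 2) (l : ℕ × ℕ × ℕ) :
    logSum (classPoint c₁ c₂ c₃ l) = logSum (c₁, c₂, c₃) + 2 * logSum l := by
  simp only [logSum, classPoint]; push_cast; ring

/-- Kummer descent: a vanishing exponential sum at an odd half-integer splits into classes. -/
lemma expSum_class_eq_zero {κ : Type*} (K : Finset κ) (a : κ → ℕ × ℕ × ℕ → ℤ) (Q : ℕ) (t : ℤ)
    (h : ∑ k ∈ K, ∑ l ∈ cubeBox (2 * Q),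
      (a k l : ℝ) * Real.exp (logSum l * (((2 * t + 1 : ℤ) : ℝ) / 2)) = 0) (c₁ c₂ c₃ : Fin 2) :
    ∑ k ∈ K, ∑ l ∈ cubeBox Q,
      (a k (classPoint c₁ c₂ c₃ l) : ℝ) * Real.exp (logSum l * ((2 * t + 1 : ℤ) : ℝ)) = 0 := by
  set A : Fin 2 → Fin 2 → Fin 2 → ℝ := fun i j m ↦ Real.exp (logSum (i, j, m) * t) *
    ∑ k ∈ K, ∑ l ∈ cubeBox Q,
      (a k (classPoint i j m l) : ℝ) * Real.exp (logSum l * ((2 * t + 1 : ℤ) : ℝ)) with hA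
  have h0 := eq_zero_of_sum_root_monomials (a := A) (fun i j m ↦ ?_) ?_ c₁ c₂ c₃
  · exact (mul_eq_zero.1 h0).resolve_left (Real.exp_ne_zero _)
  · refine mul_mem (exp_logSum_mul_mem _ _) (sum_mem fun k _ ↦ sum_mem fun l _ ↦ mul_mem ?_ ?_)
    · exact intCast_mem ratSqrtFive _
    · exact exp_logSum_mul_mem _ _
  · rw [← h]
    conv_rhs => rw [sum_congr rfl fun k _ ↦ sum_cubeBox_two_mul Q _, sum_comm]
    refine sum_congr rfl fun i _ ↦ ?_
    conv_rhs => rw [sum_comm]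
    refine sum_congr rfl fun j _ ↦ ?_
    conv_rhs => rw [sum_comm]
    refine sum_congr rfl fun m _ ↦ ?_
    have := rootPhi_pow_mul ((i : ℕ), (j : ℕ), (m : ℕ)) 1
    simp only [mul_one, Nat.cast_one] at this
    simp only [hA]
    rw [this, mul_comm, ← mul_assoc, mul_sum]
    refine sum_congr rfl fun k _ ↦ ?_
    rw [mul_sum]
    refine sum_congr rfl fun l _ ↦ ?_
    rw [logSum_classPoint, mul_left_comm, ← Real.exp_add, ← Real.exp_add]
    congr 2
    push_cast; ring

end

section

open Polynomial Finset

/-- The integer `2 j + 1 - n`. -/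
def nodeInt (n j : ℕ) : ℤ := 2 * j + 1 - n

lemma node_eq_nodeInt (n j : ℕ) : node n j = (nodeInt n j : ℝ) := by
  simp [node, nodeInt]

/-- The system of linear equations solved by the coefficients `p` of the auxiliary function. -/
def Vanish (b₁ b₂ b₃ : ℤ) (N : ℕ → ℕ → ℤ → ℤ) (D Q n T : ℕ) (p : ℕ → ℕ × ℕ × ℕ → ℤ) : Prop :=
  ∀ j < n, ∀ t₀ t₁ t₂, t₀ + t₁ + t₂ < T → ∑ k ∈ range D, ∑ l ∈ cubeBox Q,
    ((p k l * N k t₀ (Q * nodeInt n j) * (b₃ * l.1 - b₁ * l.2.2) ^ t₁ *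
      (b₃ * l.2.1 - b₂ * l.2.2) ^ t₂ : ℤ) : ℝ) * Real.exp (logSum l * (nodeInt n j : ℝ)) = 0

lemma sum_pow_eq_zero_of_affine {ι : Type*} (S : Finset ι) (w x y : ι → ℝ) (a b : ℝ) {m : ℕ}
    (h : ∀ t₁ t₂, t₁ + t₂ < m → ∑ i ∈ S, w i * (a + 2 * x i) ^ t₁ * (b + 2 * y i) ^ t₂ = 0)
    {t₁ t₂ : ℕ} (ht : t₁ + t₂ < m) : ∑ i ∈ S, w i * x i ^ t₁ * y i ^ t₂ = 0 := by
  have h1 : ∀ t u₁ u₂, t + u₁ + u₂ < m →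
      ∑ i ∈ S, w i * x i ^ t * (a + 2 * x i) ^ u₁ * (b + 2 * y i) ^ u₂ = 0 := by
    intro t
    induction t with
    | zero => intro u₁ u₂ hu; simpa using h u₁ u₂ (by omega)
    | succ t ih =>
      intro u₁ u₂ hu
      have e1 := ih (u₁ + 1) u₂ (by omega)
      have e2 := ih u₁ u₂ (by omega)
      have : ∑ i ∈ S, w i * x i ^ (t + 1) * (a + 2 * x i) ^ u₁ * (b + 2 * y i) ^ u₂ =
          1 / 2 * ∑ i ∈ S, w i * x i ^ t * (a + 2 * x i) ^ (u₁ + 1) * (b + 2 * y i) ^ u₂ -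
          a / 2 * ∑ i ∈ S, w i * x i ^ t * (a + 2 * x i) ^ u₁ * (b + 2 * y i) ^ u₂ := by
        rw [mul_sum, mul_sum, ← sum_sub_distrib]
        exact sum_congr rfl fun i _ ↦ by ring
      rw [this, e1, e2]; ring
  have h2 : ∀ t t' u, t + t' + u < m →
      ∑ i ∈ S, w i * x i ^ t' * y i ^ t * (b + 2 * y i) ^ u = 0 := by
    intro t
    induction t with
    | zero => intro t' u hu; simpa using h1 t' 0 u (by omega)
    | succ t ih =>
      intro t' u hu
      have e1 := ih t' (u + 1) (by omega)
      have e2 := ih t' u (by omega)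
      have : ∑ i ∈ S, w i * x i ^ t' * y i ^ (t + 1) * (b + 2 * y i) ^ u =
          1 / 2 * ∑ i ∈ S, w i * x i ^ t' * y i ^ t * (b + 2 * y i) ^ (u + 1) -
          b / 2 * ∑ i ∈ S, w i * x i ^ t' * y i ^ t * (b + 2 * y i) ^ u := by
        rw [mul_sum, mul_sum, ← sum_sub_distrib]
        exact sum_congr rfl fun i _ ↦ by ring
      rw [this, e1, e2]; ring
  simpa using h2 t₂ t₁ 0 (by omega)

section Step

variable {b₁ b₂ b₃ : ℤ} {N : ℕ → ℕ → ℤ → ℤ} {D Q n m v : ℕ} {p : ℕ → ℕ × ℕ × ℕ → ℤ}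
  {r : ℕ → ℂ[X]} {K P N₀ R₁ R₂ E Λ : ℝ}

lemma mem_cubeBox {Q : ℕ} {l : ℕ × ℕ × ℕ} : l ∈ cubeBox Q ↔ l.1 < Q ∧ l.2.1 < Q ∧ l.2.2 < Q := by
  simp [cubeBox]

lemma card_cubeBox (Q : ℕ) : #(cubeBox Q) = Q ^ 3 := by
  simp [cubeBox]; ring

/-- The auxiliary function vanishes at half-integers. -/
lemma Vanish.half (hV : Vanish b₁ b₂ b₃ N D Q n (2 * m) p) (hb : b₃ ≠ 0) (hn : 0 < n)
    (hv : 1 ≤ v) (hvK : v ≤ K)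
    (hΛ : Λ = b₁ * Real.log Real.goldenRatio + b₂ * Real.log (Real.sqrt 5) + b₃ * Real.log 2)
    (hN : ∀ k t y, (N k t y : ℂ) = (v : ℂ) ^ t * (hasseDeriv t (r k)).eval (y : ℂ))
    (hc : ∀ l ∈ cubeBox Q, |(b₃ * l.1 - b₁ * l.2.2 : ℝ)| ≤ K ∧ |(b₃ * l.2.1 - b₂ * l.2.2 : ℝ)| ≤ K)
    (hR₁ : ∀ k < D, ∀ t, ∀ z : ℂ, ‖z‖ ≤ Q * (n + 1) → ‖(hasseDeriv t (r k)).eval z‖ ≤ R₁)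
    (hR₂ : ∀ k < D, ∀ t, ∀ z : ℂ, ‖z‖ ≤ Q * (E * n) → ‖(hasseDeriv t (r k)).eval z‖ ≤ R₂)
    (hR₁0 : 0 ≤ R₁) (hR₂0 : 0 ≤ R₂) (hE : 2 ≤ E)
    (hp : ∀ k l, |(p k l : ℝ)| ≤ P) (hN₀ : D * Q ^ 3 * P ≤ N₀) (hδ : Q * |Λ| * n ≤ 1)
    (hnum : (N₀ * K ^ m * R₂ * Real.exp ((logTotal * Q + Q * |Λ|) * (E * n)) /
        Real.sqrt (E ^ 2 - 1) ^ (n * m) +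
      3 * (N₀ * K ^ m * R₁ * Real.exp (logTotal * Q * n) * Real.exp (logTotal * Q + Q * |Λ|) *
        (2 * (Q * |Λ|) * n)) * (22 * (E + 1)) ^ (n * m)) *
      (Real.exp (logTotal * (Q * n)) * (N₀ * K ^ m * R₁ * Real.exp (logTotal * (Q * n))) ^ 15) < 1)
    {s y : ℤ} (hs : |(s : ℝ)| ≤ 2 * n) (hy : 2 * y = Q * s) {t₀ t₁ t₂ : ℕ} (ht : t₀ + t₁ + t₂ < m) :
    ∑ k ∈ range D, ∑ l ∈ cubeBox Q, ((p k l * N k t₀ y * (b₃ * l.1 - b₁ * l.2.2) ^ t₁ *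
      (b₃ * l.2.1 - b₂ * l.2.2) ^ t₂ : ℤ) : ℝ) * Real.exp (logSum l * (s / 2)) = 0 := by
  have hb' : (b₃ : ℝ) ≠ 0 := by exact_mod_cast hb
  have hb1 : (1 : ℝ) ≤ |(b₃ : ℝ)| := by exact_mod_cast Int.one_le_abs hb
  have hv0 : (v : ℂ) ≠ 0 := by exact_mod_cast (show v ≠ 0 by omega)
  have hv1 : (1 : ℝ) ≤ v := by exact_mod_cast hv
  have hK1 : 1 ≤ K := hv1.trans hvK
  have hP0 : 0 ≤ P := (abs_nonneg _).trans (hp 0 0)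
  have hN₀0 : 0 ≤ N₀ := le_trans (by positivity) hN₀
  set S := range D ×ˢ cubeBox Q with hS
  have hSmem : ∀ i ∈ S, i.1 < D ∧ i.2 ∈ cubeBox Q := fun i hi ↦ by simpa [hS] using hi
  have hsum : ∑ i ∈ S, |(p i.1 i.2 : ℝ)| ≤ N₀ := by
    calc _ ≤ ∑ i ∈ S, P := sum_le_sum fun i _ ↦ hp _ _
      _ = D * Q ^ 3 * P := by rw [sum_const, hS, card_product, card_range, card_cubeBox]; simp
      _ ≤ N₀ := hN₀
  have hLl : ∀ i ∈ S, |logSum i.2| ≤ logTotal * Q := fun i hi ↦ by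
    have := mem_cubeBox.1 (hSmem i hi).2
    rw [abs_of_nonneg (logSum_nonneg _)]
    exact logSum_le this.1.le this.2.1.le this.2.2.le
  set x : ℝ := (s : ℝ) / 2 with hx
  have hx' : |x| ≤ n := by rw [hx, abs_div, abs_two]; linarith
  have hyx : (y : ℂ) = ((Q : ℝ) : ℂ) * (x : ℂ) := by
    have : (2 : ℂ) * y = Q * s := by exact_mod_cast hy
    rw [hx]; push_cast; linear_combination this / 2
  have hterm : ∀ (t₀ t₁ t₂ : ℕ) (y : ℤ) (i : ℕ × ℕ × ℕ × ℕ) (w : ℝ),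
      (((p i.1 i.2 * N i.1 t₀ y * (b₃ * i.2.1 - b₁ * i.2.2.2) ^ t₁ *
      (b₃ * i.2.2.1 - b₂ * i.2.2.2) ^ t₂ : ℤ) : ℝ) * Real.exp (logSum i.2 * w) : ℂ) =
      (v : ℂ) ^ t₀ * (((p i.1 i.2 : ℝ) : ℂ) * (hasseDeriv t₀ (r i.1)).eval (y : ℂ) *
        ((b₃ * i.2.1 - b₁ * i.2.2.2 : ℝ) : ℂ) ^ t₁ * ((b₃ * i.2.2.1 - b₂ * i.2.2.2 : ℝ) : ℂ) ^ t₂ *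
        Complex.exp ((logSum i.2 : ℂ) * w)) := fun t₀ t₁ t₂ y i w ↦ by
    push_cast
    rw [hN]; ring
  have key := norm_expSum_le (S := S) (p := fun i ↦ (p i.1 i.2 : ℝ))
    (c₁ := fun i ↦ (b₃ * i.2.1 - b₁ * i.2.2.2 : ℝ)) (c₂ := fun i ↦ (b₃ * i.2.2.1 - b₂ * i.2.2.2 : ℝ))
    (L := fun i ↦ logSum i.2) (θ := fun i ↦ i.2.2.2 * Λ / b₃) (r := fun i ↦ r i.1) (Q := Q)
    (by positivity) (g₁ := Real.log Real.goldenRatio / b₃) (g₂ := Real.log (Real.sqrt 5) / b₃)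
    (fun i hi ↦ by rw [hΛ, logSum]; field_simp; ring) (n := n) (m := m) hn
    (fun j hj a b c habc ↦ by
      have h1 := hV j hj a b c habc
      rw [← sum_product (f := fun i : ℕ × ℕ × ℕ × ℕ ↦ ((p i.1 i.2 * N i.1 a (Q * nodeInt n j) *
        (b₃ * i.2.1 - b₁ * i.2.2.2) ^ b * (b₃ * i.2.2.1 - b₂ * i.2.2.2) ^ c : ℤ) : ℝ) *
          Real.exp (logSum i.2 * (nodeInt n j : ℝ)))] at h1
      have h2 := congrArg (Complex.ofReal) h1
      rw [Complex.ofReal_sum] at h2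
      simp only [Complex.ofReal_mul] at h2
      rw [sum_congr rfl fun i _ ↦ hterm a b c _ i _, ← mul_sum, Complex.ofReal_zero] at h2
      have h3 := (mul_eq_zero.1 h2).resolve_left (pow_ne_zero _ hv0)
      rw [← h3, node_eq_nodeInt]
      push_cast
      rfl)
    (t₀ := t₀) (t₁ := t₁) (t₂ := t₂) ht (E := E) (N := N₀) (C := K ^ (t₁ + t₂)) (R₁ := R₁)
    (R₂ := R₂) (Lmax := logTotal * Q) (δ := Q * |Λ|) hE hsum hδ
    (fun i hi ↦ by
      have := hc _ (hSmem i hi).2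
      rw [pow_add]
      gcongr
      · exact this.1
      · exact this.2)
    (fun i hi z hz ↦ hR₁ _ (hSmem i hi).1 _ z hz) (fun i hi z hz ↦ hR₂ _ (hSmem i hi).1 _ z hz)
    hR₁0 hR₂0 (by positivity) (mul_nonneg logTotal_nonneg (by positivity)) (by positivity)
    hLl
    (fun i hi ↦ by
      have := (mem_cubeBox.1 (hSmem i hi).2).2.2
      rw [abs_div, abs_mul, Nat.abs_cast]
      refine (div_le_self (by positivity) hb1).trans ?_
      gcongr) hx'
  rw [← sum_product (f := fun i : ℕ × ℕ × ℕ × ℕ ↦ ((p i.1 i.2 * N i.1 t₀ y *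
        (b₃ * i.2.1 - b₁ * i.2.2.2) ^ t₁ * (b₃ * i.2.2.1 - b₂ * i.2.2.2) ^ t₂ : ℤ) : ℝ) *
          Real.exp (logSum i.2 * x))]
  set V := ∑ i ∈ S, ((p i.1 i.2 * N i.1 t₀ y *
        (b₃ * i.2.1 - b₁ * i.2.2.2) ^ t₁ * (b₃ * i.2.2.1 - b₂ * i.2.2.2) ^ t₂ : ℤ) : ℝ) *
          Real.exp (logSum i.2 * x) with hVdef
  have hVnorm : |V| = (v : ℝ) ^ t₀ * ‖∑ i ∈ S, ((p i.1 i.2 : ℝ) : ℂ) *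
      (hasseDeriv t₀ (r i.1)).eval (((Q : ℝ) : ℂ) * x) *
        ((b₃ * i.2.1 - b₁ * i.2.2.2 : ℝ) : ℂ) ^ t₁ * ((b₃ * i.2.2.1 - b₂ * i.2.2.2 : ℝ) : ℂ) ^ t₂ *
        Complex.exp ((logSum i.2 : ℂ) * x)‖ := by
    rw [← Real.norm_eq_abs, ← Complex.norm_real, hVdef, Complex.ofReal_sum]
    simp only [Complex.ofReal_mul]
    rw [sum_congr rfl fun i _ ↦ hterm t₀ t₁ t₂ _ i _, ← mul_sum, norm_mul, norm_pow,
      Complex.norm_natCast, hyx]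
  have hvt : (v : ℝ) ^ t₀ * K ^ (t₁ + t₂) ≤ K ^ m := by
    calc _ ≤ K ^ t₀ * K ^ (t₁ + t₂) := by gcongr
      _ = K ^ (t₀ + t₁ + t₂) := by rw [← pow_add]; ring_nf
      _ ≤ K ^ m := pow_le_pow_right₀ hK1 ht.le
  by_contra hV0
  have hA : ∑ i ∈ S, |((p i.1 i.2 * N i.1 t₀ y *
        (b₃ * i.2.1 - b₁ * i.2.2.2) ^ t₁ * (b₃ * i.2.2.1 - b₂ * i.2.2.2) ^ t₂ : ℤ) : ℝ)| ≤
      N₀ * K ^ m * R₁ := by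
    have hi : ∀ i ∈ S, |((p i.1 i.2 * N i.1 t₀ y * (b₃ * i.2.1 - b₁ * i.2.2.2) ^ t₁ *
        (b₃ * i.2.2.1 - b₂ * i.2.2.2) ^ t₂ : ℤ) : ℝ)| ≤ |(p i.1 i.2 : ℝ)| * (K ^ m * R₁) := by
      intro i hi
      obtain ⟨hc₁, hc₂⟩ := hc _ (hSmem i hi).2
      have hNb : |(N i.1 t₀ y : ℝ)| ≤ (v : ℝ) ^ t₀ * R₁ := by
        have : |(N i.1 t₀ y : ℝ)| = ‖(N i.1 t₀ y : ℂ)‖ := by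
          rw [Complex.norm_intCast]
        rw [this, hN, norm_mul, norm_pow, Complex.norm_natCast]
        gcongr
        refine hR₁ _ (hSmem i hi).1 _ _ ?_
        rw [hyx, norm_mul, Complex.norm_real, Complex.norm_real, Real.norm_eq_abs, Nat.abs_cast]
        gcongr
        rw [Real.norm_eq_abs]; linarith
      push_cast
      rw [abs_mul, abs_mul, abs_mul, abs_pow, abs_pow]
      calc _ ≤ |(p i.1 i.2 : ℝ)| * ((v : ℝ) ^ t₀ * R₁) * K ^ t₁ * K ^ t₂ := by gcongr
        _ = |(p i.1 i.2 : ℝ)| * (((v : ℝ) ^ t₀ * K ^ (t₁ + t₂)) * R₁) := by rw [pow_add]; ring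
        _ ≤ _ := by gcongr
    calc _ ≤ ∑ i ∈ S, |(p i.1 i.2 : ℝ)| * (K ^ m * R₁) := sum_le_sum hi
      _ ≤ N₀ * (K ^ m * R₁) := by rw [← sum_mul]; gcongr
      _ = _ := by ring
  have hLiou := one_le_abs_expSum_mul S _ (fun i ↦ i.2) (Q := Q)
    (fun i hi ↦ by
      have := mem_cubeBox.1 (hSmem i hi).2
      exact ⟨this.1.le, this.2.1.le, this.2.2.le⟩) hs hA hVdef hV0
  refine absurd (hLiou.trans ?_) (not_le.2 hnum)
  gcongr
  rw [hVnorm]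
  refine (mul_le_mul_of_nonneg_left key (by positivity)).trans ?_
  rw [mul_add]
  have hE1 : 0 < E ^ 2 - 1 := by nlinarith
  refine add_le_add ?_ ?_
  · calc _ = N₀ * ((v : ℝ) ^ t₀ * K ^ (t₁ + t₂)) * R₂ *
          Real.exp ((logTotal * Q + Q * |Λ|) * (E * n)) / Real.sqrt (E ^ 2 - 1) ^ (n * m) := by ring
      _ ≤ _ := by gcongr
  · calc _ = 3 * (N₀ * ((v : ℝ) ^ t₀ * K ^ (t₁ + t₂)) * R₁ * Real.exp (logTotal * Q * n) *
          Real.exp (logTotal * Q + Q * |Λ|) * (2 * (Q * |Λ|) * n)) *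
          (22 * (E + 1)) ^ (n * m) := by ring
      _ ≤ _ := by gcongr

lemma Vanish.descend (hne : ∃ k < D, ∃ l ∈ cubeBox (2 * Q), p k l ≠ 0)
    (hhalf : ∀ s y : ℤ, |(s : ℝ)| ≤ 2 * n → 2 * y = (2 * Q : ℕ) * s → ∀ t₀ t₁ t₂ : ℕ,
      t₀ + t₁ + t₂ < m → ∑ k ∈ range D, ∑ l ∈ cubeBox (2 * Q),
        ((p k l * N k t₀ y * (b₃ * l.1 - b₁ * l.2.2) ^ t₁ *
          (b₃ * l.2.1 - b₂ * l.2.2) ^ t₂ : ℤ) : ℝ) * Real.exp (logSum l * (s / 2)) = 0) :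
    ∃ c₁ c₂ c₃ : Fin 2,
      Vanish b₁ b₂ b₃ N D Q (2 * n) m (fun k l ↦ p k (classPoint c₁ c₂ c₃ l)) ∧
      ∃ k < D, ∃ l ∈ cubeBox Q, p k (classPoint c₁ c₂ c₃ l) ≠ 0 := by
  obtain ⟨k, hk, l, hl, hpl⟩ := hne
  obtain ⟨c₁, c₂, c₃, l', hl', rfl⟩ := exists_classPoint hl
  refine ⟨c₁, c₂, c₃, fun j hj t₀ t₁ t₂ ht ↦ ?_, k, hk, l', hl', hpl⟩
  set s := nodeInt (2 * n) j with hs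
  have hs2 : |(s : ℝ)| ≤ 2 * n := by
    rw [hs, ← node_eq_nodeInt]; exact_mod_cast abs_node_le hj
  have hodd : s = 2 * ((j : ℤ) - n) + 1 := by rw [hs, nodeInt]; push_cast; ring
  have h1 : ∀ u₁ u₂, u₁ + u₂ < m - t₀ → _ := fun u₁ u₂ hu ↦
    expSum_class_eq_zero (range D) (fun k l ↦ p k l * N k t₀ (Q * s) *
      (b₃ * l.1 - b₁ * l.2.2) ^ u₁ * (b₃ * l.2.1 - b₂ * l.2.2) ^ u₂) Q ((j : ℤ) - n)
      (by rw [← hodd]; exact hhalf s (Q * s) hs2 (by push_cast; ring) t₀ u₁ u₂ (by omega)) c₁ c₂ c₃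
  have h2 := sum_pow_eq_zero_of_affine (range D ×ˢ cubeBox Q)
    (fun i ↦ (p i.1 (classPoint c₁ c₂ c₃ i.2) : ℝ) * N i.1 t₀ (Q * s) *
      Real.exp (logSum i.2 * s)) (fun i ↦ b₃ * i.2.1 - b₁ * i.2.2.2)
      (fun i ↦ b₃ * i.2.2.1 - b₂ * i.2.2.2) (b₃ * (c₁ : ℕ) - b₁ * (c₃ : ℕ))
      (b₃ * (c₂ : ℕ) - b₂ * (c₃ : ℕ)) (m := m - t₀) (fun u₁ u₂ hu ↦ by
        rw [← h1 u₁ u₂ hu, sum_product, ← hodd]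
        refine sum_congr rfl fun k _ ↦ sum_congr rfl fun l _ ↦ ?_
        simp only [classPoint]
        push_cast
        ring) (t₁ := t₁) (t₂ := t₂) (by omega)
  rw [← h2, sum_product]
  refine sum_congr rfl fun k _ ↦ sum_congr rfl fun l _ ↦ ?_
  push_cast
  ring

end Step

end

section

open Finset

/-- Siegel's lemma for a system with six times as many unknowns as equations. -/
lemma exists_int_solution_of_six_mul_card_le {ι κ : Type*} [DecidableEq κ] (S : Finset ι)
    (U : Finset κ) (a : ι → κ → ℤ) {B : ℝ} (hB : 1 ≤ B) (ha : ∀ i ∈ S, ∀ k ∈ U, |(a i k : ℝ)| ≤ B)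
    (hS : 0 < #S) (hU : 6 * #S ≤ #U) :
    ∃ p : κ → ℤ, (∀ k, |(p k : ℝ)| ≤ (#U * B) ^ ((1 : ℝ) / 5)) ∧ (∃ k ∈ U, p k ≠ 0) ∧
      ∀ i ∈ S, ∑ k ∈ U, p k * a i k = 0 := by
  let _ : SeminormedAddCommGroup (Matrix S U ℤ) := Matrix.seminormedAddCommGroup
  let A : Matrix S U ℤ := fun i k ↦ a i k
  have hSU : Fintype.card S < Fintype.card U := by simp; omega
  obtain ⟨t, ht0, htA, htn⟩ := Int.Matrix.exists_ne_zero_int_vec_norm_le A hSU (by simpa using hS)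
  have hA : max 1 ‖A‖ ≤ B := by
    refine max_le hB ((Matrix.norm_le_iff (by linarith)).2 fun i k ↦ ?_)
    rw [Int.norm_eq_abs]
    exact ha i i.2 k k.2
  simp only [Fintype.card_coe] at htn
  have hUpos : (1 : ℝ) ≤ #U := by exact_mod_cast (by omega : 1 ≤ #U)
  have hSpos : (0 : ℝ) < #S := by exact_mod_cast hS
  have hU' : (6 : ℝ) * #S ≤ #U := by exact_mod_cast hU
  have hbound : ‖t‖ ≤ (#U * B) ^ ((1 : ℝ) / 5) := by
    refine htn.trans ((Real.rpow_le_rpow (by positivity) (mul_le_mul_of_nonneg_left hA (by positivity))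
      (by apply div_nonneg <;> linarith)).trans (Real.rpow_le_rpow_of_exponent_le ?_ ?_))
    · nlinarith
    · rw [div_le_div_iff₀ (by linarith) (by norm_num)]; linarith
  refine ⟨fun k ↦ if h : k ∈ U then t ⟨k, h⟩ else 0, fun k ↦ ?_, ?_, fun i hi ↦ ?_⟩
  · by_cases h : k ∈ U
    · simp only [h, dite_true]
      exact (by rw [← Int.norm_eq_abs]; exact (norm_le_pi_norm t ⟨k, h⟩).trans hbound)
    · simp only [h, dite_false, Int.cast_zero, abs_zero]; positivity
  · obtain ⟨k, hk⟩ := Function.ne_iff.1 ht0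
    exact ⟨k, k.2, by simpa using hk⟩
  · have := congrFun htA ⟨i, hi⟩
    simp only [Matrix.mulVec, dotProduct, Pi.zero_apply, A] at this
    rw [← Finset.sum_coe_sort U, ← this]
    exact sum_congr rfl fun k _ ↦ by simp [mul_comm]

/-- The exponents `(t₀, t₁, t₂)` with `t₀ + t₁ + t₂ < T`. -/
def simplex (T : ℕ) : Finset (Σ _ : ℕ, Σ _ : ℕ, ℕ) :=
  (range T).sigma fun a ↦ (range (T - a)).sigma fun b ↦ range (T - a - b)

lemma mem_simplex {T a b c : ℕ} : (⟨a, b, c⟩ : Σ _ : ℕ, Σ _ : ℕ, ℕ) ∈ simplex T ↔ a + b + c < T := by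
  simp [simplex]; omega

lemma six_mul_card_simplex (T : ℕ) : 6 * #(simplex T) = T * (T + 1) * (T + 2) := by
  have h1 : ∀ M : ℕ, 2 * ∑ b ∈ range M, (M - b) = M * (M + 1) := fun M ↦ by
    induction M with
    | zero => simp
    | succ M ih =>
      rw [sum_range_succ']
      simp only [Nat.add_sub_add_right, Nat.sub_zero]
      rw [mul_add, ih]; ring
  simp only [simplex, card_sigma, card_range]
  induction T with
  | zero => simp
  | succ T ih =>
    rw [sum_range_succ']
    simp only [Nat.add_sub_add_right, Nat.sub_zero]
    rw [mul_add, ih]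
    have := h1 (T + 1)
    linarith [this]

lemma exists_int_add_mul_goldenRatio (a b c : ℕ) : ∃ u v : ℤ,
    Real.goldenRatio ^ a * Real.sqrt 5 ^ b * 2 ^ c = u + v * Real.goldenRatio ∧
      |(u : ℝ)| ≤ 2 ^ a * 3 ^ b * 2 ^ c ∧ |(v : ℝ)| ≤ 2 ^ a * 3 ^ b * 2 ^ c := by
  have h5 : Real.sqrt 5 = 2 * Real.goldenRatio - 1 := by rw [Real.goldenRatio]; ring
  have hφ := Real.goldenRatio_sq
  induction a with
  | zero =>
    induction b with
    | zero =>
      exact ⟨2 ^ c, 0, by simp, by simp, by simp⟩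
    | succ b ih =>
      obtain ⟨u, v, h, hu, hv⟩ := ih
      refine ⟨2 * v - u, 2 * u + v, ?_, ?_, ?_⟩
      · have : Real.goldenRatio ^ 0 * Real.sqrt 5 ^ (b + 1) * 2 ^ c =
          (Real.goldenRatio ^ 0 * Real.sqrt 5 ^ b * 2 ^ c) * Real.sqrt 5 := by ring
        rw [this, h, h5]; push_cast; linear_combination 2 * (v : ℝ) * hφ
      all_goals
        push_cast
        rw [pow_succ]
        rw [abs_le] at *
        constructor <;> linarith
  | succ a ih =>
    obtain ⟨u, v, h, hu, hv⟩ := ih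
    refine ⟨v, u + v, ?_, ?_, ?_⟩
    · have : Real.goldenRatio ^ (a + 1) * Real.sqrt 5 ^ b * 2 ^ c =
          (Real.goldenRatio ^ a * Real.sqrt 5 ^ b * 2 ^ c) * Real.goldenRatio := by ring
      rw [this, h]; push_cast; linear_combination (v : ℝ) * hφ
    all_goals
      push_cast
      rw [pow_succ]
      rw [abs_le] at *
      constructor <;> linarith

lemma exists_exp_logSum_mul_eq {Q : ℕ} {l : ℕ × ℕ × ℕ}
    (hl : l.1 ≤ Q ∧ l.2.1 ≤ Q ∧ l.2.2 ≤ Q) (s : ℕ) : ∃ u v : ℤ,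
    Real.exp (logSum l * s) = u + v * Real.goldenRatio ∧
      |(u : ℝ)| ≤ 12 ^ (Q * s) ∧ |(v : ℝ)| ≤ 12 ^ (Q * s) := by
  obtain ⟨u, v, h, hu, hv⟩ := exists_int_add_mul_goldenRatio (l.1 * s) (l.2.1 * s) (l.2.2 * s)
  have hb : (2 : ℝ) ^ (l.1 * s) * 3 ^ (l.2.1 * s) * 2 ^ (l.2.2 * s) ≤ 12 ^ (Q * s) := by
    have : (12 : ℝ) ^ (Q * s) = 2 ^ (Q * s) * 3 ^ (Q * s) * 2 ^ (Q * s) := by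
      rw [← mul_pow, ← mul_pow]; norm_num
    rw [this]
    gcongr <;> first | exact hl.1 | exact hl.2.1 | exact hl.2.2 | norm_num
  refine ⟨u, v, ?_, hu.trans hb, hv.trans hb⟩
  rw [← h]
  have key : ∀ {x : ℝ}, 0 < x → ∀ m : ℕ, x ^ (m * s) = Real.exp (m * Real.log x * s) :=
    fun {x} hx m ↦ by
      rw [← Real.exp_log (pow_pos hx (m * s)), Real.log_pow]
      congr 1; push_cast; ring
  rw [key Real.goldenRatio_pos, key (by positivity : 0 < Real.sqrt 5), key (by norm_num : (0:ℝ) < 2),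
    ← Real.exp_add, ← Real.exp_add, logSum]
  congr 1; ring

/-- After multiplication by a positive constant depending only on `s`, the values `exp (logSum l * s)`
for `l` in a box are small elements of `ℤ[φ]`. -/
lemma exists_pos_mul_exp_logSum_eq (Q : ℕ) {n : ℕ} {s : ℤ} (hs : |s| ≤ n) :
    ∃ (g : ℝ) (u v : ℕ × ℕ × ℕ → ℤ), 0 < g ∧ ∀ l ∈ cubeBox Q,
      g * Real.exp (logSum l * s) = u l + v l * Real.goldenRatio ∧
        |(u l : ℝ)| ≤ 12 ^ (Q * n) ∧ |(v l : ℝ)| ≤ 12 ^ (Q * n) := by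
  suffices ∃ (g : ℝ), 0 < g ∧ ∀ l : cubeBox Q, ∃ u v : ℤ,
      g * Real.exp (logSum l * s) = u + v * Real.goldenRatio ∧
        |(u : ℝ)| ≤ 12 ^ (Q * n) ∧ |(v : ℝ)| ≤ 12 ^ (Q * n) by
    obtain ⟨g, hg, h⟩ := this
    choose u v h using h
    refine ⟨g, fun l ↦ if hl : l ∈ cubeBox Q then u ⟨l, hl⟩ else 0,
      fun l ↦ if hl : l ∈ cubeBox Q then v ⟨l, hl⟩ else 0, hg, fun l hl ↦ ?_⟩
    simpa [hl] using h ⟨l, hl⟩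
  have hns : ∀ k : ℕ, (k : ℤ) ≤ n → (12 : ℝ) ^ (Q * k) ≤ 12 ^ (Q * n) := fun k hk ↦
    pow_le_pow_right₀ (by norm_num) (Nat.mul_le_mul_left _ (by exact_mod_cast hk))
  obtain ⟨k, rfl | rfl⟩ := s.eq_nat_or_neg
  · refine ⟨1, one_pos, fun l ↦ ?_⟩
    have hl := mem_cubeBox.1 l.2
    obtain ⟨u, v, h, hu, hv⟩ := exists_exp_logSum_mul_eq ⟨hl.1.le, hl.2.1.le, hl.2.2.le⟩ k
    have hk : (k : ℤ) ≤ n := by simpa using hs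
    exact ⟨u, v, by simpa using h, hu.trans (hns k hk), hv.trans (hns k hk)⟩
  · refine ⟨Real.exp (logTotal * Q * k), Real.exp_pos _, fun l ↦ ?_⟩
    have hl := mem_cubeBox.1 l.2
    obtain ⟨u, v, h, hu, hv⟩ := exists_exp_logSum_mul_eq (Q := Q)
      (l := (Q - l.1.1, Q - l.1.2.1, Q - l.1.2.2))
      ⟨Nat.sub_le _ _, Nat.sub_le _ _, Nat.sub_le _ _⟩ k
    have hk : (k : ℤ) ≤ n := by simpa using hs
    refine ⟨u, v, ?_, hu.trans (hns k hk), hv.trans (hns k hk)⟩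
    rw [← h, ← Real.exp_add, ← logSum_diag]
    simp only [logSum]
    push_cast [Nat.cast_sub hl.1.le, Nat.cast_sub hl.2.1.le, Nat.cast_sub hl.2.2.le]
    congr 1; ring

lemma exists_vanish {b₁ b₂ b₃ : ℤ} {N : ℕ → ℕ → ℤ → ℤ} {D Q n T : ℕ} {K R : ℝ} (hK : 1 ≤ K)
    (hR : 1 ≤ R) (hn : 0 < n) (hT : 0 < T)
    (hN : ∀ k < D, ∀ t, ∀ y : ℤ, |(y : ℝ)| ≤ Q * n → |(N k t y : ℝ)| ≤ K ^ t * R)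
    (hc : ∀ l ∈ cubeBox Q, |(b₃ * l.1 - b₁ * l.2.2 : ℝ)| ≤ K ∧ |(b₃ * l.2.1 - b₂ * l.2.2 : ℝ)| ≤ K)
    (hcard : 2 * n * (T * (T + 1) * (T + 2)) ≤ D * Q ^ 3) :
    ∃ p : ℕ → ℕ × ℕ × ℕ → ℤ,
      (∀ k l, |(p k l : ℝ)| ≤ (D * Q ^ 3 * (12 ^ (Q * n) * K ^ T * R)) ^ ((1 : ℝ) / 5)) ∧
      (∃ k < D, ∃ l ∈ cubeBox Q, p k l ≠ 0) ∧ Vanish b₁ b₂ b₃ N D Q n T p := by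
  have hnode : ∀ j : Fin n, |nodeInt n j| ≤ n := fun j ↦ by
    have := abs_node_le j.2
    rw [node_eq_nodeInt] at this
    exact_mod_cast this
  choose g u v hg huv using fun j : Fin n ↦ exists_pos_mul_exp_logSum_eq Q (hnode j)
  let S : Finset ((Fin n × Bool) × Σ _ : ℕ, Σ _ : ℕ, ℕ) := univ ×ˢ simplex T
  let U : Finset (ℕ × ℕ × ℕ × ℕ) := range D ×ˢ cubeBox Q
  let e : (Fin n × Bool) × (Σ _ : ℕ, Σ _ : ℕ, ℕ) → ℕ × ℕ × ℕ × ℕ → ℤ := fun i k ↦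
    N k.1 i.2.1 (Q * nodeInt n i.1.1) * (b₃ * k.2.1 - b₁ * k.2.2.2) ^ i.2.2.1 *
      (b₃ * k.2.2.1 - b₂ * k.2.2.2) ^ i.2.2.2 * (if i.1.2 then u i.1.1 k.2 else v i.1.1 k.2)
  have hS : #S = 2 * n * #(simplex T) := by simp [S, mul_comm]
  have hU : #U = D * Q ^ 3 := by simp [U, card_cubeBox]
  have hB : ∀ i ∈ S, ∀ k ∈ U, |(e i k : ℝ)| ≤ 12 ^ (Q * n) * K ^ T * R := by
    rintro ⟨⟨j, z⟩, ⟨t₀, t₁, t₂⟩⟩ hi ⟨k, l⟩ hk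
    simp only [S, U, mem_product, mem_univ, true_and, mem_simplex, mem_range] at hi hk
    have h1 : |(N k t₀ (Q * nodeInt n j) : ℝ)| ≤ K ^ t₀ * R := hN k hk.1 t₀ _ (by
      push_cast; rw [abs_mul, Nat.abs_cast]
      have := hnode j
      have h' : |(nodeInt n j : ℝ)| ≤ n := by exact_mod_cast this
      gcongr)
    have h2 : |((if z then u j l else v j l : ℤ) : ℝ)| ≤ 12 ^ (Q * n) := by
      cases z
      · simpa using (huv j l hk.2).2.2
      · simpa using (huv j l hk.2).2.1
    obtain ⟨c1, c2⟩ := hc l hk.2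
    simp only [e, Int.cast_mul, Int.cast_pow, Int.cast_sub, Int.cast_natCast, abs_mul, abs_pow]
    calc _ ≤ (K ^ t₀ * R) * K ^ t₁ * K ^ t₂ * 12 ^ (Q * n) := by gcongr
      _ = 12 ^ (Q * n) * K ^ (t₀ + t₁ + t₂) * R := by rw [pow_add, pow_add]; ring
      _ ≤ _ := by gcongr
  have hone : 1 ≤ 12 ^ (Q * n) * K ^ T * R :=
    one_le_mul_of_one_le_of_one_le (one_le_mul_of_one_le_of_one_le
      (one_le_pow₀ (by norm_num)) (one_le_pow₀ hK)) hR
  have h6 := six_mul_card_simplex T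
  obtain ⟨p, hp, ⟨k, hk, hk0⟩, hsol⟩ := exists_int_solution_of_six_mul_card_le S U e hone hB
    (by
      rw [hS]
      have : 0 < T * (T + 1) * (T + 2) := by positivity
      have : 0 < #(simplex T) := by omega
      positivity)
    (by
      rw [hS, hU]
      calc _ = 2 * n * (6 * #(simplex T)) := by ring
        _ ≤ _ := by rw [h6]; exact hcard)
  refine ⟨fun k l ↦ p (k, l), fun k l ↦ ?_, ?_, ?_⟩
  · simpa [hU] using hp (k, l)
  · simp only [U, mem_product, mem_range] at hk
    exact ⟨k.1, hk.1, k.2, hk.2, hk0⟩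
  · intro j hj t₀ t₁ t₂ ht
    have e1 := hsol ((⟨j, hj⟩, true), ⟨t₀, t₁, t₂⟩) (by simp [S, mem_simplex, ht])
    have e2 := hsol ((⟨j, hj⟩, false), ⟨t₀, t₁, t₂⟩) (by simp [S, mem_simplex, ht])
    simp only [U, sum_product, e] at e1 e2
    have e1' := congrArg (Int.cast : ℤ → ℝ) e1
    have e2' := congrArg (Int.cast : ℤ → ℝ) e2
    simp only [Int.cast_sum, Int.cast_zero, if_true] at e1' e2'
    refine (mul_eq_zero.1 (?_ : g ⟨j, hj⟩ * _ = 0)).resolve_left (hg ⟨j, hj⟩).ne'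
    have e3 := congrArg₂ (fun a b : ℝ ↦ a + Real.goldenRatio * b) e1' e2'
    refine Eq.trans ?_ (e3.trans (by simp))
    beta_reduce
    rw [mul_sum, mul_sum, ← sum_add_distrib]
    refine sum_congr rfl fun k _ ↦ ?_
    rw [mul_sum, mul_sum, ← sum_add_distrib]
    refine sum_congr rfl fun l hl ↦ ?_
    have := (huv ⟨j, hj⟩ l hl).1
    push_cast at this ⊢
    linear_combination ((p (k, l) : ℝ) * N k t₀ (Q * nodeInt n j) * (b₃ * l.1 - b₁ * l.2.2) ^ t₁ *
      (b₃ * l.2.1 - b₂ * l.2.2) ^ t₂) * this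

end

section

open Polynomial Finset

section Iterate

variable {b₁ b₂ b₃ : ℤ} {N : ℕ → ℕ → ℤ → ℤ} {D J n τ v : ℕ} {p : ℕ → ℕ × ℕ × ℕ → ℤ}
  {r : ℕ → ℂ[X]} {K P N₀ R₁ R₂ E Λ : ℝ}

/-- Kummer descent: starting from the box of side `2 ^ (J + 1)`, the box is halved repeatedly. -/
lemma Vanish.iterate
    (hV : Vanish b₁ b₂ b₃ N D (2 ^ (J + 1)) n (τ * 2 ^ (J + 1)) p)
    (hne : ∃ k < D, ∃ l ∈ cubeBox (2 ^ (J + 1)), p k l ≠ 0) (hb : b₃ ≠ 0) (hn : 0 < n)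
    (hv : 1 ≤ v) (hvK : v ≤ K)
    (hΛ : Λ = b₁ * Real.log Real.goldenRatio + b₂ * Real.log (Real.sqrt 5) + b₃ * Real.log 2)
    (hN : ∀ k t y, (N k t y : ℂ) = (v : ℂ) ^ t * (hasseDeriv t (r k)).eval (y : ℂ))
    (hc : ∀ l ∈ cubeBox (2 ^ (J + 1)),
      |(b₃ * l.1 - b₁ * l.2.2 : ℝ)| ≤ K ∧ |(b₃ * l.2.1 - b₂ * l.2.2 : ℝ)| ≤ K)
    (hR₁ : ∀ k < D, ∀ t, ∀ z : ℂ, ‖z‖ ≤ 2 ^ (J + 1) * (n + 1) →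
      ‖(hasseDeriv t (r k)).eval z‖ ≤ R₁)
    (hR₂ : ∀ k < D, ∀ t, ∀ z : ℂ, ‖z‖ ≤ E * (2 ^ (J + 1) * n) →
      ‖(hasseDeriv t (r k)).eval z‖ ≤ R₂)
    (hR₁0 : 0 ≤ R₁) (hR₂0 : 0 ≤ R₂) (hE : 2 ≤ E)
    (hp : ∀ k l, |(p k l : ℝ)| ≤ P) (hN₀ : D * (2 ^ (J + 1)) ^ 3 * P ≤ N₀)
    (hδ : 2 ^ (J + 1) * n * |Λ| ≤ 1)
    (hnum : (N₀ * K ^ (τ * 2 ^ J) * R₂ *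
        Real.exp ((logTotal + |Λ|) * (E * (2 ^ (J + 1) * n))) /
        Real.sqrt (E ^ 2 - 1) ^ (n * (τ * 2 ^ J)) +
      3 * (N₀ * K ^ (τ * 2 ^ J) * R₁ * Real.exp (logTotal * (2 ^ (J + 1) * n)) *
        Real.exp ((logTotal + |Λ|) * 2 ^ (J + 1)) * (2 * (2 ^ (J + 1) * n) * |Λ|)) *
        (22 * (E + 1)) ^ (n * (τ * 2 ^ J))) *
      (Real.exp (logTotal * (2 ^ (J + 1) * n)) * (N₀ * K ^ (τ * 2 ^ J) * R₁ *
        Real.exp (logTotal * (2 ^ (J + 1) * n))) ^ 15) < 1) :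
    ∃ p' : ℕ → ℕ × ℕ × ℕ → ℤ, Vanish b₁ b₂ b₃ N D 1 (n * 2 ^ (J + 1)) τ p' ∧
      ∃ k < D, ∃ l ∈ cubeBox 1, p' k l ≠ 0 := by
  have hK1 : 1 ≤ K := le_trans (by exact_mod_cast hv) hvK
  have hP0 : 0 ≤ P := (abs_nonneg _).trans (hp 0 0)
  have hN₀0 : 0 ≤ N₀ := le_trans (by positivity) hN₀
  have hlog := logTotal_nonneg
  have hΛ0 := abs_nonneg Λ
  have main : ∀ I i, I + i = J + 1 → ∃ p' : ℕ → ℕ × ℕ × ℕ → ℤ, (∀ k l, |(p' k l : ℝ)| ≤ P) ∧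
      Vanish b₁ b₂ b₃ N D (2 ^ i) (n * 2 ^ I) (τ * 2 ^ i) p' ∧
      ∃ k < D, ∃ l ∈ cubeBox (2 ^ i), p' k l ≠ 0 := by
    intro I
    induction I with
    | zero =>
      intro i hi
      obtain rfl : i = J + 1 := by omega
      exact ⟨p, hp, by simpa using hV, hne⟩
    | succ I ih =>
      intro i hi
      obtain ⟨p', hp', hV', hne'⟩ := ih (i + 1) (by omega)
      have hq : (2 : ℝ) ^ (i + 1) * 2 ^ I = 2 ^ (J + 1) := by rw [← pow_add]; congr 1; omega
      have hq' : (2 : ℕ) ^ (i + 1) ≤ 2 ^ (J + 1) := Nat.pow_le_pow_right (by norm_num) (by omega)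
      have hq'' : (2 : ℝ) ^ (i + 1) ≤ 2 ^ (J + 1) := by exact_mod_cast hq'
      have hqi : (2 : ℕ) ^ i ≤ 2 ^ J := Nat.pow_le_pow_right (by norm_num) (by omega)
      have hnm : n * 2 ^ I * (τ * 2 ^ i) = n * (τ * 2 ^ J) := by
        have : J = I + i := by omega
        rw [this, pow_add]; ring
      have hG : (2 : ℝ) ^ (i + 1) * (n * 2 ^ I) = 2 ^ (J + 1) * n := by rw [← hq]; ring
      have hV2 : Vanish b₁ b₂ b₃ N D (2 ^ (i + 1)) (n * 2 ^ I) (2 * (τ * 2 ^ i)) p' := by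
        convert hV' using 1; ring
      have hhalf := fun (s y : ℤ) hs hy (t₀ t₁ t₂ : ℕ) (ht : t₀ + t₁ + t₂ < τ * 2 ^ i) ↦
        hV2.half (s := s) (y := y) (t₀ := t₀) hb (by positivity) hv hvK hΛ hN
        (fun l hl ↦ hc l (mem_cubeBox.2 (by have := mem_cubeBox.1 hl; omega)))
        (fun k hk t z hz ↦ hR₁ k hk t z (hz.trans (by
          push_cast
          calc (2 : ℝ) ^ (i + 1) * (n * 2 ^ I + 1) = 2 ^ (J + 1) * n + 2 ^ (i + 1) := by
                rw [mul_add, hG, mul_one]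
            _ ≤ 2 ^ (J + 1) * n + 2 ^ (J + 1) := by linarith
            _ = _ := by ring)))
        (fun k hk t z hz ↦ hR₂ k hk t z (hz.trans_eq (by push_cast; rw [← hG]; ring)))
        hR₁0 hR₂0 hE hp' (N₀ := N₀)
        (le_trans (by push_cast; gcongr) hN₀)
        (by push_cast; calc _ = (2 : ℝ) ^ (i + 1) * (n * 2 ^ I) * |Λ| := by ring
              _ ≤ 1 := by rw [hG]; exact hδ)
        (by
          refine lt_of_le_of_lt ?_ hnum
          push_cast
          have e1 : (logTotal * 2 ^ (i + 1) + 2 ^ (i + 1) * |Λ|) * (E * (n * 2 ^ I)) =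
              (logTotal + |Λ|) * (E * (2 ^ (J + 1) * n)) := by rw [← hG]; ring
          have e2 : logTotal * 2 ^ (i + 1) * (n * 2 ^ I) = logTotal * (2 ^ (J + 1) * n) := by
            rw [← hG]; ring
          have e3 : 2 * (2 ^ (i + 1) * |Λ|) * (n * 2 ^ I) = 2 * (2 ^ (J + 1) * n) * |Λ| := by
            rw [← hG]; ring
          have e4 : logTotal * 2 ^ (i + 1) + 2 ^ (i + 1) * |Λ| = (logTotal + |Λ|) * 2 ^ (i + 1) := by
            ring
          rw [e1, e2, e3, e4, hnm, hG]
          have hKm : K ^ (τ * 2 ^ i) ≤ K ^ (τ * 2 ^ J) :=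
            pow_le_pow_right₀ hK1 (Nat.mul_le_mul_left _ hqi)
          have hex : Real.exp ((logTotal + |Λ|) * 2 ^ (i + 1)) ≤
              Real.exp ((logTotal + |Λ|) * 2 ^ (J + 1)) :=
            Real.exp_le_exp.2 (mul_le_mul_of_nonneg_left hq'' (by positivity))
          gcongr) hs hy ht
      have hne2 : ∃ k < D, ∃ l ∈ cubeBox (2 * 2 ^ i), p' k l ≠ 0 := by rwa [← pow_succ']
      obtain ⟨c₁, c₂, c₃, hV3, hne3⟩ := Vanish.descend (b₁ := b₁) (b₂ := b₂) (b₃ := b₃) (N := N)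
        (n := n * 2 ^ I) (m := τ * 2 ^ i) hne2 (fun s y hs hy t₀ t₁ t₂ ht ↦ by
          have := hhalf s y hs (by rw [hy]; push_cast; ring) t₀ t₁ t₂ ht
          rwa [pow_succ'] at this)
      refine ⟨_, fun k l ↦ hp' k _, ?_, hne3⟩
      convert hV3 using 1; ring
  obtain ⟨p', -, hV', hne'⟩ := main (J + 1) 0 (by omega)
  exact ⟨p', by simpa using hV', by simpa using hne'⟩

lemma Vanish.false_of_linearIndependent (hV : Vanish b₁ b₂ b₃ N D 1 n τ p) (hτ : 0 < τ)
    (hne : ∃ k < D, ∃ l ∈ cubeBox 1, p k l ≠ 0) (hDn : D ≤ n)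
    (hN : ∀ k t y, (N k t y : ℂ) = (v : ℂ) ^ t * (hasseDeriv t (r k)).eval (y : ℂ))
    (hr : LinearIndependent ℂ r) (hdeg : ∀ k, (r k).degree = k) : False := by
  obtain ⟨k₀, hk₀, l, hl, hpl⟩ := hne
  have hl0 : l = (0, 0, 0) := by
    have := mem_cubeBox.1 hl
    ext <;> simp <;> omega
  subst hl0
  have hbox : cubeBox 1 = {(0, 0, 0)} := by simp [cubeBox]
  have hz : ∑ k ∈ range D, (p k (0, 0, 0) : ℂ) • r k = 0 := by
    refine eq_zero_of_degree_lt_of_eval_index_eq_zero (range n)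
      (v := fun j ↦ ((nodeInt n j : ℤ) : ℂ)) ?_ ?_ ?_
    · intro i _ j _ h
      have : nodeInt n i = nodeInt n j := Int.cast_injective (α := ℂ) h
      simp only [nodeInt] at this
      omega
    · rw [card_range]
      refine (degree_sum_le _ _).trans_lt ((Finset.sup_lt_iff (WithBot.bot_lt_coe n)).2 fun k hk ↦ ?_)
      refine (degree_smul_le _ _).trans_lt ?_
      rw [hdeg]
      have := mem_range.1 hk
      exact WithBot.coe_lt_coe.2 (show k < n by omega)
    · intro j hj
      have h := hV j (mem_range.1 hj) 0 0 0 hτ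
      simp only [hbox, sum_singleton, pow_zero, mul_one, logSum, Nat.cast_zero, zero_mul, add_zero,
        Real.exp_zero, Nat.cast_one, one_mul] at h
      have h' : ∑ k ∈ range D, (p k (0, 0, 0) * N k 0 (nodeInt n j) : ℤ) = 0 := by
        exact_mod_cast h
      rw [eval_finsetSum, ← Int.cast_zero, ← h', Int.cast_sum]
      refine sum_congr rfl fun k _ ↦ ?_
      rw [Int.cast_mul, hN]
      simp
  exact hpl (by exact_mod_cast linearIndependent_iff'.1 hr (range D) _ hz k₀ (mem_range.2 hk₀))

end Iterate

end

section

open Polynomial Finset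

lemma logTotal_le_two : logTotal ≤ 2 := by
  have h5 : Real.sqrt 5 ^ 2 = 5 := Real.sq_sqrt (by norm_num)
  have h5' : Real.sqrt 5 ≤ 2.237 := by
    rw [Real.sqrt_le_left (by norm_num)]; norm_num
  have hs : 0 < Real.sqrt 5 := by positivity
  have h : logTotal = Real.log (Real.sqrt 5 + 5) := by
    simp only [logTotal, logSum, Nat.cast_one, one_mul]
    rw [← Real.log_mul Real.goldenRatio_pos.ne' hs.ne', ← Real.log_mul
      (mul_pos Real.goldenRatio_pos hs).ne' two_ne_zero, Real.goldenRatio]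
    congr 1; linear_combination h5
  rw [h, Real.log_le_iff_le_exp (by positivity)]
  have := Real.exp_one_gt_d9
  have e2 : Real.exp 2 = Real.exp 1 * Real.exp 1 := by rw [← Real.exp_add]; norm_num
  rw [e2]; nlinarith

/-- The inequality between the sizes of the auxiliary quantities that drives the descent. -/
lemma descent_inequality {N₀ A R₁ R₂ ℓ δ w q S₁ S₂ : ℝ} (hN₀ : N₀ ≤ Real.exp (147 * w))
    (hA : A ≤ Real.exp (144.2 * w)) (hR₁ : R₁ ≤ Real.exp (170.4 * w))
    (hR₂ : R₂ ≤ Real.exp (194 * w)) (hℓ : ℓ ≤ 2) (hδ : δ < Real.exp (-59000 * w))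
    (hw : 10000 ≤ w) (hqw : q ≤ w) (hS₁ : Real.exp (18300 * w) ≤ S₁)
    (hS₂ : S₂ ≤ Real.exp (36730 * w)) (hN₀0 : 0 ≤ N₀) (hA0 : 0 ≤ A) (hR₁0 : 0 ≤ R₁)
    (hR₂0 : 0 ≤ R₂) (hδ0 : 0 ≤ δ) (hq0 : 0 ≤ q) (hS₂0 : 0 ≤ S₂) :
    (N₀ * A * R₂ * Real.exp ((ℓ + δ) * (25 * (110 * w))) / S₁ +
      3 * (N₀ * A * R₁ * Real.exp (ℓ * (110 * w)) * Real.exp ((ℓ + δ) * q) *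
        (2 * (110 * w) * δ)) * S₂) *
      (Real.exp (ℓ * (110 * w)) * (N₀ * A * R₁ * Real.exp (ℓ * (110 * w))) ^ 15) < 1 := by
  have hδ1 : δ ≤ 0.01 := by
    have h1 := Real.add_one_le_exp (59000 * w)
    have h2 : Real.exp (-59000 * w) = (Real.exp (59000 * w))⁻¹ := by rw [← Real.exp_neg]; ring_nf
    have h3 : (Real.exp (59000 * w))⁻¹ ≤ 0.01 := by
      rw [inv_le_comm₀ (Real.exp_pos _) (by norm_num)]; norm_num; linarith
    linarith
  have hℓw : Real.exp (ℓ * (110 * w)) ≤ Real.exp (220 * w) := Real.exp_le_exp.2 (by nlinarith)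
  have hX : N₀ * A * R₁ * Real.exp (ℓ * (110 * w)) ≤ Real.exp (681.6 * w) := by
    calc _ ≤ Real.exp (147 * w) * Real.exp (144.2 * w) * Real.exp (170.4 * w) *
          Real.exp (220 * w) := by gcongr
      _ = Real.exp (681.6 * w) := by rw [← Real.exp_add, ← Real.exp_add, ← Real.exp_add]; ring_nf
  have hlast : Real.exp (ℓ * (110 * w)) * (N₀ * A * R₁ * Real.exp (ℓ * (110 * w))) ^ 15 ≤
      Real.exp (10444 * w) := by
    calc _ ≤ Real.exp (220 * w) * Real.exp (681.6 * w) ^ 15 := by gcongr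
      _ = Real.exp (10444 * w) := by rw [← Real.exp_nat_mul, ← Real.exp_add]; push_cast; ring_nf
  have hfirst : N₀ * A * R₂ * Real.exp ((ℓ + δ) * (25 * (110 * w))) / S₁ ≤ Real.exp (-12000 * w) := by
    have hS0 : 0 < S₁ := (Real.exp_pos _).trans_le hS₁
    rw [div_le_iff₀ hS0]
    calc _ ≤ Real.exp (147 * w) * Real.exp (144.2 * w) * Real.exp (194 * w) *
          Real.exp (5528 * w) := by
            have : Real.exp ((ℓ + δ) * (25 * (110 * w))) ≤ Real.exp (5528 * w) :=
              Real.exp_le_exp.2 (by nlinarith)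
            gcongr
      _ ≤ Real.exp (-12000 * w) * Real.exp (18300 * w) := by
        rw [← Real.exp_add, ← Real.exp_add, ← Real.exp_add, ← Real.exp_add, Real.exp_le_exp]
        linarith
      _ ≤ _ := by gcongr
  have hwexp : 3 * (2 * (110 * w)) ≤ Real.exp w := by
    have := Real.quadratic_le_exp_of_nonneg (show 0 ≤ w by linarith)
    nlinarith
  have hsecond : 3 * (N₀ * A * R₁ * Real.exp (ℓ * (110 * w)) * Real.exp ((ℓ + δ) * q) *
        (2 * (110 * w) * δ)) * S₂ ≤ Real.exp (-12000 * w) := by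
    calc _ = (N₀ * A * R₁ * Real.exp (ℓ * (110 * w))) * Real.exp ((ℓ + δ) * q) *
          (3 * (2 * (110 * w))) * δ * S₂ := by ring
      _ ≤ Real.exp (681.6 * w) * Real.exp (3 * w) * Real.exp w * Real.exp (-59000 * w) *
          Real.exp (36730 * w) := by
            have : Real.exp ((ℓ + δ) * q) ≤ Real.exp (3 * w) := Real.exp_le_exp.2 (by nlinarith)
            gcongr
      _ ≤ _ := by
        rw [← Real.exp_add, ← Real.exp_add, ← Real.exp_add, ← Real.exp_add, Real.exp_le_exp]
        linarith
  calc _ ≤ (Real.exp (-12000 * w) + Real.exp (-12000 * w)) * Real.exp (10444 * w) := by gcongr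
    _ = 2 * Real.exp (-(1556 * w)) := by
      rw [← two_mul, mul_assoc, ← Real.exp_add]; ring_nf
    _ < 1 := by
      have := Real.add_one_le_exp (1556 * w)
      rw [Real.exp_neg, ← div_eq_mul_inv, div_lt_one (Real.exp_pos _)]; linarith

lemma le_exp_of_nat_pow {x a c : ℝ} {k : ℕ} (hx : x ≤ Real.exp c) (hx0 : 0 ≤ x)
    (hk : k * c ≤ a) : x ^ k ≤ Real.exp a :=
  (pow_le_pow_left₀ hx0 hx k).trans (by rw [← Real.exp_nat_mul]; exact Real.exp_le_exp.2 hk)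

lemma le_exp_of_pow_le_two_pow {x c : ℝ} {k j : ℕ} (hk : k ≠ 0) (hx : x ^ k ≤ 2 ^ j)
    (hc : j * 0.6931471808 ≤ k * c) : x ≤ Real.exp c := by
  refine le_of_pow_le_pow_left₀ hk (Real.exp_pos _).le (hx.trans ?_)
  rw [← Real.exp_nat_mul, ← Real.exp_log (show (0 : ℝ) < 2 ^ j by positivity), Real.log_pow,
    Real.exp_le_exp]
  have := Real.log_two_lt_d9
  refine le_trans ?_ hc
  gcongr

lemma twelve_le_exp : (12 : ℝ) ≤ Real.exp 2.5 :=
  le_exp_of_pow_le_two_pow (k := 5) (j := 18) (by norm_num) (by norm_num) (by norm_num)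

lemma sixteen_le_exp : (16 : ℝ) ≤ Real.exp 2.7727 :=
  le_exp_of_pow_le_two_pow (k := 1) (j := 4) (by norm_num) (by norm_num) (by norm_num)

lemma le_exp_six : (572 : ℝ) ≤ Real.exp 6.42 :=
  le_exp_of_pow_le_two_pow (k := 4) (j := 37) (by norm_num) (by norm_num) (by norm_num)

lemma exp_le_sqrt : Real.exp 3.2 ≤ Real.sqrt (25 ^ 2 - 1) := by
  refine le_of_pow_le_pow_left₀ (n := 8) (by norm_num) (Real.sqrt_nonneg _) ?_
  have h1 : Real.sqrt (25 ^ 2 - 1) ^ 8 = 624 ^ 4 := by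
    rw [show (8 : ℕ) = 2 * 4 by norm_num, pow_mul, Real.sq_sqrt (by norm_num)]; norm_num
  have h2 : Real.exp 3.2 ^ 8 ≤ 2 ^ 37 := by
    rw [← Real.exp_nat_mul, ← Real.exp_log (show (0 : ℝ) < 2 ^ 37 by positivity), Real.log_pow,
      Real.exp_le_exp]
    have := Real.log_two_gt_d9
    norm_num at *
    linarith
  rw [h1]; exact h2.trans (by norm_num)

lemma exp_one_mul_le {x t : ℝ} {k : ℕ} (ht : 0 ≤ t) (hx : x ≤ 2.718 ^ k * (t + 1)) :
    Real.exp 1 * x ≤ Real.exp (k + 1 + t) := by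
  rw [add_right_comm, Real.exp_add, mul_comm]
  refine mul_le_mul_of_nonneg_right (hx.trans ?_) (Real.exp_pos _).le
  rw [Real.exp_add]
  have h1 : (2.718 : ℝ) ^ k ≤ Real.exp k := by
    rw [← mul_one (k : ℝ), Real.exp_nat_mul]
    exact pow_le_pow_left₀ (by norm_num) (by linarith [Real.exp_one_gt_d9]) _
  exact mul_le_mul h1 (Real.add_one_le_exp t) (by linarith) (Real.exp_pos _).le

/-- An explicit lower bound for linear forms in `log φ`, `log √5` and `log 2`. -/
theorem exp_neg_le_abs_linearForm {d : ℕ} (hd : 25 ≤ d) {b₁ b₂ b₃ : ℤ} (hb : b₃ ≠ 0)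
    (h₁ : 2 ^ 26 * |(b₁ : ℝ)| ≤ 16 ^ d) (h₂ : 2 ^ 26 * |(b₂ : ℝ)| ≤ 16 ^ d)
    (h₃ : 2 ^ 26 * |(b₃ : ℝ)| ≤ 16 ^ d) :
    Real.exp (-(2 * 10 ^ 12) * d) ≤
      |b₁ * Real.log Real.goldenRatio + b₂ * Real.log (Real.sqrt 5) + b₃ * Real.log 2| := by
  by_contra! hlt
  obtain ⟨Λ, hΛ⟩ : ∃ Λ, Λ = b₁ * Real.log Real.goldenRatio + b₂ * Real.log (Real.sqrt 5) +
    b₃ * Real.log 2 := ⟨_, rfl⟩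
  rw [← hΛ] at hlt
  have hd0 : 0 < d := by omega
  have hd25 : (25 : ℝ) ≤ d := by exact_mod_cast hd
  have hdR : (0 : ℝ) < d := by linarith
  obtain ⟨L, hL⟩ : ∃ L : ℕ, L = 247500000 := ⟨_, rfl⟩
  obtain ⟨J, hJ⟩ : ∃ J : ℕ, J = 24 := ⟨_, rfl⟩
  have hq : (2 : ℝ) ^ (J + 1) = 33554432 := by rw [hJ]; norm_num
  have hqN : 2 ^ (J + 1) = 33554432 := by rw [hJ]; norm_num
  set v := Nat.lcmUpto d with hv
  set K : ℝ := 16 ^ d with hK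
  have hvK : (v : ℝ) ≤ K := lcmUpto_le_sixteen_pow hd
  have hv1 : 1 ≤ v := Nat.pos_of_ne_zero (Nat.lcmUpto_ne_zero d)
  have hK1 : 1 ≤ K := one_le_pow₀ (by norm_num)
  choose N hN using fun (k t : ℕ) (y : ℤ) ↦ (integralAt_feldman hd0
    (fun j h1 hj ↦ dvd_lcmUpto h1 hj) k y).exists_eval_hasseDeriv t
  set w : ℝ := 33554432 * d with hw
  have hqw : 33554432 ≤ w := by rw [hw]; nlinarith
  have hR₁ : ∀ k < d * L, ∀ t, ∀ z : ℂ, ‖z‖ ≤ 2 ^ (J + 1) * ((110 * d : ℕ) + 1) →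
      ‖(hasseDeriv t (feldman d k)).eval z‖ ≤ Real.exp (170.4 * w) := by
    intro k hk t z hz
    refine (norm_eval_hasseDeriv_feldman_le hd0 hk hz t).trans
      (le_exp_of_nat_pow (c := 23.1) ?_ (by positivity) ?_)
    · refine (exp_one_mul_le (k := 22) (t := 0.1) (by norm_num) ?_).trans_eq (by norm_num)
      rw [div_le_iff₀ hdR]
      push_cast
      rw [hq]
      norm_num
      linarith
    · rw [hw, hL]; push_cast; norm_num; linarith
  have hR₂ : ∀ k < d * L, ∀ t, ∀ z : ℂ, ‖z‖ ≤ 25 * (2 ^ (J + 1) * (110 * d : ℕ)) →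
      ‖(hasseDeriv t (feldman d k)).eval z‖ ≤ Real.exp (194 * w) := by
    intro k hk t z hz
    refine (norm_eval_hasseDeriv_feldman_le hd0 hk hz t).trans
      (le_exp_of_nat_pow (c := 26.3) ?_ (by positivity) ?_)
    · refine (exp_one_mul_le (k := 25) (t := 0.3) (by norm_num) ?_).trans_eq (by norm_num)
      rw [div_le_iff₀ hdR]
      push_cast
      rw [hq]
      norm_num
      linarith
    · rw [hw, hL]; push_cast; norm_num; linarith
  have hc : ∀ l ∈ cubeBox (2 ^ (J + 1)),
      |(b₃ * l.1 - b₁ * l.2.2 : ℝ)| ≤ K ∧ |(b₃ * l.2.1 - b₂ * l.2.2 : ℝ)| ≤ K := by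
    intro l hl
    obtain ⟨l1, l2, l3⟩ := mem_cubeBox.1 hl
    have key : ∀ (b : ℤ) (i : ℕ), 2 ^ 26 * |(b : ℝ)| ≤ 16 ^ d → i < 2 ^ (J + 1) →
        |(b * i : ℝ)| ≤ K / 2 := fun b i hb hi ↦ by
      have : (i : ℝ) ≤ 33554432 := by rw [← hq]; exact_mod_cast hi.le
      rw [abs_mul, Nat.abs_cast]
      nlinarith [abs_nonneg (b : ℝ)]
    have e1 := key b₃ l.1 h₃ l1
    have e2 := key b₃ l.2.1 h₃ l2
    have e3 := key b₁ l.2.2 h₁ l3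
    have e4 := key b₂ l.2.2 h₂ l3
    exact ⟨(abs_sub _ _).trans (by linarith), (abs_sub _ _).trans (by linarith)⟩
  have hNbound : ∀ k < d * L, ∀ t, ∀ y : ℤ, |(y : ℝ)| ≤ (2 ^ (J + 1) : ℕ) * (110 * d : ℕ) →
      |(N k t y : ℝ)| ≤ K ^ t * Real.exp (170.4 * w) := by
    intro k hk t y hy
    have h1 : |(N k t y : ℝ)| = ‖(N k t y : ℂ)‖ := by simp
    have h2 := hR₁ k hk t (y : ℂ) (by
      rw [Complex.norm_intCast]; refine hy.trans ?_; push_cast; linarith)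
    rw [h1, hN, norm_mul, norm_pow, Complex.norm_natCast]
    gcongr
  obtain ⟨p, hp, hne, hV⟩ := exists_vanish (Q := 2 ^ (J + 1)) (n := 110 * d)
    (T := 104 * 2 ^ (J + 1)) hK1 (Real.one_le_exp (by positivity)) (by positivity) (by positivity)
    hNbound hc (by
      calc _ = d * (220 * (104 * 2 ^ (J + 1) * (104 * 2 ^ (J + 1) + 1) *
            (104 * 2 ^ (J + 1) + 2))) := by ring
        _ ≤ d * (L * (2 ^ (J + 1)) ^ 3) := Nat.mul_le_mul_left _ (by rw [hL, hqN]; norm_num)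
        _ = _ := by ring)
  have hsize : ((d * L : ℕ) : ℝ) * (2 ^ (J + 1)) ^ 3 ≤ Real.exp (100 * d) := by
    have e1 : (d : ℝ) ≤ Real.exp d := by linarith [Real.add_one_le_exp (d : ℝ)]
    have e2 : (L : ℝ) * (2 ^ (J + 1)) ^ 3 ≤ Real.exp (99 * d) := by
      calc (L : ℝ) * (2 ^ (J + 1)) ^ 3 ≤ 2.718 ^ 200 := by rw [hL, hq]; norm_num
        _ ≤ Real.exp 1 ^ 200 := by gcongr; linarith [Real.exp_one_gt_d9]
        _ = Real.exp 200 := by rw [← Real.exp_nat_mul]; norm_num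
        _ ≤ _ := Real.exp_le_exp.2 (by linarith)
    calc _ = (d : ℝ) * (L * (2 ^ (J + 1)) ^ 3) := by push_cast; ring
      _ ≤ Real.exp d * Real.exp (99 * d) := by gcongr
      _ = _ := by rw [← Real.exp_add]; ring_nf
  have hP : (((d * L : ℕ) : ℝ) * ((2 ^ (J + 1) : ℕ) : ℝ) ^ 3 * (12 ^ (2 ^ (J + 1) * (110 * d)) *
      K ^ (104 * 2 ^ (J + 1)) * Real.exp (170.4 * w))) ^ ((1 : ℝ) / 5) ≤ Real.exp (146.9 * w) := by
    have e1 : (12 : ℝ) ^ (2 ^ (J + 1) * (110 * d)) ≤ Real.exp (275 * w) :=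
      le_exp_of_nat_pow twelve_le_exp (by norm_num) (by push_cast; rw [hq, hw]; linarith)
    have e2 : K ^ (104 * 2 ^ (J + 1)) ≤ Real.exp (288.4 * w) := by
      rw [hK, ← pow_mul]
      exact le_exp_of_nat_pow sixteen_le_exp (by norm_num) (by push_cast; rw [hq, hw]; linarith)
    calc _ ≤ (Real.exp (100 * d) * (Real.exp (275 * w) * Real.exp (288.4 * w) *
          Real.exp (170.4 * w))) ^ ((1 : ℝ) / 5) := by
            push_cast at hsize ⊢
            gcongr
      _ = Real.exp ((100 * d + (275 * w + 288.4 * w + 170.4 * w)) * ((1 : ℝ) / 5)) := by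
        rw [← Real.exp_add, ← Real.exp_add, ← Real.exp_add, ← Real.exp_mul]
      _ ≤ _ := Real.exp_le_exp.2 (by rw [hw]; linarith)
  have hΛw : |Λ| < Real.exp (-59000 * w) :=
    hlt.trans_le (Real.exp_le_exp.2 (by rw [hw]; linarith))
  have hδ : 2 ^ (J + 1) * ((110 * d : ℕ) : ℝ) * |Λ| ≤ 1 := by
    have e1 : 2 ^ (J + 1) * ((110 * d : ℕ) : ℝ) = 110 * w := by rw [hq, hw]; push_cast; ring
    have e2 := Real.add_one_le_exp (59000 * w)
    have e3 : Real.exp (-59000 * w) * Real.exp (59000 * w) = 1 := by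
      rw [← Real.exp_add]; simp
    rw [e1]
    calc 110 * w * |Λ| ≤ Real.exp (59000 * w) * Real.exp (-59000 * w) := by
          gcongr; linarith
      _ = 1 := by rw [mul_comm, e3]
  have hG : 2 ^ (J + 1) * ((110 * d : ℕ) : ℝ) = 110 * w := by rw [hq, hw]; push_cast; ring
  have hexp : ((110 * d * (104 * 2 ^ J) : ℕ) : ℝ) = 5720 * w := by
    rw [pow_succ] at hq; push_cast; rw [hw]; linear_combination 5720 * (d : ℝ) * hq
  obtain ⟨p', hV', hne'⟩ := hV.iterate (E := 25) (P := Real.exp (146.9 * w))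
    (N₀ := Real.exp (147 * w)) hne hb (by positivity) hv1 hvK hΛ hN hc hR₁ hR₂
    (Real.exp_pos _).le (Real.exp_pos _).le (by norm_num) (fun k l ↦ (hp k l).trans hP)
    (by
      calc _ ≤ Real.exp (100 * d) * Real.exp (146.9 * w) := by gcongr
        _ ≤ _ := by rw [← Real.exp_add, Real.exp_le_exp, hw]; linarith)
    hδ
    (by
      rw [hG, hq]
      refine descent_inequality le_rfl ?_ le_rfl le_rfl logTotal_le_two hΛw (by linarith) hqw
        ?_ ?_ (Real.exp_pos _).le (by positivity) (Real.exp_pos _).le (Real.exp_pos _).le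
        (abs_nonneg _) (by norm_num) (by positivity)
      · rw [hK, ← pow_mul]
        refine le_exp_of_nat_pow sixteen_le_exp (by norm_num) ?_
        rw [pow_succ] at hq; push_cast; rw [hw]; nlinarith
      · refine le_trans ?_ (pow_le_pow_left₀ (Real.exp_pos _).le exp_le_sqrt _)
        rw [← Real.exp_nat_mul, Real.exp_le_exp, hexp]; linarith
      · refine le_exp_of_nat_pow (c := 6.42) ?_ (by norm_num) ?_
        · refine le_trans ?_ le_exp_six; norm_num
        · rw [hexp]; linarith)
  refine hV'.false_of_linearIndependent (by norm_num) hne' ?_ hN (linearIndependent_feldman d)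
    (degree_feldman d)
  calc d * L ≤ d * (110 * 2 ^ (J + 1)) := Nat.mul_le_mul_left _ (by rw [hL, hqN]; norm_num)
    _ = _ := by ring

end

section CubicUnits

variable {α : Fin 3 → ℝ} {A B : ℝ}

lemma vieta_of_roots (hord : α 0 < α 1 ∧ α 1 < α 2)
    (hroot : ∀ i, α i * (α i - A) * (α i - B) - 1 = 0) :
    α 0 + α 1 + α 2 = A + B ∧ α 0 * α 1 + α 0 * α 2 + α 1 * α 2 = A * B ∧
      α 0 * α 1 * α 2 = 1 := by
  obtain ⟨h01, h12⟩ := hord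
  have r0 := hroot 0
  have r1 := hroot 1
  have r2 := hroot 2
  have q01 : α 0 ^ 2 + α 0 * α 1 + α 1 ^ 2 - (A + B) * (α 0 + α 1) + A * B = 0 :=
    (mul_eq_zero.1 (by linear_combination r0 - r1 :
      (α 0 - α 1) * (α 0 ^ 2 + α 0 * α 1 + α 1 ^ 2 - (A + B) * (α 0 + α 1) + A * B) = 0)).resolve_left
      (by linarith)
  have q12 : α 1 ^ 2 + α 1 * α 2 + α 2 ^ 2 - (A + B) * (α 1 + α 2) + A * B = 0 :=
    (mul_eq_zero.1 (by linear_combination r1 - r2 :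
      (α 1 - α 2) * (α 1 ^ 2 + α 1 * α 2 + α 2 ^ 2 - (A + B) * (α 1 + α 2) + A * B) = 0)).resolve_left
      (by linarith)
  have e1 : α 0 + α 1 + α 2 - (A + B) = 0 :=
    (mul_eq_zero.1 (by linear_combination q01 - q12 :
      (α 0 - α 2) * (α 0 + α 1 + α 2 - (A + B)) = 0)).resolve_left (by linarith)
  have e2 : α 0 * α 1 + α 0 * α 2 + α 1 * α 2 = A * B := by
    linear_combination -q01 + (α 0 + α 1) * e1
  refine ⟨by linarith, e2, ?_⟩
  linear_combination r0 - α 0 ^ 2 * e1 + α 0 * e2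

lemma roots_localized (hA : 4 ≤ A) (hAB : 2 * A ≤ B) (hord : α 0 < α 1 ∧ α 1 < α 2)
    (hroot : ∀ i, α i * (α i - A) * (α i - B) - 1 = 0) :
    (0 < α 0 ∧ α 0 < 1) ∧ (A - 1 < α 1 ∧ α 1 < A) ∧ (B < α 2 ∧ α 2 < B + 1) := by
  have loc : ∀ i, (0 < α i ∧ α i < 1) ∨ (A - 1 < α i ∧ α i < A) ∨ (B < α i ∧ α i < B + 1) := by
    intro i
    have h := hroot i
    set t := α i
    have ht : 0 < t := by
      by_contra! ht
      nlinarith [mul_nonneg (mul_nonneg (neg_nonneg.2 ht) (by linarith : 0 ≤ A - t))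
        (by linarith : 0 ≤ B - t)]
    rcases lt_or_ge t 1 with h1 | h1
    · exact .inl ⟨ht, h1⟩
    rcases lt_or_ge t A with h2 | h2
    · refine .inr (.inl ⟨?_, h2⟩)
      by_contra! h3
      have e1 : 1 ≤ A - t := by linarith
      have e2 : 4 ≤ B - t := by linarith
      have e3 : 1 ≤ t * (A - t) := by nlinarith
      nlinarith
    · have h3 : B < t := by
        by_contra! h3
        nlinarith [mul_nonneg (mul_nonneg ht.le (by linarith : 0 ≤ t - A))
          (by linarith : 0 ≤ B - t)]
      refine .inr (.inr ⟨h3, ?_⟩)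
      by_contra! h4
      have e3 : 4 ≤ t * (t - A) := by nlinarith
      nlinarith
  obtain ⟨e1, -, -⟩ := vieta_of_roots hord hroot
  obtain ⟨h01, h12⟩ := hord
  rcases loc 0 with a | a | a <;> rcases loc 1 with b | b | b <;> rcases loc 2 with c | c | c <;>
    first
    | exact ⟨a, b, c⟩
    | (exfalso; linarith [a.1, a.2, b.1, b.2, c.1, c.2])

lemma prod_sub_mul (hord : α 0 < α 1 ∧ α 1 < α 2)
    (hroot : ∀ i, α i * (α i - A) * (α i - B) - 1 = 0) (x y : ℝ) :
    (x - α 0 * y) * (x - α 1 * y) * (x - α 2 * y) = x * (x - A * y) * (x - B * y) - y ^ 3 := by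
  obtain ⟨e1, e2, e3⟩ := vieta_of_roots hord hroot
  linear_combination -x ^ 2 * y * e1 + x * y ^ 2 * e2 - y ^ 3 * e3

/-- Families of values at the conjugates `α i` of an integral quadratic polynomial. -/
def IsOrderElement (α g : Fin 3 → ℝ) : Prop :=
  ∃ u v w : ℤ, ∀ i, g i = u + v * α i + w * α i ^ 2

lemma IsOrderElement.mul {a b : ℤ} (hroot : ∀ i, α i * (α i - a) * (α i - b) - 1 = 0)
    {g h : Fin 3 → ℝ} (hg : IsOrderElement α g) (hh : IsOrderElement α h) :
    IsOrderElement α (fun i ↦ g i * h i) := by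
  obtain ⟨u, v, w, hg⟩ := hg
  obtain ⟨u', v', w', hh⟩ := hh
  refine ⟨u * u' + (v * w' + w * v') + w * w' * (a + b),
    u * v' + v * u' - (v * w' + w * v') * (a * b) + w * w' * (1 - (a + b) * (a * b)),
    u * w' + v * v' + w * u' + (v * w' + w * v') * (a + b) + w * w' * ((a + b) ^ 2 - a * b),
    fun i ↦ ?_⟩
  beta_reduce
  rw [hg, hh]
  push_cast
  linear_combination ((v * w' + w * v' : ℝ) + w * w' * (α i + (a + b))) * hroot i

lemma IsOrderElement.pow {a b : ℤ} (hroot : ∀ i, α i * (α i - a) * (α i - b) - 1 = 0)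
    {g : Fin 3 → ℝ} (hg : IsOrderElement α g) (k : ℕ) : IsOrderElement α (fun i ↦ g i ^ k) := by
  induction k with
  | zero => exact ⟨1, 0, 0, fun i ↦ by simp⟩
  | succ k ih => simpa only [pow_succ] using ih.mul hroot hg

lemma IsOrderElement.zpow {a b : ℤ} (hroot : ∀ i, α i * (α i - a) * (α i - b) - 1 = 0)
    {g : Fin 3 → ℝ} (hg : IsOrderElement α g) (hg' : IsOrderElement α (fun i ↦ (g i)⁻¹)) (k : ℤ) :
    IsOrderElement α (fun i ↦ g i ^ k) := by
  obtain ⟨m, rfl | rfl⟩ := k.eq_nat_or_neg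
  · simpa using hg.pow hroot m
  · simpa using hg'.pow hroot m

lemma coeff_eq_zero_of_roots (h01 : α 0 ≠ α 1) (h02 : α 0 ≠ α 2) (h12 : α 1 ≠ α 2) {u v w : ℝ}
    (h : ∀ i, u + v * α i + w * α i ^ 2 = 0) : u = 0 ∧ v = 0 ∧ w = 0 := by
  have h0 := h 0
  have h1 := h 1
  have h2 := h 2
  have a1 : v + w * (α 0 + α 1) = 0 := (mul_eq_zero.1 (by linear_combination h0 - h1 :
    (α 0 - α 1) * (v + w * (α 0 + α 1)) = 0)).resolve_left (sub_ne_zero.2 h01)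
  have a2 : v + w * (α 0 + α 2) = 0 := (mul_eq_zero.1 (by linear_combination h0 - h2 :
    (α 0 - α 2) * (v + w * (α 0 + α 2)) = 0)).resolve_left (sub_ne_zero.2 h02)
  have hw : w = 0 := (mul_eq_zero.1 (by linear_combination a1 - a2 :
    (α 1 - α 2) * w = 0)).resolve_left (sub_ne_zero.2 h12)
  subst hw
  have hv : v = 0 := by linear_combination a1
  subst hv
  exact ⟨by linear_combination h0, rfl, rfl⟩

lemma IsOrderElement.exists_linear {g : Fin 3 → ℝ} (hg : IsOrderElement α g)
    (hord : α 0 < α 1 ∧ α 1 < α 2) {c : Fin 3 → ℝ} (hc : ∀ i, |g i| ≤ c i)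
    (hsum : c 0 / ((α 1 - α 0) * (α 2 - α 0)) + c 1 / ((α 1 - α 0) * (α 2 - α 1)) +
      c 2 / ((α 2 - α 0) * (α 2 - α 1)) < 1) : ∃ u v : ℤ, ∀ i, g i = u + v * α i := by
  obtain ⟨u, v, w, h⟩ := hg
  obtain ⟨h01, h12⟩ := hord
  have p01 : 0 < α 1 - α 0 := by linarith
  have p02 : 0 < α 2 - α 0 := by linarith
  have p12 : 0 < α 2 - α 1 := by linarith
  have hw : (w : ℝ) = g 0 / ((α 1 - α 0) * (α 2 - α 0)) - g 1 / ((α 1 - α 0) * (α 2 - α 1)) +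
      g 2 / ((α 2 - α 0) * (α 2 - α 1)) := by
    rw [h 0, h 1, h 2]; field_simp; ring
  have hw1 : |(w : ℝ)| < 1 := by
    refine lt_of_le_of_lt ?_ hsum
    rw [hw]
    refine (abs_add_le _ _).trans (add_le_add ((abs_sub _ _).trans (add_le_add ?_ ?_)) ?_)
    all_goals
      rw [abs_div, abs_of_pos (a := _ * _) (by positivity)]
      gcongr
      exact hc _
  have hw0 : w = 0 := by
    have : |w| < 1 := by exact_mod_cast hw1
    exact Int.abs_lt_one_iff.1 this
  exact ⟨u, v, fun i ↦ by rw [h, hw0]; simp⟩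

/-- Units of the order all of whose conjugates are small are trivial. -/
lemma IsOrderElement.eq_one_or_neg_one {g : Fin 3 → ℝ} (hg : IsOrderElement α g)
    (hg' : IsOrderElement α (fun i ↦ (g i)⁻¹)) (hg0 : ∀ i, g i ≠ 0)
    (hord : α 0 < α 1 ∧ α 1 < α 2) {c : Fin 3 → ℝ} (hc : ∀ i, |g i| ≤ c i)
    (hc' : ∀ i, |(g i)⁻¹| ≤ c i)
    (hsum : c 0 / ((α 1 - α 0) * (α 2 - α 0)) + c 1 / ((α 1 - α 0) * (α 2 - α 1)) +
      c 2 / ((α 2 - α 0) * (α 2 - α 1)) < 1) : (∀ i, g i = 1) ∨ ∀ i, g i = -1 := by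
  obtain ⟨u, v, h⟩ := hg.exists_linear hord hc hsum
  obtain ⟨u', v', h'⟩ := hg'.exists_linear hord hc' hsum
  obtain ⟨h1, h2, h3⟩ := coeff_eq_zero_of_roots (u := u * u' - 1) (v := u * v' + v * u')
    (w := v * v') hord.1.ne (hord.1.trans hord.2).ne hord.2.ne (fun i ↦ by
      have : g i * (g i)⁻¹ = 1 := mul_inv_cancel₀ (hg0 i)
      rw [h', h] at this
      linear_combination this)
  have h1' : u * u' = 1 := by exact_mod_cast sub_eq_zero.1 h1
  have h2' : u * v' + v * u' = 0 := by exact_mod_cast h2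
  have h3' : v * v' = 0 := by exact_mod_cast h3
  have hu := Int.eq_one_or_neg_one_of_mul_eq_one h1'
  have hu' : u' ≠ 0 := by rintro rfl; simp at h1'
  have hv : v = 0 := by
    rcases mul_eq_zero.1 h3' with hv | hv
    · exact hv
    · subst hv
      exact (mul_eq_zero.1 (by simpa using h2' : v * u' = 0)).resolve_right hu'
  subst hv
  rcases hu with rfl | rfl
  · exact .inl fun i ↦ by rw [h]; simp
  · exact .inr fun i ↦ by rw [h]; simp

end CubicUnits

section UnitDecomposition

variable {α : Fin 3 → ℝ}

lemma abs_log_sub_log_le {u v m : ℝ} (hm : 0 < m) (hu : m ≤ u) (hv : m ≤ v) :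
    |Real.log u - Real.log v| ≤ |u - v| / m := by
  have key : ∀ {s t : ℝ}, m ≤ s → m ≤ t → Real.log s - Real.log t ≤ |s - t| / m := by
    intro s t hs ht
    have hs0 : 0 < s := hm.trans_le hs
    have ht0 : 0 < t := hm.trans_le ht
    rw [← Real.log_div hs0.ne' ht0.ne']
    calc Real.log (s / t) ≤ s / t - 1 := Real.log_le_sub_one_of_pos (by positivity)
      _ = (s - t) / t := by field_simp
      _ ≤ |s - t| / t := by gcongr; exact le_abs_self _
      _ ≤ |s - t| / m := by gcongr
  rw [abs_le]
  constructor
  · have := key hv hu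
    rw [abs_sub_comm] at this
    linarith
  · exact key hu hv

/-- Cramer's rule followed by rounding: every vector with zero coordinate sum is, up to half the
sum of the two generators, an integral combination of the generators. -/
lemma exists_int_combination {a e l : Fin 3 → ℝ} (ha : a 0 + a 1 + a 2 = 0)
    (he : e 0 + e 1 + e 2 = 0) (hl : l 0 + l 1 + l 2 = 0) (hdet : a 1 * e 2 - a 2 * e 1 ≠ 0) :
    ∃ p q : ℤ, ∀ i, |l i - (p * a i + q * e i)| ≤ (|a i| + |e i|) / 2 := by
  set D := a 1 * e 2 - a 2 * e 1 with hD
  set s := (l 1 * e 2 - l 2 * e 1) / D with hs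
  set t := (a 1 * l 2 - a 2 * l 1) / D with ht
  have e1 : l 1 = s * a 1 + t * e 1 := by
    rw [hs, ht]; field_simp; rw [hD]; ring
  have e2 : l 2 = s * a 2 + t * e 2 := by
    rw [hs, ht]; field_simp; rw [hD]; ring
  have h : ∀ i, l i = s * a i + t * e i := by
    intro i
    fin_cases i
    · change l 0 = s * a 0 + t * e 0
      linear_combination hl - e1 - e2 - s * ha - t * he
    · exact e1
    · exact e2
  refine ⟨round s, round t, fun i ↦ ?_⟩
  rw [h i, show s * a i + t * e i - (round s * a i + round t * e i) =
    (s - round s) * a i + (t - round t) * e i by ring]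
  refine (abs_add_le _ _).trans ?_
  rw [abs_mul, abs_mul]
  nlinarith [abs_sub_round s, abs_sub_round t, abs_nonneg (a i), abs_nonneg (e i)]

lemma IsOrderElement.root {a b : ℤ} (hroot : ∀ i, α i * (α i - a) * (α i - b) - 1 = 0) :
    IsOrderElement α α ∧ IsOrderElement α (fun i ↦ (α i)⁻¹) ∧
      IsOrderElement α (fun i ↦ α i - a) ∧ IsOrderElement α (fun i ↦ (α i - a)⁻¹) := by
  refine ⟨⟨0, 1, 0, fun i ↦ by simp⟩, ⟨a * b, -(a + b), 1, fun i ↦ ?_⟩,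
    ⟨-a, 1, 0, fun i ↦ by push_cast; ring⟩, ⟨0, -b, 1, fun i ↦ ?_⟩⟩
  · refine inv_eq_of_mul_eq_one_right ?_
    push_cast
    linear_combination hroot i
  · refine inv_eq_of_mul_eq_one_right ?_
    push_cast
    linear_combination hroot i

lemma IsOrderElement.linear {a b : ℤ} (hroot : ∀ i, α i * (α i - a) * (α i - b) - 1 = 0)
    {x y : ℤ} (h : x * (x - a * y) * (x - b * y) - y ^ 3 = 1 ∨
      x * (x - a * y) * (x - b * y) - y ^ 3 = -1) :
    IsOrderElement α (fun i ↦ x - α i * y) ∧ IsOrderElement α (fun i ↦ (x - α i * y)⁻¹) := by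
  refine ⟨⟨x, -y, 0, fun i ↦ by push_cast; ring⟩, ?_⟩
  rcases h with h | h
  · refine ⟨x ^ 2 - (a + b) * x * y + a * b * y ^ 2, x * y - (a + b) * y ^ 2, y ^ 2, fun i ↦ ?_⟩
    refine inv_eq_of_mul_eq_one_right ?_
    have h' : (x * (x - a * y) * (x - b * y) - y ^ 3 : ℝ) = 1 := by exact_mod_cast h
    push_cast
    linear_combination h' - y ^ 3 * hroot i
  · refine ⟨-(x ^ 2 - (a + b) * x * y + a * b * y ^ 2), -(x * y - (a + b) * y ^ 2), -y ^ 2,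
      fun i ↦ ?_⟩
    refine inv_eq_of_mul_eq_one_right ?_
    have h' : (x * (x - a * y) * (x - b * y) - y ^ 3 : ℝ) = -1 := by exact_mod_cast h
    push_cast
    linear_combination -h' + y ^ 3 * hroot i

lemma log_abs_root {a b : ℝ} (ha : 4 ≤ a) (hab : 2 * a ≤ b) (hord : α 0 < α 1 ∧ α 1 < α 2)
    (hroot : ∀ i, α i * (α i - a) * (α i - b) - 1 = 0) :
    Real.log |α 0| = -(Real.log (a - α 0) + Real.log (b - α 0)) ∧
      Real.log |α 1 - a| = -(Real.log (α 1) + Real.log (b - α 1)) := by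
  obtain ⟨⟨h00, h01⟩, ⟨h10, h11⟩, -⟩ := roots_localized ha hab hord hroot
  constructor
  · rw [← Real.log_mul (by linarith) (by linarith), ← Real.log_inv, abs_of_pos h00]
    congr 1
    exact eq_inv_of_mul_eq_one_left (by linear_combination hroot 0)
  · rw [← Real.log_mul (by linarith) (by linarith), ← Real.log_inv, abs_of_neg (by linarith)]
    congr 1
    exact eq_inv_of_mul_eq_one_left (by linear_combination hroot 1)

lemma sum_div_lt_one {a b : ℝ} (ha : 100 ≤ a) (hab : 8 * a ≤ b) (d01 : a / 2 ≤ α 1 - α 0)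
    (d02 : b / 2 ≤ α 2 - α 0) (d12 : b / 2 ≤ α 2 - α 1) :
    a * √b / ((α 1 - α 0) * (α 2 - α 0)) + a * √b / ((α 1 - α 0) * (α 2 - α 1)) +
      (b + 1) / ((α 2 - α 0) * (α 2 - α 1)) < 1 := by
  have ha0 : 0 < a := by linarith
  have hb0 : 0 < b := by linarith
  have hsb : √b * √b = b := Real.mul_self_sqrt hb0.le
  have hsb1 : 28 ≤ √b := Real.le_sqrt_of_sq_le (by linarith)
  have t1 : a * √b / ((α 1 - α 0) * (α 2 - α 0)) ≤ a * √b / (a / 2 * (b / 2)) := by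
    gcongr
    linarith
  have t2 : a * √b / ((α 1 - α 0) * (α 2 - α 1)) ≤ a * √b / (a / 2 * (b / 2)) := by
    gcongr
    linarith
  have t3 : (b + 1) / ((α 2 - α 0) * (α 2 - α 1)) ≤ (b + 1) / (b / 2 * (b / 2)) := by
    gcongr
    linarith
  have u1 : a * √b / (a / 2 * (b / 2)) ≤ 1 / 7 := by
    rw [div_le_div_iff₀ (by positivity) (by norm_num)]
    calc a * √b * 7 = a / 4 * (28 * √b) := by ring
      _ ≤ a / 4 * (√b * √b) := by gcongr
      _ = 1 * (a / 2 * (b / 2)) := by rw [hsb]; ring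
  have u3 : (b + 1) / (b / 2 * (b / 2)) ≤ 1 / 7 := by
    rw [div_le_div_iff₀ (by positivity) (by norm_num)]
    nlinarith
  linarith

/-- The roots `α i` and their translates `α i - a` generate, up to sign, the units of the order. -/
lemma IsOrderElement.exists_eq_zpow_mul_zpow {a b : ℤ} (ha : 100 ≤ (a : ℝ))
    (hab : 8 * (a : ℝ) ≤ b) (hord : α 0 < α 1 ∧ α 1 < α 2)
    (hroot : ∀ i, α i * (α i - a) * (α i - b) - 1 = 0) {g : Fin 3 → ℝ}
    (hg : IsOrderElement α g) (hg' : IsOrderElement α (fun i ↦ (g i)⁻¹))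
    (hnorm : |g 0 * g 1 * g 2| = 1) :
    ∃ p q : ℤ, (∀ i, g i = α i ^ p * (α i - a) ^ q) ∨ ∀ i, g i = -(α i ^ p * (α i - a) ^ q) := by
  obtain ⟨⟨h00, h01⟩, ⟨h10, h11⟩, ⟨h20, h21⟩⟩ :=
    roots_localized (by linarith) (by linarith) hord hroot
  obtain ⟨-, -, hprod⟩ := vieta_of_roots hord hroot
  obtain ⟨o1, o2, o3, o4⟩ := IsOrderElement.root hroot
  have hα0 : ∀ i, α i ≠ 0 := fun i h ↦ by simpa [h] using hroot i
  have hη0 : ∀ i, α i - a ≠ 0 := fun i h ↦ by simpa [h] using hroot i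
  have hg0 : g 0 ≠ 0 := fun h ↦ by simp [h] at hnorm
  have hg1 : g 1 ≠ 0 := fun h ↦ by simp [h] at hnorm
  have hg2 : g 2 ≠ 0 := fun h ↦ by simp [h] at hnorm
  have hgi : ∀ i, g i ≠ 0 := fun i ↦ by fin_cases i <;> assumption
  have hη : (α 0 - a) * (α 1 - a) * (α 2 - a) = 1 := by
    have := prod_sub_mul hord hroot a 1
    norm_num at this
    linear_combination -this
  obtain ⟨la0, le1⟩ := log_abs_root (by linarith) (by linarith) hord hroot
  have le0 : Real.log |α 0 - a| = Real.log (a - α 0) := by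
    rw [abs_sub_comm, abs_of_pos (by linarith)]
  have la1 : Real.log |α 1| = Real.log (α 1) := by rw [abs_of_pos (by linarith)]
  have la2 : Real.log |α 2| = Real.log (α 2) := by rw [abs_of_pos (by linarith)]
  have le2 : Real.log |α 2 - a| = Real.log (α 2 - a) := by rw [abs_of_pos (by linarith)]
  have pos : ∀ {t : ℝ}, 1 < t → 0 < Real.log t := fun h ↦ Real.log_pos h
  have mono : ∀ {s t : ℝ}, 1 < s → s ≤ t → Real.log s ≤ Real.log t :=
    fun h h' ↦ Real.log_le_log (by linarith) h'
  have p1 := pos (show 1 < a - α 0 by linarith)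
  have p2 := pos (show 1 < b - α 0 by linarith)
  have p3 := pos (show 1 < α 1 by linarith)
  have p4 := pos (show 1 < b - α 1 by linarith)
  have p5 := pos (show 1 < α 2 by linarith)
  have p6 := pos (show 1 < α 2 - a by linarith)
  have m1 := mono (show 1 < a - α 0 by linarith) (show a - α 0 ≤ a by linarith)
  have m2 := mono (show 1 < b - α 0 by linarith) (show b - α 0 ≤ b by linarith)
  have m3 := mono (show 1 < α 1 by linarith) h11.le
  have m4 := mono (show 1 < b - α 1 by linarith) (show b - α 1 ≤ b by linarith)
  have m5 := mono (show 1 < α 2 by linarith) h21.le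
  have m6 := mono (show 1 < α 2 - a by linarith) (show α 2 - a ≤ b + 1 by linarith)
  have sum_log : ∀ f : Fin 3 → ℝ, |f 0 * f 1 * f 2| = 1 →
      Real.log |f 0| + Real.log |f 1| + Real.log |f 2| = 0 := by
    intro f hf
    have n0 : f 0 ≠ 0 := fun h ↦ by simp [h] at hf
    have n1 : f 1 ≠ 0 := fun h ↦ by simp [h] at hf
    have n2 : f 2 ≠ 0 := fun h ↦ by simp [h] at hf
    rw [← Real.log_mul (by positivity) (by positivity),
      ← Real.log_mul (by positivity) (by positivity), ← abs_mul, ← abs_mul, hf, Real.log_one]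
  obtain ⟨p, q, hpq⟩ := exists_int_combination (a := fun i ↦ Real.log |α i|)
    (e := fun i ↦ Real.log |α i - a|) (l := fun i ↦ Real.log |g i|)
    (sum_log α (by rw [hprod, abs_one])) (sum_log (fun i ↦ α i - a) (by rw [hη, abs_one]))
    (sum_log g hnorm) (by
      rw [la1, la2, le1, le2]
      refine ne_of_gt ?_
      nlinarith [mul_pos p3 p6, mul_pos p5 p3, mul_pos p5 p4])
  set γ : Fin 3 → ℝ := fun i ↦ g i * (α i ^ (-p) * (α i - a) ^ (-q)) with hγ
  have hγ0 : ∀ i, γ i ≠ 0 := fun i ↦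
    mul_ne_zero (hgi i) (mul_ne_zero (zpow_ne_zero _ (hα0 i)) (zpow_ne_zero _ (hη0 i)))
  have oγ : IsOrderElement α γ :=
    hg.mul hroot ((o1.zpow hroot o2 (-p)).mul hroot (o3.zpow hroot o4 (-q)))
  have oγ' : IsOrderElement α (fun i ↦ (γ i)⁻¹) := by
    have := hg'.mul hroot ((o1.zpow hroot o2 p).mul hroot (o3.zpow hroot o4 q))
    convert this using 2 with i
    rw [hγ]
    simp
    ring
  have hlogγ : ∀ i, Real.log |γ i| =
      Real.log |g i| - (p * Real.log |α i| + q * Real.log |α i - a|) := by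
    intro i
    rw [hγ]
    simp only [abs_mul, abs_zpow]
    rw [Real.log_mul (by simpa using hgi i), Real.log_mul, Real.log_zpow, Real.log_zpow]
    · push_cast; ring
    · exact zpow_ne_zero _ (by simpa using hα0 i)
    · exact zpow_ne_zero _ (by simpa using hη0 i)
    · exact mul_ne_zero (zpow_ne_zero _ (by simpa using hα0 i))
        (zpow_ne_zero _ (by simpa using hη0 i))
  have ha0 : (0 : ℝ) < a := by linarith
  have hb0 : (0 : ℝ) < b := by linarith
  have hbound : ∀ i, |(Real.log |γ i|)| ≤ Real.log (![a * √b, a * √b, b + 1] i : ℝ) := by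
    intro i
    rw [hlogγ]
    refine (hpq i).trans ?_
    have hsq : Real.log (a * √b) = Real.log a + Real.log b / 2 := by
      rw [Real.log_mul ha0.ne' (by positivity), Real.log_sqrt hb0.le]
    fin_cases i
    · simp only [Fin.zero_eta, Matrix.cons_val_zero]
      rw [la0, le0, abs_neg, abs_of_pos p1, abs_of_pos (add_pos p1 p2), hsq]
      linarith
    · simp only [Fin.mk_one, Matrix.cons_val_one, Matrix.cons_val_zero]
      rw [la1, le1, abs_neg, abs_of_pos p3, abs_of_pos (add_pos p3 p4), hsq]
      linarith
    · simp only [Fin.reduceFinMk, Matrix.cons_val]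
      rw [la2, le2, abs_of_pos p5, abs_of_pos p6]
      linarith
  have hcpos : ∀ i, 0 < (![a * √b, a * √b, b + 1] i : ℝ) := by
    intro i
    fin_cases i <;> simp <;> positivity
  have hc : ∀ i, |γ i| ≤ (![a * √b, a * √b, b + 1] i : ℝ) := fun i ↦
    (Real.log_le_log_iff (abs_pos.2 (hγ0 i)) (hcpos i)).1 ((le_abs_self _).trans (hbound i))
  have hc' : ∀ i, |(γ i)⁻¹| ≤ (![a * √b, a * √b, b + 1] i : ℝ) := fun i ↦ by
    refine (Real.log_le_log_iff (abs_pos.2 (inv_ne_zero (hγ0 i))) (hcpos i)).1 ?_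
    rw [abs_inv, Real.log_inv]
    exact (neg_le_abs _).trans (hbound i)
  have hcase := oγ.eq_one_or_neg_one oγ' hγ0 hord hc hc'
    (sum_div_lt_one ha hab (by linarith) (by linarith) (by linarith))
  have hinv : ∀ i, g i = γ i * (α i ^ p * (α i - a) ^ q) := by
    intro i
    rw [hγ]
    have := zpow_ne_zero p (hα0 i)
    have := zpow_ne_zero q (hη0 i)
    simp only [zpow_neg]
    field_simp
  refine ⟨p, q, ?_⟩
  rcases hcase with h | h
  · exact .inl fun i ↦ by rw [hinv, h, one_mul]
  · exact .inr fun i ↦ by rw [hinv, h, neg_one_mul]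

end UnitDecomposition

section Reduction

/-- Elimination of `Y` from the approximate logarithms of two conjugates of a unit. -/
lemma abs_linearForm_le {LA LB Y ε a₁ e₁ a₂ e₂ l₁ l₂ p q : ℝ} (hLA : 4 ≤ LA) (hLAB : LA ≤ LB)
    (hLBA : LB ≤ 2 * LA) (hY : 2 * LA - 2 ≤ Y) (hε : ε ≤ 1) (ha₁ : |a₁ - LA| ≤ ε)
    (he₁ : |e₁ + (LA + LB)| ≤ ε) (ha₂ : |a₂ - LB| ≤ ε) (he₂ : |e₂ - LB| ≤ ε)
    (hl₁ : |l₁ - (Y + LA)| ≤ ε) (hl₂ : |l₂ - (Y + LB)| ≤ ε) (h₁ : l₁ = p * a₁ + q * e₁)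
    (h₂ : l₂ = p * a₂ + q * e₂) :
    |p| ≤ 5 * Y ∧ |q| ≤ 5 * Y ∧
      |(p - 1 - q) * LA - (p - 1 + 2 * q) * LB| ≤ 22 * Y * ε := by
  have hε0 : 0 ≤ ε := (abs_nonneg _).trans ha₁
  rw [abs_le] at ha₁ he₁ ha₂ he₂ hl₁ hl₂
  have hl₁0 : 0 ≤ l₁ := by linarith
  have hl₂0 : 0 ≤ l₂ := by linarith
  have a1 : 3 ≤ a₁ := by linarith
  have a2 : 3 ≤ a₂ := by linarith
  have e1 : 7 ≤ -e₁ := by linarith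
  have e2 : 3 ≤ e₂ := by linarith
  have hD : a₂ * (-e₁) ≤ a₁ * e₂ - a₂ * e₁ := by nlinarith
  have hDpos : 0 < a₁ * e₂ - a₂ * e₁ := lt_of_lt_of_le (by positivity) hD
  have hsum : l₁ + l₂ ≤ 5 * Y := by linarith
  have hpD : p * (a₁ * e₂ - a₂ * e₁) = l₁ * e₂ + l₂ * (-e₁) := by rw [h₁, h₂]; ring
  have hqD : q * (a₁ * e₂ - a₂ * e₁) = a₁ * l₂ - a₂ * l₁ := by rw [h₁, h₂]; ring
  have hp : |p| ≤ l₁ + l₂ := by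
    refine le_of_mul_le_mul_right ?_ hDpos
    rw [← abs_of_pos hDpos, ← abs_mul, abs_of_pos hDpos, hpD]
    have u1 : e₂ ≤ a₂ * (-e₁) := by nlinarith
    have u2 : -e₁ ≤ a₂ * (-e₁) := by nlinarith
    have hpos : 0 ≤ l₁ * e₂ + l₂ * (-e₁) := by
      have := mul_nonneg hl₁0 (by linarith : 0 ≤ e₂)
      have := mul_nonneg hl₂0 (by linarith : 0 ≤ -e₁)
      linarith
    rw [abs_of_nonneg hpos]
    calc l₁ * e₂ + l₂ * (-e₁) ≤ l₁ * (a₂ * (-e₁)) + l₂ * (a₂ * (-e₁)) := by gcongr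
      _ = (l₁ + l₂) * (a₂ * (-e₁)) := by ring
      _ ≤ _ := by gcongr
  have hq : |q| ≤ l₁ + l₂ := by
    refine le_of_mul_le_mul_right ?_ hDpos
    rw [← abs_of_pos hDpos, ← abs_mul, abs_of_pos hDpos, hqD]
    have u1 : a₁ ≤ a₂ * (-e₁) := by nlinarith
    have u2 : a₂ ≤ a₂ * (-e₁) := by nlinarith
    calc |a₁ * l₂ - a₂ * l₁| ≤ a₁ * l₂ + a₂ * l₁ := by
          rw [abs_le]
          constructor <;>
          linarith [mul_nonneg (by linarith : 0 ≤ a₁) hl₂0, mul_nonneg (by linarith : 0 ≤ a₂) hl₁0]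
      _ ≤ (a₂ * (-e₁)) * l₂ + (a₂ * (-e₁)) * l₁ := by gcongr
      _ = (l₁ + l₂) * (a₂ * (-e₁)) := by ring
      _ ≤ _ := by gcongr
  refine ⟨hp.trans hsum, hq.trans hsum, ?_⟩
  have key : (p - 1 - q) * LA - (p - 1 + 2 * q) * LB =
      p * ((a₂ - LB) - (a₁ - LA)) + q * ((e₂ - LB) - (e₁ + (LA + LB))) -
        ((l₂ - (Y + LB)) - (l₁ - (Y + LA))) := by
    rw [h₁, h₂]; ring
  have bd : ∀ {s t : ℝ}, (-ε ≤ s ∧ s ≤ ε) → (-ε ≤ t ∧ t ≤ ε) → |s - t| ≤ 2 * ε := by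
    intro s t hs ht
    rw [abs_le]
    constructor <;> linarith [hs.1, hs.2, ht.1, ht.2]
  have hY0 : 0 ≤ 5 * Y := by linarith
  rw [key]
  calc _ ≤ |p| * |(a₂ - LB) - (a₁ - LA)| + |q| * |(e₂ - LB) - (e₁ + (LA + LB))| +
        |(l₂ - (Y + LB)) - (l₁ - (Y + LA))| := by
        rw [← abs_mul, ← abs_mul]
        exact (abs_sub _ _).trans (add_le_add_left (abs_add_le _ _) _)
    _ ≤ 5 * Y * (2 * ε) + 5 * Y * (2 * ε) + 2 * ε := by
        gcongr
        · exact hp.trans hsum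
        · exact bd ha₂ ha₁
        · exact hq.trans hsum
        · exact bd he₂ he₁
        · exact bd hl₂ hl₁
    _ ≤ _ := by nlinarith

/-- A nontrivial solution has large `y`. -/
lemma sq_le_five_mul_abs {A B : ℝ} (hA : 0 < A) (hAB : 2 * A ≤ B) {x y : ℝ} (hy : 2 ≤ |y|)
    (h₁ : 1 ≤ |x|) (h₂ : 1 ≤ |x - A * y|) (h₃ : 1 ≤ |x - B * y|)
    (h : |x * (x - A * y) * (x - B * y)| ≤ |y| ^ 3 + 1) : A ^ 2 ≤ 5 * |y| := by
  have d12 : A * |y| ≤ |x| + |x - A * y| := by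
    calc A * |y| = |x - (x - A * y)| := by rw [sub_sub_cancel, abs_mul, abs_of_pos hA]
      _ ≤ _ := abs_sub _ _
  have d13 : A * |y| ≤ |x| + |x - B * y| := by
    calc A * |y| ≤ B * |y| := by gcongr; linarith
      _ = |x - (x - B * y)| := by rw [sub_sub_cancel, abs_mul, abs_of_pos (a := B) (by linarith)]
      _ ≤ _ := abs_sub _ _
  have d23 : A * |y| ≤ |x - A * y| + |x - B * y| := by
    calc A * |y| ≤ (B - A) * |y| := by gcongr; linarith
      _ = |(x - A * y) - (x - B * y)| := by
        rw [show (x - A * y) - (x - B * y) = (B - A) * y by ring, abs_mul,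
          abs_of_pos (a := B - A) (by linarith)]
      _ ≤ _ := abs_sub _ _
  rw [abs_mul, abs_mul] at h
  generalize |x| = r at *
  generalize |x - A * y| = s at *
  generalize |x - B * y| = t at *
  generalize |y| = z at *
  set m := A * z / 2 with hm
  have hm0 : 0 ≤ m := by positivity
  have main : m ^ 2 ≤ r * s * t := by
    have two : ∀ {u v w : ℝ}, m ≤ u → m ≤ v → 1 ≤ w → m ^ 2 ≤ u * v * w := by
      intro u v w hu hv hw
      have : m * m ≤ u * v := mul_le_mul hu hv hm0 (hm0.trans hu)
      nlinarith
    rcases le_or_gt m r with hr | hr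
    · rcases le_or_gt m s with hs | hs
      · exact two hr hs h₃
      · have := two hr (show m ≤ t by linarith) h₂
        linarith
    · have := two (show m ≤ s by linarith) (show m ≤ t by linarith) h₁
      linarith
  have h8 : 1 ≤ z ^ 3 / 8 := by
    have : (2 : ℝ) ^ 3 ≤ z ^ 3 := by gcongr
    linarith
  have hz : 0 < z ^ 2 := by positivity
  have : A ^ 2 * z ^ 2 ≤ 5 * z * z ^ 2 := by
    rw [hm] at main
    nlinarith
  exact le_of_mul_le_mul_right this hz

end Reduction

section SmallForm

variable {α : Fin 3 → ℝ}

lemma log_root_approx {a b : ℝ} (ha : 100 ≤ a) (hab : 100 * a ≤ b) (hba : b ≤ a ^ 2)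
    (hord : α 0 < α 1 ∧ α 1 < α 2) (hroot : ∀ i, α i * (α i - a) * (α i - b) - 1 = 0) :
    (|Real.log |α 1| - Real.log a| ≤ 6 * a / b ∧
      |Real.log |α 1 - a| + (Real.log a + Real.log b)| ≤ 6 * a / b) ∧
    (|Real.log |α 0 - a| - Real.log a| ≤ 6 * a / b ∧
      |Real.log |α 0| + (Real.log a + Real.log b)| ≤ 6 * a / b) ∧
    (|Real.log |α 2| - Real.log b| ≤ 6 * a / b ∧
      |Real.log |α 2 - a| - Real.log b| ≤ 6 * a / b) := by
  obtain ⟨⟨h00, h01⟩, ⟨h10, h11⟩, ⟨h20, h21⟩⟩ :=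
    roots_localized (by linarith) (by linarith) hord hroot
  obtain ⟨la0, le1⟩ := log_abs_root (by linarith) (by linarith) hord hroot
  have ha0 : 0 < a := by linarith
  have hb0 : 0 < b := by linarith
  have near_a : ∀ {t : ℝ}, a - 1 ≤ t → t ≤ a → |Real.log t - Real.log a| ≤ 2 * a / b := by
    intro t h1 h2
    refine (abs_log_sub_log_le (m := a / 2) (by linarith) (by linarith) (by linarith)).trans ?_
    rw [div_le_div_iff₀ (by positivity) hb0]
    have : |t - a| ≤ 1 := abs_le.2 ⟨by linarith, by linarith⟩
    nlinarith [abs_nonneg (t - a)]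
  have near_b : ∀ {t : ℝ}, b - a ≤ t → t ≤ b + 1 → |Real.log t - Real.log b| ≤ 2 * a / b := by
    intro t h1 h2
    refine (abs_log_sub_log_le (m := b / 2) (by linarith) (by linarith) (by linarith)).trans ?_
    rw [div_le_div_iff₀ (by positivity) hb0]
    have : |t - b| ≤ a := abs_le.2 ⟨by linarith, by linarith⟩
    nlinarith
  have hε : 0 ≤ 2 * a / b := by positivity
  have h6 : 6 * a / b = 3 * (2 * a / b) := by ring
  have one : ∀ {s : ℝ}, |s| ≤ 2 * a / b → |s| ≤ 6 * a / b := fun h ↦ by rw [h6]; linarith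
  have two : ∀ {s t u v : ℝ}, |s - u| ≤ 2 * a / b → |t - v| ≤ 2 * a / b →
      |-(s + t) + (u + v)| ≤ 6 * a / b := by
    intro s t u v hs ht
    rw [abs_le] at hs ht ⊢
    constructor <;> linarith [hs.1, hs.2, ht.1, ht.2]
  refine ⟨⟨?_, ?_⟩, ⟨?_, ?_⟩, ⟨?_, ?_⟩⟩
  · rw [abs_of_pos (a := α 1) (by linarith)]
    exact one (near_a h10.le h11.le)
  · rw [le1]
    exact two (near_a h10.le h11.le) (near_b (by linarith) (by linarith))
  · rw [abs_sub_comm (α 0), abs_of_pos (a := a - α 0) (by linarith)]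
    exact one (near_a (by linarith) (by linarith))
  · rw [la0]
    exact two (near_a (by linarith) (by linarith)) (near_b (by linarith) (by linarith))
  · rw [abs_of_pos (a := α 2) (by linarith)]
    exact one (near_b (by linarith) (by linarith))
  · rw [abs_of_pos (a := α 2 - a) (by linarith)]
    exact one (near_b (by linarith) (by linarith))

lemma abs_log_sub_log_add_log_le {β β' δ y M k : ℝ} (h : β = β' + δ * y) (hβ' : |β'| ≤ 1)
    (hδ : |(|δ| - M)| ≤ k) (hM : 4 * (k + 1) ≤ M) (hy : 1 ≤ |y|) :
    |Real.log |β| - (Real.log |y| + Real.log M)| ≤ 2 * (k + 1) / M := by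
  have hk : 0 ≤ k := (abs_nonneg _).trans hδ
  have hM0 : 0 < M := by linarith
  have hd : |(|β| - |y| * M)| ≤ (k + 1) * |y| := by
    have h1 : |(|β| - |δ| * |y|)| ≤ 1 := by
      rw [← abs_mul]
      refine (abs_abs_sub_abs_le _ _).trans ?_
      rw [h]
      simpa using hβ'
    have h2 : |(|δ| - M) * (|y|)| ≤ k * |y| := by
      rw [abs_mul, abs_abs]
      gcongr
    calc |(|β| - |y| * M)| = |(|β| - |δ| * |y|) + (|δ| - M) * (|y|)| := by ring_nf
      _ ≤ 1 + k * |y| := (abs_add_le _ _).trans (add_le_add h1 h2)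
      _ ≤ _ := by linarith
  have hy0 : 0 < |y| := by linarith
  have hm : (k + 1) * |y| ≤ |y| * M / 2 := by nlinarith
  rw [← Real.log_mul hy0.ne' hM0.ne']
  refine (abs_log_sub_log_le (m := |y| * M / 2) (by positivity) ?_ ?_).trans ?_
  · linarith [(abs_le.1 hd).1]
  · linarith [mul_pos hy0 hM0]
  · rw [div_le_div_iff₀ (by positivity) hM0]
    nlinarith

/-- Solutions of the Thue equation give small values of a linear form in `log a`, `log b`. -/
lemma exists_small_linearForm {a b : ℤ} (ha : 100 ≤ (a : ℝ)) (hab : 100 * (a : ℝ) ≤ b)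
    (hba : (b : ℝ) ≤ a ^ 2) (hord : α 0 < α 1 ∧ α 1 < α 2)
    (hroot : ∀ i, α i * (α i - a) * (α i - b) - 1 = 0) {x y : ℤ}
    (heq : x * (x - a * y) * (x - b * y) - y ^ 3 = 1 ∨
      x * (x - a * y) * (x - b * y) - y ^ 3 = -1) (hy : 2 ≤ |y|) {j : Fin 3} (hj : j = 0 ∨ j = 1)
    (hmin : ∀ i, |x - α j * y| ≤ |x - α i * y|) (hY : 2 * Real.log a - 2 ≤ Real.log |(y : ℝ)|)
    (hsmall : 6 * (a : ℝ) / b ≤ 1) :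
    ∃ p q : ℤ, ¬(p = 1 ∧ q = 0) ∧ |(p : ℝ)| ≤ 5 * Real.log |(y : ℝ)| ∧
      |(q : ℝ)| ≤ 5 * Real.log |(y : ℝ)| ∧
      |(p - 1 - q) * Real.log a - (p - 1 + 2 * q) * Real.log b| ≤
        22 * Real.log |(y : ℝ)| * (6 * a / b) := by
  obtain ⟨⟨h00, h01⟩, ⟨h10, h11⟩, ⟨h20, h21⟩⟩ :=
    roots_localized (by linarith) (by linarith) hord hroot
  obtain ⟨⟨A1, E1⟩, ⟨E0, A0⟩, ⟨A2, E2⟩⟩ := log_root_approx ha hab hba hord hroot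
  have ha0 : (0 : ℝ) < a := by linarith
  have hb0 : (0 : ℝ) < b := by linarith
  have hyR : 1 ≤ |(y : ℝ)| := by
    have : (2 : ℝ) ≤ |(y : ℝ)| := by exact_mod_cast hy
    linarith
  obtain ⟨oβ, oβ'⟩ := IsOrderElement.linear hroot heq
  have hnorm : |(x - α 0 * y) * (x - α 1 * y) * (x - α 2 * y)| = 1 := by
    rw [prod_sub_mul hord hroot]
    rcases heq with h | h
    · have h' : (x * (x - a * y) * (x - b * y) - y ^ 3 : ℝ) = 1 := by exact_mod_cast h
      rw [h', abs_one]
    · have h' : (x * (x - a * y) * (x - b * y) - y ^ 3 : ℝ) = -1 := by exact_mod_cast h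
      rw [h', abs_neg, abs_one]
  have hβj : |x - α j * y| ≤ 1 := by
    by_contra! hlt
    have g0 := hlt.trans_le (hmin 0)
    have g1 := hlt.trans_le (hmin 1)
    have g2 := hlt.trans_le (hmin 2)
    rw [abs_mul, abs_mul] at hnorm
    have := one_lt_mul_of_lt_of_le (one_lt_mul_of_lt_of_le g0 g1.le) g2.le
    linarith
  obtain ⟨p, q, hpq⟩ := oβ.exists_eq_zpow_mul_zpow ha (by linarith) hord hroot oβ' hnorm
  have hα0 : ∀ i, α i ≠ 0 := fun i h ↦ by simpa [h] using hroot i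
  have hη0 : ∀ i, α i - a ≠ 0 := fun i h ↦ by simpa [h] using hroot i
  have hlog : ∀ i, Real.log |x - α i * y| = p * Real.log |α i| + q * Real.log |α i - a| := by
    intro i
    have : |x - α i * y| = |α i| ^ p * |α i - a| ^ q := by
      rcases hpq with h | h
      · rw [h, abs_mul, abs_zpow, abs_zpow]
      · rw [h, abs_neg, abs_mul, abs_zpow, abs_zpow]
    rw [this, Real.log_mul (zpow_ne_zero _ (by simpa using hα0 i))
      (zpow_ne_zero _ (by simpa using hη0 i)), Real.log_zpow, Real.log_zpow]
  have hy1 : y ≠ 1 ∧ y ≠ -1 := ⟨by rintro rfl; simp at hy, by rintro rfl; simp at hy⟩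
  have no_linear : ∀ c e : ℝ, (e = 1 ∨ e = -1) → ¬ ∀ i, x - α i * y = e * (α i - c) := by
    intro c e he h
    obtain ⟨-, h2, -⟩ := coeff_eq_zero_of_roots (u := x + e * c) (v := -y - e) (w := 0)
      hord.1.ne (hord.1.trans hord.2).ne hord.2.ne (fun i ↦ by linear_combination h i)
    rcases he with rfl | rfl
    · exact hy1.2 (by exact_mod_cast (by linarith : (y : ℝ) = -1))
    · exact hy1.1 (by exact_mod_cast (by linarith : (y : ℝ) = 1))
  have l4 : 4 ≤ Real.log (a : ℝ) := by
    rw [Real.le_log_iff_exp_le ha0]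
    have h4 : Real.exp 4 = Real.exp 1 ^ 4 := by rw [← Real.exp_nat_mul]; norm_num
    rw [h4]
    calc Real.exp 1 ^ 4 ≤ (2.72 : ℝ) ^ 4 := by
          gcongr; linarith [Real.exp_one_lt_d9]
      _ ≤ 100 := by norm_num
      _ ≤ _ := ha
  have lab : Real.log (a : ℝ) ≤ Real.log b := Real.log_le_log ha0 (by linarith)
  have lba : Real.log (b : ℝ) ≤ 2 * Real.log a := by
    have := Real.log_le_log hb0 hba
    rwa [Real.log_pow] at this
  have ea : 2 * ((2 : ℝ) + 1) / a ≤ 6 * a / b := by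
    rw [div_le_div_iff₀ ha0 hb0]; nlinarith
  have eb : 2 * ((a : ℝ) + 1) / b ≤ 6 * a / b := by
    rw [div_le_div_iff_of_pos_right hb0]; linarith
  rcases hj with rfl | rfl
  · refine ⟨p, q, ?_, ?_⟩
    · rintro ⟨rfl, rfl⟩
      rcases hpq with h | h
      · exact no_linear 0 1 (.inl rfl) fun i ↦ by simpa using h i
      · exact no_linear 0 (-1) (.inr rfl) fun i ↦ by simpa using h i
    · exact abs_linearForm_le l4 lab lba hY hsmall A1 E1 A2 E2
        ((abs_log_sub_log_add_log_le (δ := α 0 - α 1) (by ring) hβj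
          (by rw [abs_of_neg (a := α 0 - α 1) (by linarith), abs_le]; constructor <;> linarith)
          (by linarith) hyR).trans ea)
        ((abs_log_sub_log_add_log_le (δ := α 0 - α 2) (by ring) hβj
          (by rw [abs_of_neg (a := α 0 - α 2) (by linarith), abs_le]; constructor <;> linarith)
          (by linarith) hyR).trans eb)
        (hlog 1) (hlog 2)
  · refine ⟨q, p, ?_, ?_⟩
    · rintro ⟨rfl, rfl⟩
      rcases hpq with h | h
      · exact no_linear a 1 (.inl rfl) fun i ↦ by simpa using h i
      · exact no_linear a (-1) (.inr rfl) fun i ↦ by simpa using h i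
    · exact abs_linearForm_le l4 lab lba hY hsmall E0 A0 E2 A2
        ((abs_log_sub_log_add_log_le (δ := α 1 - α 0) (by ring) hβj
          (by rw [abs_of_pos (a := α 1 - α 0) (by linarith), abs_le]; constructor <;> linarith)
          (by linarith) hyR).trans ea)
        ((abs_log_sub_log_add_log_le (δ := α 1 - α 2) (by ring) hβj
          (by rw [abs_of_neg (a := α 1 - α 2) (by linarith), abs_le]; constructor <;> linarith)
          (by linarith) hyR).trans eb)
        ((hlog 0).trans (add_comm _ _)) ((hlog 2).trans (add_comm _ _))

end SmallForm

section Fibonacci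

open Real

lemma goldenRatio_bounds : 1.618 < goldenRatio ∧ goldenRatio < 1.6181 := by
  have h1 : (2.236 : ℝ) < √5 := Real.lt_sqrt_of_sq_lt (by norm_num)
  have h2 : √5 < 2.2362 := (Real.sqrt_lt' (by norm_num)).2 (by norm_num)
  unfold goldenRatio
  constructor <;> linarith

lemma abs_goldenConj_pow_le_one (n : ℕ) : |goldenConj ^ n| ≤ 1 := by
  rw [abs_pow]
  exact pow_le_one₀ (abs_nonneg _) (abs_le.2 ⟨neg_one_lt_goldenConj.le, by
    linarith [goldenConj_neg]⟩)

lemma twenty_mul_two_pow_le {n : ℕ} (hn : 1000 < n) :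
    (20 : ℝ) * 2 ^ n ≤ (goldenRatio ^ n) ^ 2 := by
  have h1 : (2 * 1.3 : ℝ) ≤ goldenRatio ^ 2 := by nlinarith [goldenRatio_bounds.1]
  have h2 : (20 : ℝ) ≤ 1.3 ^ n := by
    have := one_add_mul_le_pow (show (-2 : ℝ) ≤ 0.3 by norm_num) n
    have hn' : (1000 : ℝ) < n := by exact_mod_cast hn
    norm_num at this ⊢
    linarith
  calc (20 : ℝ) * 2 ^ n ≤ 1.3 ^ n * 2 ^ n := by gcongr
    _ = (2 * 1.3) ^ n := by rw [mul_pow, mul_comm]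
    _ ≤ (goldenRatio ^ 2) ^ n := by gcongr
    _ = _ := by rw [← pow_mul, ← pow_mul, mul_comm]

lemma fib_bounds {n : ℕ} (hn : 1000 < n) :
    goldenRatio ^ n / 3 ≤ (Nat.fib n : ℝ) ∧ (Nat.fib n : ℝ) ≤ goldenRatio ^ n := by
  have hφ := goldenRatio_bounds
  have h20 := twenty_mul_two_pow_le hn
  have h1 : (2.236 : ℝ) < √5 := Real.lt_sqrt_of_sq_lt (by norm_num)
  have h2 : √5 < 2.2362 := (Real.sqrt_lt' (by norm_num)).2 (by norm_num)
  have hψ := abs_le.1 (abs_goldenConj_pow_le_one n)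
  have hp : 20 ≤ goldenRatio ^ n := by
    have hn' : (1000 : ℝ) < n := by exact_mod_cast hn
    have := one_add_mul_le_pow (show (-2 : ℝ) ≤ goldenRatio - 1 by linarith) n
    rw [add_sub_cancel] at this
    nlinarith
  rw [coe_fib_eq, le_div_iff₀ (by linarith), div_le_iff₀ (by linarith)]
  constructor <;> nlinarith

lemma two_pow_le_fib_sq {n : ℕ} (hn : 1000 < n) : (2 : ℝ) ^ n ≤ (Nat.fib n : ℝ) ^ 2 := by
  have h := (fib_bounds hn).1
  have h20 := twenty_mul_two_pow_le hn
  have : (0 : ℝ) < goldenRatio ^ n := pow_pos goldenRatio_pos n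
  have h' : (goldenRatio ^ n / 3) ^ 2 ≤ (Nat.fib n : ℝ) ^ 2 := by gcongr
  have h2 : (0 : ℝ) < 2 ^ n := by positivity
  nlinarith

lemma fib_div_two_pow_le {n : ℕ} (hn : 1000 < n) :
    (Nat.fib n : ℝ) / 2 ^ n ≤ Real.exp (-(0.2 * n)) := by
  have hexp : Real.exp 0.2 ≤ 1.23 := by
    refine le_of_pow_le_pow_left₀ (n := 5) (by norm_num) (by norm_num) ?_
    rw [← Real.exp_nat_mul]
    norm_num
    linarith [Real.exp_one_lt_d9]
  have hφ := goldenRatio_bounds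
  have h0 : 0 < goldenRatio := goldenRatio_pos
  rw [div_le_iff₀ (by positivity), Real.exp_neg, inv_mul_eq_div, le_div_iff₀ (Real.exp_pos _)]
  calc (Nat.fib n : ℝ) * Real.exp (0.2 * n) ≤ goldenRatio ^ n * Real.exp 0.2 ^ n := by
        rw [← Real.exp_nat_mul, mul_comm (n : ℝ)]
        gcongr
        exact (fib_bounds hn).2
    _ = (goldenRatio * Real.exp 0.2) ^ n := (mul_pow _ _ _).symm
    _ ≤ 2 ^ n := by
        gcongr
        nlinarith [Real.exp_pos 0.2]

lemma abs_log_fib_sub_le {n : ℕ} (hn : 1000 < n) :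
    |Real.log (Nat.fib n) - (n * Real.log goldenRatio - Real.log √5)| ≤ Nat.fib n / 2 ^ n := by
  have h20 := twenty_mul_two_pow_le hn
  have hb := fib_bounds hn
  have hp : (0 : ℝ) < goldenRatio ^ n := pow_pos goldenRatio_pos n
  have h2 : (0 : ℝ) < 2 ^ n := by positivity
  have h5 : (0 : ℝ) < √5 := by positivity
  have hψ := abs_goldenConj_pow_le_one n
  have h5' : (2 : ℝ) < √5 := Real.lt_sqrt_of_sq_lt (by norm_num)
  have hfib : (Nat.fib n : ℝ) * √5 = goldenRatio ^ n - goldenConj ^ n := by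
    rw [coe_fib_eq]; field_simp
  have hf0 : (0 : ℝ) < Nat.fib n := lt_of_lt_of_le (by positivity) hb.1
  have e : Real.log (Nat.fib n) - (n * Real.log goldenRatio - Real.log √5) =
      Real.log (Nat.fib n * √5) - Real.log (goldenRatio ^ n) := by
    rw [Real.log_mul hf0.ne' h5.ne', Real.log_pow]; ring
  rw [e]
  refine (abs_log_sub_log_le (m := goldenRatio ^ n / 2) (by positivity) (by nlinarith)
    (by linarith)).trans ?_
  rw [hfib, sub_sub_cancel_left, abs_neg, div_le_div_iff₀ (by positivity) h2]
  nlinarith [mul_le_mul_of_nonneg_right hb.1 hp.le]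

end Fibonacci

section Final

open Real

lemma sq_le_of_solution {a b : ℝ} (ha : 0 < a) (hab : 2 * a ≤ b) {a' b' x y : ℤ}
    (haa : a = a') (hbb : b = b') (heq : x * (x - a' * y) * (x - b' * y) - y ^ 3 = 1 ∨
      x * (x - a' * y) * (x - b' * y) - y ^ 3 = -1) (hy : 2 ≤ |y|) : a ^ 2 ≤ 5 * |(y : ℝ)| := by
  subst haa hbb
  obtain ⟨T, hT, hT'⟩ : ∃ T : ℤ, x * (x - a' * y) * (x - b' * y) = T ∧
      (T - y ^ 3 = 1 ∨ T - y ^ 3 = -1) := ⟨_, rfl, heq⟩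
  have hyR : 2 ≤ |(y : ℝ)| := by exact_mod_cast hy
  have hy8 : 8 ≤ |y ^ 3| := by
    rw [abs_pow]
    exact pow_le_pow_left₀ (by norm_num) hy 3
  have hT1 : |T - y ^ 3| = 1 := by rcases hT' with h | h <;> simp [h]
  have hT0 : T ≠ 0 := by
    rintro rfl
    rw [zero_sub, abs_neg] at hT1
    omega
  rw [← hT] at hT0
  have hne := mul_ne_zero_iff.1 hT0
  have hne' := mul_ne_zero_iff.1 hne.1
  refine sq_le_five_mul_abs ha hab (x := x) hyR (by exact_mod_cast Int.one_le_abs hne'.1)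
    (by exact_mod_cast Int.one_le_abs hne'.2) (by exact_mod_cast Int.one_le_abs hne.2) ?_
  have hTR : (x * (x - a' * y) * (x - b' * y) : ℝ) = T := by exact_mod_cast hT
  have hT1R : |(T - y ^ 3 : ℝ)| = 1 := by exact_mod_cast hT1
  rw [hTR, ← abs_pow, ← hT1R]
  calc |(T : ℝ)| = |(y : ℝ) ^ 3 + (T - y ^ 3)| := by rw [add_sub_cancel]
    _ ≤ _ := abs_add_le _ _

lemma le_of_sq_le_exp {N h : ℝ} (hN : 1000 < N) (hh : N = 5.7e12 * h)
    (hle : N ^ 2 / 2 ≤ Real.exp (h - 4)) : 64 ≤ h := by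
  have h4 : 4 < h := by
    have : Real.exp 0 < Real.exp (h - 4) := by rw [Real.exp_zero]; nlinarith
    linarith [Real.exp_lt_exp.1 this]
  have hexp : Real.exp 60 ≤ 2.5 * 10 ^ 26 := by
    have : Real.exp 60 = Real.exp 1 ^ 60 := by rw [← Real.exp_nat_mul]; norm_num
    rw [this]
    calc Real.exp 1 ^ 60 ≤ (2.7183 : ℝ) ^ 60 := by
          gcongr; linarith [Real.exp_one_lt_d9]
      _ ≤ _ := by norm_num
  have hN' : 2.28 * 10 ^ 13 ≤ N := by rw [hh]; linarith
  have : Real.exp 60 ≤ Real.exp (h - 4) := by nlinarith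
  linarith [Real.exp_le_exp.1 this]

/-- The linear form attached to a solution contradicts the lower bound for linear forms in
logarithms. -/
lemma false_of_small_linearForm {n : ℕ} {P Q : ℤ} {Y h : ℝ} (hh : (n : ℝ) = 5.7e12 * h)
    (h64 : 64 ≤ h) (hY : (n : ℝ) * Y ≤ Real.exp (h - 4)) (hP : |(P : ℝ)| ≤ 16 * Y)
    (hQ : |(Q : ℝ)| ≤ 16 * Y) (hQ0 : Q ≠ 0)
    (hΛ : |P * (n * Real.log goldenRatio - Real.log √5) - Q * (n * Real.log 2)| ≤
      200 * Y * Real.exp (-(0.2 * n))) : False := by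
  set d := ⌈h / 2⌉₊ with hd
  have hd1 : h / 2 ≤ d := Nat.le_ceil _
  have hd2 : (d : ℝ) < h / 2 + 1 := Nat.ceil_lt_add_one (by linarith)
  have hn1 : (1 : ℝ) ≤ n := by rw [hh]; linarith
  have hn0 : n ≠ 0 := by rintro rfl; norm_num at hn1
  have hY0 : 0 ≤ Y := by linarith [abs_nonneg (P : ℝ)]
  have hl2 := Real.log_two_gt_d9
  have hl2' := Real.log_two_lt_d9
  have hsize : 2 ^ 26 * (16 * Real.exp (h - 4)) ≤ (16 : ℝ) ^ d := by
    have e1 : (2 : ℝ) ^ 30 = Real.exp (30 * Real.log 2) := by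
      rw [← Real.exp_log (show (0 : ℝ) < 2 ^ 30 by positivity), Real.log_pow]; norm_num
    have e2 : (16 : ℝ) ^ d = Real.exp (d * (4 * Real.log 2)) := by
      rw [← Real.exp_log (show (0 : ℝ) < 16 ^ d by positivity), Real.log_pow,
        show (16 : ℝ) = 2 ^ 4 by norm_num, Real.log_pow]
      norm_num
    calc 2 ^ 26 * (16 * Real.exp (h - 4)) = 2 ^ 30 * Real.exp (h - 4) := by ring
      _ = Real.exp (30 * Real.log 2 + (h - 4)) := by rw [e1, Real.exp_add]
      _ ≤ (16 : ℝ) ^ d := by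
          rw [e2, Real.exp_le_exp]
          nlinarith
  have hcoef : ∀ {R : ℤ}, |(R : ℝ)| ≤ 16 * Y → 2 ^ 26 * (n * |(R : ℝ)|) ≤ (16 : ℝ) ^ d := by
    intro R hR
    refine le_trans (mul_le_mul_of_nonneg_left ?_ (by positivity)) hsize
    nlinarith
  have hbaker := exp_neg_le_abs_linearForm (d := d) (b₁ := n * P) (b₂ := -P) (b₃ := -(n * Q))
    (by have : (25 : ℝ) ≤ d := by linarith
        exact_mod_cast this)
    (neg_ne_zero.2 (mul_ne_zero (by exact_mod_cast hn0) hQ0))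
    (by push_cast; rw [abs_mul, Nat.abs_cast]; exact hcoef hP)
    (by push_cast
        rw [abs_neg]
        refine le_trans ?_ (hcoef hP)
        gcongr
        exact le_mul_of_one_le_left (abs_nonneg _) hn1)
    (by push_cast; rw [abs_neg, abs_mul, Nat.abs_cast]; exact hcoef hQ)
  have hΛ' : ((n * P : ℤ) : ℝ) * Real.log goldenRatio + ((-P : ℤ) : ℝ) * Real.log √5 +
      ((-(n * Q) : ℤ) : ℝ) * Real.log 2 =
      P * (n * Real.log goldenRatio - Real.log √5) - Q * (n * Real.log 2) := by
    push_cast; ring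
  rw [hΛ'] at hbaker
  have h200 : 200 * Y ≤ Real.exp (h + 6) := by
    have hY' : Y ≤ Real.exp (h - 4) := by nlinarith
    have e10 : (200 : ℝ) ≤ Real.exp 10 := by
      have : Real.exp 10 = Real.exp 1 ^ 10 := by rw [← Real.exp_nat_mul]; norm_num
      rw [this]
      calc (200 : ℝ) ≤ 2.7 ^ 10 := by norm_num
        _ ≤ _ := by gcongr; linarith [Real.exp_one_gt_d9]
    calc 200 * Y ≤ Real.exp 10 * Real.exp (h - 4) := by gcongr
      _ = _ := by rw [← Real.exp_add]; ring_nf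
  have hfin : Real.exp (-(2 * 10 ^ 12) * d) ≤ Real.exp (h + 6 + -(0.2 * n)) := by
    rw [Real.exp_add]
    refine hbaker.trans (hΛ.trans ?_)
    gcongr
  have := Real.exp_le_exp.1 hfin
  rw [hh] at this
  linarith

end Final

/-- For `n > 1000`, a solution `(x, y)` with `|y| ≥ 2` whose type `j` is `1` or `2`
(indices `0` or `1` here) satisfies `log |y| > exp(n/(5.7·10¹²) - log n - 4)`. -/
theorem lower_bound_log_y_type12 (n : ℕ) (hn : 1000 < n)
    (α : Fin 3 → ℝ)
    (hord : α 0 < α 1 ∧ α 1 < α 2)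
    (hroot : ∀ i, α i * (α i - (Nat.fib n : ℝ)) * (α i - 2 ^ n) - 1 = 0)
    (x y : ℤ)
    (heq : x * (x - (Nat.fib n : ℤ) * y) * (x - 2 ^ n * y) - y ^ 3 = 1 ∨
           x * (x - (Nat.fib n : ℤ) * y) * (x - 2 ^ n * y) - y ^ 3 = -1)
    (hy : 2 ≤ |y|)
    (β : Fin 3 → ℝ) (hβ : ∀ i, β i = (x : ℝ) - α i * (y : ℝ))
    (j : Fin 3) (hj : j = 0 ∨ j = 1) (hmin : ∀ i, |β j| ≤ |β i|) :
    Real.log (|(y : ℝ)|) >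
      Real.exp ((n : ℝ) / 5.7e12 - Real.log (n : ℝ) - 4) := by
  by_contra! hcon
  have hnR : (1000 : ℝ) < n := by exact_mod_cast hn
  have hn0 : (0 : ℝ) < n := by linarith
  have hyR : 2 ≤ |(y : ℝ)| := by exact_mod_cast hy
  have hy0 : 0 < |(y : ℝ)| := by linarith
  set Y := Real.log |(y : ℝ)| with hYdef
  set h := (n : ℝ) / 5.7e12 with hdef
  have hh : (n : ℝ) = 5.7e12 * h := by rw [hdef]; field_simp
  have hY : (n : ℝ) * Y ≤ Real.exp (h - 4) := by
    have e : Real.exp (h - 4) = n * Real.exp (h - Real.log n - 4) := by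
      conv_rhs => rw [← Real.exp_log hn0]
      rw [← Real.exp_add, Real.exp_log hn0]
      ring_nf
    rw [e]
    gcongr
  have hF2 := two_pow_le_fib_sq hn
  have hratio := fib_div_two_pow_le hn
  have h2n : (2 : ℝ) ^ n = ((2 ^ n : ℤ) : ℝ) := by push_cast; rfl
  have hFn : (Nat.fib n : ℝ) = ((Nat.fib n : ℤ) : ℝ) := by push_cast; rfl
  have hpow : (10000 : ℝ) ≤ 2 ^ n := by
    calc (10000 : ℝ) ≤ 2 ^ 14 := by norm_num
      _ ≤ 2 ^ n := pow_le_pow_right₀ (by norm_num) (by omega)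
  have hF : (100 : ℝ) ≤ Nat.fib n := by
    refine le_of_sq_le_sq ?_ (by positivity)
    linarith
  have hF0 : (0 : ℝ) < Nat.fib n := by linarith
  have hsmall : (Nat.fib n : ℝ) / 2 ^ n ≤ 1 / 100 := by
    refine hratio.trans ?_
    rw [Real.exp_neg, ← one_div]
    refine one_div_le_one_div_of_le (by norm_num) ?_
    linarith [Real.add_one_le_exp (0.2 * n : ℝ)]
  have hFB : 100 * (Nat.fib n : ℝ) ≤ 2 ^ n := by
    rw [div_le_div_iff₀ (by positivity) (by norm_num)] at hsmall
    linarith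
  have hsq : (Nat.fib n : ℝ) ^ 2 ≤ 5 * |(y : ℝ)| :=
    sq_le_of_solution hF0 (by linarith) hFn h2n heq hy
  have hYlow : 2 * Real.log (Nat.fib n) - 2 ≤ Y := by
    have h1 := Real.log_le_log (by positivity) hsq
    rw [Real.log_pow, Real.log_mul (by norm_num) hy0.ne'] at h1
    have h5 : Real.log 5 ≤ 2 := by
      rw [Real.log_le_iff_le_exp (by norm_num)]
      have : Real.exp 2 = Real.exp 1 ^ 2 := by rw [← Real.exp_nat_mul]; norm_num
      nlinarith [Real.exp_one_gt_d9]
    push_cast at h1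
    linarith
  have hlogF : n * Real.log 2 ≤ 2 * Real.log (Nat.fib n) := by
    have := Real.log_le_log (by positivity) hF2
    rwa [Real.log_pow, Real.log_pow] at this
  have hYn : (n : ℝ) / 2 ≤ Y := by nlinarith [Real.log_two_gt_d9]
  have h64 : 64 ≤ h := le_of_sq_le_exp hnR hh (le_trans (by nlinarith) hY)
  obtain ⟨p, q, hpq, hp, hq, hΛ⟩ := exists_small_linearForm (a := Nat.fib n) (b := 2 ^ n)
    (by rwa [← hFn]) (by rwa [← hFn, ← h2n]) (by rwa [← hFn, ← h2n]) hord
    (by rwa [← hFn, ← h2n]) heq hy hj (by simpa only [hβ] using hmin) (by rwa [← hFn])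
    (by rw [← hFn, ← h2n, mul_div_assoc]; linarith)
  rw [← hFn, ← h2n, ← hYdef, Real.log_pow] at hΛ
  set r := (Nat.fib n : ℝ) / 2 ^ n with hr
  have hr0 : 0 ≤ r := by positivity
  have hY1 : 1 ≤ Y := by linarith
  rw [mul_div_assoc, ← hr] at hΛ
  have hP : |((p - 1 - q : ℤ) : ℝ)| ≤ 16 * Y := by
    push_cast
    rw [abs_le] at hp hq ⊢
    constructor <;> linarith [hp.1, hp.2, hq.1, hq.2]
  have hQ : |((p - 1 + 2 * q : ℤ) : ℝ)| ≤ 16 * Y := by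
    push_cast
    rw [abs_le] at hp hq ⊢
    constructor <;> linarith [hp.1, hp.2, hq.1, hq.2]
  refine false_of_small_linearForm hh h64 hY hP hQ ?_ ?_
  · intro hQ0
    have hP0 : p - 1 - q ≠ 0 := by omega
    have hP1 : (1 : ℝ) ≤ |(p - 1 - q : ℝ)| := by exact_mod_cast Int.one_le_abs hP0
    have hQ0' : (p - 1 + 2 * q : ℝ) = 0 := by exact_mod_cast hQ0
    rw [hQ0', zero_mul, sub_zero, abs_mul] at hΛ
    have hL : 200 ≤ |Real.log (Nat.fib n)| := by
      refine le_trans ?_ (le_abs_self _)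
      nlinarith [Real.log_two_gt_d9]
    have hsm : Y * r ≤ 1 := by
      calc Y * r ≤ Real.exp (h - 4) * Real.exp (-(0.2 * n)) := by
            gcongr
            nlinarith
        _ = Real.exp (h - 4 + -(0.2 * n)) := by rw [Real.exp_add]
        _ ≤ 1 := by
            rw [Real.exp_le_one_iff, hh]
            linarith
    have h200 := mul_le_mul hP1 hL (by norm_num) (abs_nonneg _)
    have hring : 22 * Y * (6 * r) = 132 * (Y * r) := by ring
    linarith
  · have hb := abs_log_fib_sub_le hn
    push_cast at hP ⊢
    calc _ = |((p - 1 - q) * Real.log (Nat.fib n) - (p - 1 + 2 * q) * (n * Real.log 2)) -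
          (p - 1 - q) * (Real.log (Nat.fib n) -
            (n * Real.log Real.goldenRatio - Real.log √5))| := by ring_nf
      _ ≤ 22 * Y * (6 * r) + 16 * Y * r := by
          refine (abs_sub _ _).trans (add_le_add hΛ ?_)
          rw [abs_mul]
          gcongr
      _ = 148 * Y * r := by ring
      _ ≤ 200 * Y * r := by gcongr; norm_num
      _ ≤ _ := by gcongr
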